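/- arXiv:1301.0792 — 10 statements merged into one kernel-verified Lean document; each statement's English description precedes it below -/
import Mathlib

section
/- Let p be a prime and let A be a perfectoid uniform Banach ℚ_p-algebra. Then for every nonnegative integer m and every x ∈ A, there exists y ∈ A such that ‖x − y^p‖ ≤ p^{−1−p^{−1}−p^{−2}−⋯−p^{−m}}·‖x‖. -/
/-- A uniform Banach `ℚ_p`-algebra: a commutative ring complete with respect to a
power-multiplicative nonarchimedean norm, in which `p` is invertible and
`‖p·x‖ = p⁻¹·‖x‖` for all `x`. -/
structure UniformBanachQpAlgebra (p : ℕ) (A : Type*) [CommRing A] where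
  nrm : A → ℝ
  nonneg : ∀ x, 0 ≤ nrm x
  eq_zero_iff : ∀ x, nrm x = 0 ↔ x = 0
  nonarch : ∀ x y, nrm (x + y) ≤ max (nrm x) (nrm y)
  submul : ∀ x y, nrm (x * y) ≤ nrm x * nrm y
  powmul : ∀ (x : A) (n : ℕ), 1 ≤ n → nrm (x ^ n) = nrm x ^ n
  isUnit_p : IsUnit (p : A)
  nrm_p_mul : ∀ x : A, nrm ((p : A) * x) = (p : ℝ)⁻¹ * nrm x
  complete : ∀ u : ℕ → A,
    (∀ ε : ℝ, 0 < ε → ∃ N : ℕ, ∀ m ≥ N, ∀ n ≥ N, nrm (u m - u n) < ε) →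
    ∃ x : A, ∀ ε : ℝ, 0 < ε → ∃ N : ℕ, ∀ n ≥ N, nrm (u n - x) < ε

/-- A uniform Banach `ℚ_p`-algebra is perfectoid if Frobenius is surjective on
`𝔬_A/(p)` and there exists `z` with `‖z‖ ≤ 1` and `‖z^p − p‖ ≤ p⁻²`. -/
def UniformBanachQpAlgebra.IsPerfectoid {p : ℕ} {A : Type*} [CommRing A]
    (ν : UniformBanachQpAlgebra p A) : Prop :=
  (∀ x : A, ν.nrm x ≤ 1 → ∃ y : A, ν.nrm y ≤ 1 ∧ ν.nrm (x - y ^ p) ≤ (p : ℝ)⁻¹) ∧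
  ∃ z : A, ν.nrm z ≤ 1 ∧ ν.nrm (z ^ p - (p : A)) ≤ ((p : ℝ) ^ 2)⁻¹

namespace UniformBanachQpAlgebra

variable {p : ℕ} {A : Type*} [CommRing A] (ν : UniformBanachQpAlgebra p A)

theorem nrm_zero : ν.nrm 0 = 0 := (ν.eq_zero_iff 0).2 rfl

theorem nrm_neg (x : A) : ν.nrm (-x) = ν.nrm x := by
  have h := ν.powmul (-x) 2 (by norm_num)
  rw [neg_sq, ν.powmul x 2 (by norm_num)] at h
  exact ((sq_eq_sq₀ (ν.nonneg _) (ν.nonneg _)).1 h).symm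

theorem nrm_sub_comm (x y : A) : ν.nrm (x - y) = ν.nrm (y - x) := by
  rw [← ν.nrm_neg, neg_sub]

theorem nrm_add_le {x y : A} {c : ℝ} (hx : ν.nrm x ≤ c) (hy : ν.nrm y ≤ c) :
    ν.nrm (x + y) ≤ c :=
  (ν.nonarch x y).trans (max_le hx hy)

theorem nrm_sub_le {x y : A} {c : ℝ} (hx : ν.nrm x ≤ c) (hy : ν.nrm y ≤ c) :
    ν.nrm (x - y) ≤ c := by
  rw [sub_eq_add_neg]
  exact ν.nrm_add_le hx (by rwa [ν.nrm_neg])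

theorem nrm_le_of_sub_le {x y : A} {c : ℝ} (hx : ν.nrm x ≤ c) (h : ν.nrm (x - y) ≤ c) :
    ν.nrm y ≤ c := by
  have := ν.nrm_sub_le hx h
  rwa [sub_sub_cancel] at this

theorem nrm_eq_of_sub_lt {x y : A} (h : ν.nrm (x - y) < ν.nrm x) : ν.nrm y = ν.nrm x := by
  refine le_antisymm (ν.nrm_le_of_sub_le le_rfl h.le) (le_of_not_gt fun hy ↦ ?_)
  have := ν.nonarch (x - y) y
  rw [sub_add_cancel] at this
  exact absurd this (not_le.2 (max_lt h hy))

theorem nrm_one_le : ν.nrm 1 ≤ 1 := by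
  have h := ν.powmul 1 2 (by norm_num)
  rw [one_pow] at h
  nlinarith [ν.nonneg 1]

theorem nrm_natCast_le (n : ℕ) : ν.nrm (n : A) ≤ 1 := by
  induction n with
  | zero => simp [ν.nrm_zero]
  | succ n ih => rw [Nat.cast_succ]; exact ν.nrm_add_le ih ν.nrm_one_le

theorem nrm_sum_le {ι : Type*} (s : Finset ι) (f : ι → A) {c : ℝ} (hc : 0 ≤ c)
    (h : ∀ i ∈ s, ν.nrm (f i) ≤ c) : ν.nrm (∑ i ∈ s, f i) ≤ c :=
  Finset.sum_induction f (fun a ↦ ν.nrm a ≤ c) (fun _ _ ↦ ν.nrm_add_le)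
    (by rwa [ν.nrm_zero]) h

theorem nrm_mul_le {x y : A} {a b : ℝ} (hx : ν.nrm x ≤ a) (hy : ν.nrm y ≤ b) :
    ν.nrm (x * y) ≤ a * b :=
  (ν.submul x y).trans (mul_le_mul hx hy (ν.nonneg _) ((ν.nonneg _).trans hx))

theorem nrm_pow_le {x : A} {a : ℝ} (hx : ν.nrm x ≤ a) {n : ℕ} (hn : 1 ≤ n) :
    ν.nrm (x ^ n) ≤ a ^ n := by
  rw [ν.powmul x n hn]
  exact pow_le_pow_left₀ (ν.nonneg _) hx n

/-- The Frobenius map is additive up to an error controlled by the size of one summand. -/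
theorem nrm_sub_add_pow_le (hp : p.Prime) {w v : A} {a s : ℝ} (hs : 0 ≤ s) (hs1 : s ≤ 1)
    (hw : ν.nrm w ≤ a) (hv : ν.nrm v ≤ a * s) :
    ν.nrm (w ^ p + v ^ p - (w + v) ^ p) ≤ (p : ℝ)⁻¹ * (a ^ p * s) := by
  have ha : 0 ≤ a := (ν.nonneg w).trans hw
  rw [add_pow_prime_eq' hp, sub_add_cancel_left, ν.nrm_neg, ν.nrm_p_mul]
  refine mul_le_mul_of_nonneg_left ?_ (by positivity)
  refine ν.nrm_sum_le _ _ (by positivity) fun k hk ↦ ?_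
  obtain ⟨hk0, hkp⟩ := Finset.mem_Ioo.1 hk
  have h1 : ν.nrm (w ^ k * v ^ (p - k)) ≤ a ^ k * (a * s) ^ (p - k) :=
    ν.nrm_mul_le (ν.nrm_pow_le hw hk0) (ν.nrm_pow_le hv (by omega))
  have h2 := ν.nrm_mul_le h1 (ν.nrm_natCast_le (p.choose k / p))
  refine h2.trans ?_
  rw [mul_one, mul_pow, ← mul_assoc, ← pow_add, Nat.add_sub_cancel' hkp.le]
  exact mul_le_mul_of_nonneg_left (pow_le_of_le_one hs hs1 (by omega)) (by positivity)

/-- An element whose `p`-th power is close to `p` has a multiplicative norm. -/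
theorem nrm_mul_eq_of_pow_sub_p (hp : p.Prime) {q : ℝ} (hq : 0 < q) (hqp : q ^ p = (p : ℝ)⁻¹)
    {z : A} (hz : ν.nrm (z ^ p - (p : A)) ≤ ((p : ℝ) ^ 2)⁻¹) (x : A) :
    ν.nrm (z * x) = q * ν.nrm x := by
  have hp1 : (1 : ℝ) < p := by exact_mod_cast hp.one_lt
  have hp0 : (0 : ℝ) < p := by positivity
  refine (pow_left_inj₀ (ν.nonneg _) (mul_nonneg hq.le (ν.nonneg _)) hp.ne_zero).1 ?_
  rw [← ν.powmul _ _ hp.one_le, mul_pow, mul_pow, hqp, ← ν.powmul _ _ hp.one_le, ← ν.nrm_p_mul]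
  rcases eq_or_ne (x ^ p) 0 with h | h
  · simp [h]
  have hpos : 0 < ν.nrm (x ^ p) :=
    (ν.nonneg _).lt_of_ne fun h' ↦ h ((ν.eq_zero_iff _).1 h'.symm)
  apply ν.nrm_eq_of_sub_lt
  rw [ν.nrm_sub_comm, ← sub_mul, ν.nrm_p_mul]
  refine (ν.nrm_mul_le hz le_rfl).trans_lt (mul_lt_mul_of_pos_right ?_ hpos)
  exact inv_strictAnti₀ hp0 (by nlinarith)

theorem exists_inverse_p (hp : p.Prime) :
    ∃ P : A, (p : A) * P = 1 ∧ ∀ x, ν.nrm (P * x) = p * ν.nrm x := by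
  obtain ⟨P, hP⟩ := ν.isUnit_p.exists_right_inv
  refine ⟨P, hP, fun x ↦ ?_⟩
  have hp0 : (p : ℝ) ≠ 0 := by exact_mod_cast hp.ne_zero
  have h := ν.nrm_p_mul (P * x)
  rw [← mul_assoc, hP, one_mul] at h
  rw [h, mul_inv_cancel_left₀ hp0]

theorem nrm_p_pow_mul (n : ℕ) (x : A) :
    ν.nrm ((p : A) ^ n * x) = ((p : ℝ)⁻¹) ^ n * ν.nrm x := by
  induction n with
  | zero => simp
  | succ n ih => rw [pow_succ', mul_assoc, ν.nrm_p_mul, ih, pow_succ', mul_assoc]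

/-- On the unit ball, approximation by `p`-th powers up to `p^{-1-1/p}`. -/
theorem IsPerfectoid.exists_pow_approx_of_le_one {ν : UniformBanachQpAlgebra p A}
    (hperf : ν.IsPerfectoid)
    (hp : p.Prime) {q : ℝ} (hq : 0 < q) (hq1 : q < 1) (hqp : q ^ p = (p : ℝ)⁻¹)
    {x : A} (hx : ν.nrm x ≤ 1) : ∃ y : A, ν.nrm (x - y ^ p) ≤ (p : ℝ)⁻¹ * q := by
  obtain ⟨hfrob, z, -, hz⟩ := hperf
  obtain ⟨P, hP, hPn⟩ := ν.exists_inverse_p hp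
  have hp0 : (0 : ℝ) < p := by exact_mod_cast hp.pos
  obtain ⟨w, hw1, hw⟩ := hfrob x hx
  have hPe : ν.nrm (P * (x - w ^ p)) ≤ 1 := by
    rw [hPn]
    calc (p : ℝ) * _ ≤ p * (p : ℝ)⁻¹ := by gcongr
      _ = 1 := mul_inv_cancel₀ hp0.ne'
  obtain ⟨u, hu1, hu⟩ := hfrob _ hPe
  refine ⟨w + z * u, ?_⟩
  have hle : ((p : ℝ) ^ 2)⁻¹ ≤ (p : ℝ)⁻¹ * q := by
    rw [sq, mul_inv]
    refine mul_le_mul_of_nonneg_left ?_ (by positivity)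
    rw [← hqp]
    exact pow_le_of_le_one hq.le hq1.le hp.ne_zero
  have hzu : ν.nrm (z * u) ≤ 1 * q := by
    rw [ν.nrm_mul_eq_of_pow_sub_p hp hq hqp hz]
    nlinarith
  have h1 := ν.nrm_sub_add_pow_le hp hq.le hq1.le hw1 hzu
  rw [one_pow, one_mul] at h1
  have h2 : ν.nrm ((p : A) * (P * (x - w ^ p) - u ^ p)) ≤ (p : ℝ)⁻¹ * q := by
    rw [ν.nrm_p_mul]
    refine le_trans ?_ hle
    rw [sq, mul_inv]
    gcongr
  have h3 : ν.nrm ((z ^ p - (p : A)) * u ^ p) ≤ (p : ℝ)⁻¹ * q := by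
    refine le_trans ?_ hle
    simpa using ν.nrm_mul_le hz (ν.nrm_pow_le hu1 hp.one_le)
  have h4 := ν.nrm_add_le (ν.nrm_sub_le h2 h3) h1
  convert h4 using 2
  linear_combination (w ^ p - x) * hP

/-- There is an element `t` whose `p`-th power multiplies norms by `p^{-1/p}` and is invertible
up to an error of norm at most `p⁻¹`. -/
theorem IsPerfectoid.exists_pow_scaling {ν : UniformBanachQpAlgebra p A}
    (hperf : ν.IsPerfectoid)
    (hp : p.Prime) {q : ℝ} (hq : 0 < q) (hq1 : q < 1) (hqp : q ^ p = (p : ℝ)⁻¹) :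
    ∃ t H : A, (∀ x, ν.nrm (t ^ p * x) = q * ν.nrm x) ∧
      ν.nrm (1 - t ^ p * H) ≤ (p : ℝ)⁻¹ := by
  obtain ⟨hfrob, z, hz1, hz⟩ := hperf
  obtain ⟨P, hP, hPn⟩ := ν.exists_inverse_p hp
  have hp0 : (0 : ℝ) < p := by exact_mod_cast hp.pos
  have hpq : (p : ℝ)⁻¹ < q := by
    rw [← hqp]
    exact pow_lt_self_of_lt_one₀ hq hq1 hp.one_lt
  have hzmul := ν.nrm_mul_eq_of_pow_sub_p hp hq hqp hz
  obtain ⟨t, -, ht⟩ := hfrob z hz1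
  have htmul : ∀ x, ν.nrm (t ^ p * x) = q * ν.nrm x := fun x ↦ by
    rw [← hzmul]
    rcases eq_or_ne x 0 with rfl | h
    · simp
    have hpos : 0 < ν.nrm x :=
      (ν.nonneg _).lt_of_ne fun h' ↦ h ((ν.eq_zero_iff _).1 h'.symm)
    apply ν.nrm_eq_of_sub_lt
    rw [← sub_mul, hzmul]
    exact (ν.nrm_mul_le ht le_rfl).trans_lt (mul_lt_mul_of_pos_right hpq hpos)
  set a : A := 1 - t ^ p * (z ^ (p - 1) * P) with ha
  have haq : ν.nrm a ≤ q := by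
    have h1 : ν.nrm (P * (z * z ^ (p - 1) - (p : A))) ≤ q := by
      rw [mul_pow_sub_one hp.ne_zero, hPn]
      calc (p : ℝ) * _ ≤ p * ((p : ℝ) ^ 2)⁻¹ := by gcongr
        _ = (p : ℝ)⁻¹ := by field_simp
        _ ≤ q := hpq.le
    have h2 : ν.nrm (P * ((z - t ^ p) * z ^ (p - 1))) ≤ q := by
      have hz' : ν.nrm z ≤ q := by
        have := hzmul 1
        rw [mul_one] at this
        rw [this]
        nlinarith [ν.nrm_one_le]
      have hzq : ν.nrm (z ^ (p - 1)) ≤ q :=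
        (ν.nrm_pow_le hz' (by have := hp.two_le; omega)).trans
          (pow_le_of_le_one hq.le hq1.le (by have := hp.two_le; omega))
      rw [hPn]
      calc (p : ℝ) * _ ≤ p * ((p : ℝ)⁻¹ * q) := by gcongr; exact ν.nrm_mul_le ht hzq
        _ = q := mul_inv_cancel_left₀ hp0.ne' q
    have h3 := ν.nrm_sub_le h2 h1
    convert h3 using 2
    rw [ha]
    linear_combination -hP
  refine ⟨t, z ^ (p - 1) * P * ∑ i ∈ Finset.range p, a ^ i, htmul, ?_⟩
  have hgeom : 1 - t ^ p * (z ^ (p - 1) * P * ∑ i ∈ Finset.range p, a ^ i) = a ^ p := by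
    have := mul_neg_geom_sum a p
    rw [show 1 - a = t ^ p * (z ^ (p - 1) * P) by rw [ha]; ring] at this
    linear_combination -this
  rw [hgeom, ← hqp]
  exact ν.nrm_pow_le haq hp.one_le

/-- Scale-invariant approximation by `p`-th powers. -/
theorem IsPerfectoid.exists_pow_approx {ν : UniformBanachQpAlgebra p A}
    (hperf : ν.IsPerfectoid) (hp : p.Prime) (x : A) :
    ∃ y : A, ν.nrm (x - y ^ p) ≤ (p : ℝ)⁻¹ * ν.nrm x := by
  have hp1 : (1 : ℝ) < p := by exact_mod_cast hp.one_lt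
  have hp0 : (0 : ℝ) < p := by positivity
  have hpi : (0 : ℝ) < (p : ℝ)⁻¹ := by positivity
  have hpi1 : (p : ℝ)⁻¹ < 1 := inv_lt_one_of_one_lt₀ hp1
  obtain ⟨q, hq, hq1, hqp⟩ : ∃ q : ℝ, 0 < q ∧ q < 1 ∧ q ^ p = (p : ℝ)⁻¹ :=
    ⟨(p : ℝ)⁻¹ ^ (p : ℝ)⁻¹, by positivity, Real.rpow_lt_one hpi.le hpi1 hpi,
      Real.rpow_inv_natCast_pow hpi.le hp.ne_zero⟩
  obtain ⟨t, H, ht, hH⟩ := hperf.exists_pow_scaling hp hq hq1 hqp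
  have key : ∀ (k : ℕ) (x : A), q ^ (k + 1) ≤ ν.nrm x → ν.nrm x ≤ 1 →
      ∃ y : A, ν.nrm (x - y ^ p) ≤ (p : ℝ)⁻¹ * ν.nrm x := by
    have base : ∀ x : A, q ≤ ν.nrm x → ν.nrm x ≤ 1 →
        ∃ y : A, ν.nrm (x - y ^ p) ≤ (p : ℝ)⁻¹ * ν.nrm x := fun x hx hx1 ↦ by
      obtain ⟨y, hy⟩ := hperf.exists_pow_approx_of_le_one hp hq hq1 hqp hx1
      exact ⟨y, hy.trans (by gcongr)⟩
    intro k
    induction k with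
    | zero => simpa using base
    | succ k ih =>
      intro x hx hx1
      rcases le_total q (ν.nrm x) with hqx | hqx
      · exact base x hqx hx1
      have hxpos : 0 < ν.nrm x := lt_of_lt_of_le (by positivity) hx
      have hsub : ν.nrm (x - t ^ p * (H * x)) ≤ (p : ℝ)⁻¹ * ν.nrm x := by
        rw [show x - t ^ p * (H * x) = (1 - t ^ p * H) * x by ring]
        exact ν.nrm_mul_le hH le_rfl
      have hHx : q * ν.nrm (H * x) = ν.nrm x := by
        rw [← ht]
        exact ν.nrm_eq_of_sub_lt (hsub.trans_lt (mul_lt_of_lt_one_left hxpos hpi1))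
      obtain ⟨y, hy⟩ := ih (H * x)
        (le_of_mul_le_mul_left (by rwa [hHx, ← pow_succ']) hq)
        (le_of_mul_le_mul_left (by rwa [hHx, mul_one]) hq)
      refine ⟨t * y, ?_⟩
      have h2 : ν.nrm (t ^ p * (H * x - y ^ p)) ≤ (p : ℝ)⁻¹ * ν.nrm x := by
        rw [ht, ← hHx, mul_left_comm]
        gcongr
      have h3 := ν.nrm_add_le hsub h2
      rwa [show x - t ^ p * (H * x) + t ^ p * (H * x - y ^ p) = x - (t * y) ^ p by ring] at h3
  rcases eq_or_ne x 0 with rfl | hx0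
  · exact ⟨0, by simp [hp.ne_zero, ν.nrm_zero]⟩
  have hxpos : 0 < ν.nrm x := (ν.nonneg _).lt_of_ne fun h ↦ hx0 ((ν.eq_zero_iff _).1 h.symm)
  obtain ⟨P, hP, hPn⟩ := ν.exists_inverse_p hp
  obtain ⟨N, hN⟩ := exists_pow_lt_of_lt_one (inv_pos.2 hxpos)
    (pow_lt_one₀ hpi.le hpi1 hp.ne_zero)
  rw [← pow_mul] at hN
  have hnx := ν.nrm_p_pow_mul (p * N) x
  obtain ⟨k, hk⟩ := exists_pow_lt_of_lt_one
    (show 0 < ν.nrm ((p : A) ^ (p * N) * x) by rw [hnx]; positivity) hq1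
  obtain ⟨y, hy⟩ := key k ((p : A) ^ (p * N) * x)
    ((pow_le_pow_of_le_one hq.le hq1.le k.le_succ).trans hk.le)
    (by rw [hnx]; exact ((lt_inv_mul_iff₀' hxpos).1 (by simpa using hN)).le)
  refine ⟨P ^ N * y, ?_⟩
  have hPN : (p : A) ^ (p * N) * (P ^ N) ^ p = 1 := by
    rw [← pow_mul, mul_comm N p, ← mul_pow, hP, one_pow]
  have heq : (p : A) ^ (p * N) * x - y ^ p = (p : A) ^ (p * N) * (x - (P ^ N * y) ^ p) := by
    rw [mul_pow]
    linear_combination y ^ p * hPN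
  rw [heq, ν.nrm_p_pow_mul, ν.nrm_p_pow_mul, mul_left_comm] at hy
  exact le_of_mul_le_mul_left hy (by positivity)

end UniformBanachQpAlgebra

/-- In a perfectoid uniform Banach `ℚ_p`-algebra, for every `m` and
every `x`, there is `y` with `‖x − y^p‖ ≤ p^{−1−p^{−1}−⋯−p^{−m}}·‖x‖`. -/
theorem perfectoid_strong_frobenius_approximation
    (p : ℕ) (hp : p.Prime) (A : Type*) [CommRing A]
    (ν : UniformBanachQpAlgebra p A) (hperf : ν.IsPerfectoid)
    (m : ℕ) (x : A) :
    ∃ y : A, ν.nrm (x - y ^ p) ≤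
      (p : ℝ) ^ (-(∑ i ∈ Finset.range (m + 1), ((p : ℝ)⁻¹) ^ i)) * ν.nrm x := by
  have hp1 : (1 : ℝ) < p := by exact_mod_cast hp.one_lt
  have hp0 : (0 : ℝ) < p := by positivity
  induction m with
  | zero =>
    obtain ⟨y, hy⟩ := hperf.exists_pow_approx hp x
    exact ⟨y, by simpa [Real.rpow_neg_one] using hy⟩
  | succ m ih =>
    obtain ⟨w, hw⟩ := ih
    obtain ⟨v, hv⟩ := hperf.exists_pow_approx hp (x - w ^ p)
    have hsum : ∑ i ∈ Finset.range (m + 1 + 1), ((p : ℝ)⁻¹) ^ i =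
        1 + (∑ i ∈ Finset.range (m + 1), ((p : ℝ)⁻¹) ^ i) * (p : ℝ)⁻¹ := by
      rw [Finset.sum_range_succ', Finset.sum_mul, pow_zero, add_comm]
      simp only [pow_succ]
    rw [hsum]
    set c := ∑ i ∈ Finset.range (m + 1), ((p : ℝ)⁻¹) ^ i
    have hc : 0 ≤ c := Finset.sum_nonneg fun i _ ↦ by positivity
    set s : ℝ := (p : ℝ) ^ (-(c * (p : ℝ)⁻¹)) with hs_def
    have hs : 0 ≤ s := by positivity
    have hs1 : s ≤ 1 := Real.rpow_le_one_of_one_le_of_nonpos hp1.le (by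
      have : 0 ≤ c * (p : ℝ)⁻¹ := by positivity
      linarith)
    have hsp : s ^ p = (p : ℝ) ^ (-c) := by
      rw [hs_def, ← Real.rpow_mul_natCast hp0.le]
      congr 1
      field_simp
    set a : ℝ := ν.nrm x ^ (p : ℝ)⁻¹
    have ha : 0 ≤ a := Real.rpow_nonneg (ν.nonneg x) _
    have hap : a ^ p = ν.nrm x := Real.rpow_inv_natCast_pow (ν.nonneg x) hp.ne_zero
    rw [← hsp] at hw
    have hsp1 : s ^ p ≤ 1 := pow_le_one₀ hs hs1
    have hw' : ν.nrm w ≤ a := by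
      refine (pow_le_pow_iff_left₀ (ν.nonneg _) ha hp.ne_zero).1 ?_
      rw [hap, ← ν.powmul _ _ hp.one_le]
      exact ν.nrm_le_of_sub_le le_rfl (hw.trans (mul_le_of_le_one_left (ν.nonneg x) hsp1))
    have hv' : ν.nrm v ≤ a * s := by
      refine (pow_le_pow_iff_left₀ (ν.nonneg _) (by positivity) hp.ne_zero).1 ?_
      rw [mul_pow, hap, ← ν.powmul _ _ hp.one_le, mul_comm]
      exact (ν.nrm_le_of_sub_le le_rfl
        (hv.trans (mul_le_of_le_one_left (ν.nonneg _) (inv_le_one_of_one_le₀ hp1.le)))).trans hw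
    have hadd := ν.nrm_sub_add_pow_le hp hs hs1 hw' hv'
    rw [hap] at hadd
    have hv2 : ν.nrm (x - w ^ p - v ^ p) ≤ (p : ℝ)⁻¹ * (ν.nrm x * s) := by
      refine hv.trans (mul_le_mul_of_nonneg_left (hw.trans ?_) (by positivity))
      rw [mul_comm]
      exact mul_le_mul_of_nonneg_left (pow_le_of_le_one hs hs1 hp.ne_zero) (ν.nonneg x)
    refine ⟨w + v, ?_⟩
    have h := ν.nrm_add_le hv2 hadd
    rw [show x - w ^ p - v ^ p + (w ^ p + v ^ p - (w + v) ^ p) = x - (w + v) ^ p by ring] at h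
    rw [neg_add, Real.rpow_add hp0, Real.rpow_neg_one, mul_assoc, mul_comm _ (ν.nrm x)]
    exact h
end

section
/- Let p be a prime. Let S be a commutative ring such that p is not a zero divisor in S, S is p-adically complete and separated (the natural map S → lim_n S/pⁿS is an isomorphism), and S/pS is a perfect ring of characteristic p (the map x ↦ x^p is bijective on S/pS). Let U be any commutative ring that is p-adically complete and separated. Then for every ring homomorphism f : S/pS → U/pU there exists a unique ring homomorphism F : S → U lifting f, i.e., such that the composite S → U → U/pU equals the composite S → S/pS → U/pU. Equivalently, the reduction-mod-p map from ring homomorphisms S → U to ring homomorphisms S/pS → U/pU is bijective. -/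
open Ideal WittVector

section WittLift

variable {p : ℕ} [Fact p.Prime] {k : Type*} [CommRing k] [CharP k p] [PerfectRing k p]
variable {A : Type*} [CommRing A]

/-- Two ring homomorphisms out of the Witt vectors of a perfect ring which agree modulo `p`
are equal, provided the target is `p`-adically separated. -/
theorem WittVector.ringHom_ext_of_mk_eq [IsHausdorff (span {(p : A)}) A]
    (φ ψ : WittVector p k →+* A)
    (h : (Ideal.Quotient.mk (span {(p : A)})).comp φ = (Ideal.Quotient.mk _).comp ψ) :
    φ = ψ := by
  have key (n : ℕ) : (Ideal.Quotient.mk (span {(p : A)} ^ (n + 1))).comp φ =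
      (Ideal.Quotient.mk _).comp ψ := by
    apply eq_of_apply_teichmuller_eq
    · refine ⟨n + 1, ?_⟩
      rw [← map_natCast (Ideal.Quotient.mk (span {(p : A)} ^ (n + 1))), ← map_pow,
        Ideal.Quotient.eq_zero_iff_mem]
      exact Ideal.pow_mem_pow (mem_span_singleton_self _) _
    · intro x
      obtain ⟨y, rfl⟩ : ∃ y : k, y ^ p ^ n = x :=
        ⟨(iterateFrobeniusEquiv k p n).symm x, by
          rw [← iterateFrobeniusEquiv_def, RingEquiv.apply_symm_apply]⟩
      have hy := RingHom.congr_fun h (teichmuller p y)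
      simp only [RingHom.comp_apply, Ideal.Quotient.eq, mem_span_singleton] at hy
      simp only [RingHom.comp_apply, map_pow φ, map_pow ψ, map_pow (teichmuller p),
        Ideal.Quotient.eq, span_singleton_pow, mem_span_singleton]
      exact dvd_sub_pow_of_dvd_sub hy n
  ext x
  rw [IsHausdorff.eq_iff_smodEq (I := span {(p : A)})]
  intro n
  have hn := RingHom.congr_fun (key n) x
  simp only [RingHom.comp_apply, Ideal.Quotient.eq] at hn
  rw [smul_eq_mul, mul_top, SModEq.sub_mem]
  exact Ideal.pow_le_pow_right n.le_succ hn

/-- The reduction modulo `p ^ (n + 1)` of the lift to Witt vectors of a homomorphism from a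
perfect ring to `A / p`. -/
noncomputable def WittVector.liftModPPow (g : k →+* A ⧸ span {(p : A)}) (n : ℕ) :
    WittVector p k →+* A ⧸ span {(p : A)} ^ (n + 1) :=
  (ghostComponentModPPow n).comp
    (WittVector.map (g.comp (iterateFrobeniusEquiv k p n).symm.toRingHom))

theorem WittVector.liftModPPow_teichmuller (g : k →+* A ⧸ span {(p : A)}) (n : ℕ) (x : k) (a : A)
    (ha : Ideal.Quotient.mk _ a = g ((iterateFrobeniusEquiv k p n).symm x)) :
    liftModPPow g n (teichmuller p x) = Ideal.Quotient.mk _ (a ^ p ^ n) := by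
  have := ghostComponentModPPow_map_mk n (teichmuller p a)
  rw [ghostComponent_teichmuller, map_teichmuller, ha] at this
  simpa [liftModPPow, map_teichmuller] using this

theorem WittVector.factorPowSucc_comp_liftModPPow (g : k →+* A ⧸ span {(p : A)}) (n : ℕ) :
    (Ideal.Quotient.factorPowSucc _ _).comp (liftModPPow g (n + 1)) = liftModPPow g n := by
  apply eq_of_apply_teichmuller_eq
  · refine ⟨n + 1, ?_⟩
    rw [← map_natCast (Ideal.Quotient.mk (span {(p : A)} ^ (n + 1))), ← map_pow,
      Ideal.Quotient.eq_zero_iff_mem]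
    exact Ideal.pow_mem_pow (mem_span_singleton_self _) _
  · intro x
    obtain ⟨a, ha⟩ := Ideal.Quotient.mk_surjective
      (g ((iterateFrobeniusEquiv k p (n + 1)).symm x))
    have hb : Ideal.Quotient.mk _ (a ^ p) = g ((iterateFrobeniusEquiv k p n).symm x) := by
      rw [map_pow, ha, ← map_pow]
      congr 1
      rw [RingEquiv.eq_symm_apply, iterateFrobeniusEquiv_def, ← pow_mul, ← pow_succ',
        ← iterateFrobeniusEquiv_def, RingEquiv.apply_symm_apply]
    rw [RingHom.comp_apply, liftModPPow_teichmuller g _ x a ha,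
      liftModPPow_teichmuller g _ x _ hb, ← pow_mul, ← pow_succ']
    rfl

/-- A ring homomorphism from a perfect ring `k` to `A / p`, where `A` is `p`-adically complete,
lifts to a ring homomorphism from the Witt vectors of `k` to `A`. -/
theorem WittVector.exists_ringHom_lift [IsAdicComplete (span {(p : A)}) A]
    (g : k →+* A ⧸ span {(p : A)}) :
    ∃ φ : WittVector p k →+* A,
      (Ideal.Quotient.mk (span {(p : A)})).comp φ = g.comp constantCoeff := by
  refine ⟨IsAdicComplete.StrictMono.liftRingHom _ Order.succ_strictMono _
    (factorPowSucc_comp_liftModPPow g _), ?_⟩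
  ext x
  have h : Ideal.Quotient.mk (span {(p : A)} ^ (0 + 1)) _ = liftModPPow g 0 x :=
    IsAdicComplete.StrictMono.mk_liftRingHom (span {(p : A)}) Order.succ_strictMono _
      (factorPowSucc_comp_liftModPPow g _) (n := 0) x
  have h1 : span {(p : A)} ^ (0 + 1) = span {(p : A)} := pow_one _
  apply_fun Ideal.quotEquivOfEq h1 at h
  simp only [Ideal.quotEquivOfEq_mk] at h
  rw [RingHom.comp_apply]
  refine h.trans ?_
  rw [liftModPPow, RingHom.comp_apply]
  refine (quotEquivOfEq_ghostComponentModPPow _ _).trans ?_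
  simp [ghostComponent_apply]

/-- A lift to Witt vectors of an isomorphism `k ≃ A / p` is bijective when `A` is `p`-torsion-free
and `p`-adically complete. -/
theorem WittVector.bijective_of_mk_comp_eq [IsAdicComplete (span {(p : A)}) A]
    (hA : ∀ x : A, (p : A) * x = 0 → x = 0) (g : k →+* A ⧸ span {(p : A)})
    (hg : Function.Bijective g) (φ : WittVector p k →+* A)
    (hφ : (Ideal.Quotient.mk (span {(p : A)})).comp φ = g.comp constantCoeff) :
    Function.Bijective φ := by
  constructor
  · rw [injective_iff_map_eq_zero]
    have key (n : ℕ) : ∀ x, φ x = 0 → x ∈ span {(p : WittVector p k)} ^ n := by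
      induction n with
      | zero => simp
      | succ n ih =>
        intro x hx
        have h0 : g (x.coeff 0) = 0 := by
          simpa [hx] using (RingHom.congr_fun hφ x).symm
        have hx0 := (mem_span_p_iff_coeff_zero_eq_zero x).2
          ((_root_.map_eq_zero_iff g hg.injective).1 h0)
        obtain ⟨y, rfl⟩ := mem_span_singleton.1 hx0
        rw [map_mul, map_natCast] at hx
        rw [pow_succ']
        exact Ideal.mul_mem_mul (mem_span_singleton_self _) (ih y (hA _ hx))
    intro x hx
    refine IsHausdorff.haus (I := span {(p : WittVector p k)}) inferInstance x fun n ↦ ?_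
    rw [smul_eq_mul, mul_top, SModEq.zero]
    exact key n x hx
  · have hmap : Ideal.map φ (span {(p : WittVector p k)}) = span {(p : A)} := by
      simp [map_span]
    have : IsHausdorff ((span {(p : WittVector p k)}).map φ) A := by
      rw [hmap]
      infer_instance
    apply surjective_of_mk_map_comp_surjective φ (I := span {(p : WittVector p k)})
    rw [hmap, hφ]
    exact hg.surjective.comp (constantCoeff_surjective p)

end WittLift


/-- Let `S` be a strict `p`-ring (i.e. `p` is not a zero divisor in `S`,
`S` is `p`-adically complete and separated, and `S/pS` is perfect of characteristic `p`),
and let `U` be any `p`-adically complete and separated commutative ring. Then every ring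
homomorphism `S/pS → U/pU` lifts uniquely to a ring homomorphism `S → U`. -/
theorem strict_p_ring_unique_lift
    (p : ℕ) (hp : p.Prime) (S U : Type*) [CommRing S] [CommRing U]
    (hpnzd : ∀ x : S, (p : S) * x = 0 → x = 0)
    [IsAdicComplete (Ideal.span {(p : S)}) S]
    [IsAdicComplete (Ideal.span {(p : U)}) U]
    [CharP (S ⧸ Ideal.span {(p : S)}) p]
    (hperf : Function.Bijective fun x : S ⧸ Ideal.span {(p : S)} => x ^ p)
    (f : (S ⧸ Ideal.span {(p : S)}) →+* (U ⧸ Ideal.span {(p : U)})) :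
    ∃! F : S →+* U,
      (Ideal.Quotient.mk (Ideal.span {(p : U)})).comp F
        = f.comp (Ideal.Quotient.mk (Ideal.span {(p : S)})) := by
  have : Fact p.Prime := ⟨hp⟩
  have : PerfectRing (S ⧸ span {(p : S)}) p := ⟨hperf⟩
  obtain ⟨θ, hθ⟩ := exists_ringHom_lift (RingHom.id (S ⧸ span {(p : S)}))
  obtain ⟨φ, hφ⟩ := exists_ringHom_lift f
  let e := RingEquiv.ofBijective θ
    (bijective_of_mk_comp_eq hpnzd _ Function.bijective_id θ hθ)
  have hmk (w : WittVector p (S ⧸ span {(p : S)})) :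
      Ideal.Quotient.mk _ (θ w) = constantCoeff w := RingHom.congr_fun hθ w
  refine ⟨φ.comp e.symm.toRingHom, ?_, fun G hG ↦ ?_⟩
  · ext s
    obtain ⟨w, rfl⟩ := e.surjective s
    have hw := RingHom.congr_fun hφ w
    simp only [RingHom.comp_apply] at hw ⊢
    have he : e.symm.toRingHom (e w) = w := e.symm_apply_apply w
    rw [he, hw]
    exact congrArg f (hmk w).symm
  · have h : G.comp θ = φ := by
      apply ringHom_ext_of_mk_eq
      rw [← RingHom.comp_assoc, hG, RingHom.comp_assoc, hθ, hφ, RingHom.id_comp]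
    ext s
    obtain ⟨w, rfl⟩ := e.surjective s
    have he : e.symm.toRingHom (e w) = w := e.symm_apply_apply w
    rw [RingHom.comp_apply, he, ← h]
    rfl
end

section
/- Let p be a prime, let a and n be positive integers, and let m be a nonnegative integer. Let R be a perfect commutative ring of characteristic p, and let W_n(R) = 𝕎R/(pⁿ) be the quotient of the p-typical Witt vectors, with φ the ring endomorphism of W_n(R) induced by the Witt vector Frobenius. Then for every invertible m×m matrix A over W_n(R), there exists an R-algebra S, which is finite étale and faithfully flat over R, together with an invertible m×m matrix U over W_n(S), such that U = Ā·φ^a(U), where Ā denotes the image of A in W_n(S) under the map induced by R → S, and φ^a(U) is obtained by applying φ^a to each entry of U. (This is the free case of the statement that any finite projective W_n(R)-module of everywhere positive rank with a semilinear φ^a-action acquires a φ^a-fixed basis over a faithfully finite étale extension of R.) -/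
universe u

/-- The truncation `W_n(R) = 𝕎R/(pⁿ)` of the ring of `p`-typical Witt vectors. -/
abbrev Wn (p : ℕ) [Fact p.Prime] (n : ℕ) (R : Type u) [CommRing R] : Type u :=
  WittVector p R ⧸ Ideal.span {(p : WittVector p R) ^ n}

/-- The endomorphism of `W_n(R)` induced by the Witt vector Frobenius. -/
noncomputable def WnFrobenius (p : ℕ) [Fact p.Prime] (n : ℕ) (R : Type u) [CommRing R] :
    Wn p n R →+* Wn p n R :=
  Ideal.Quotient.lift _
    ((Ideal.Quotient.mk (Ideal.span {(p : WittVector p R) ^ n})).comp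
      (WittVector.frobenius : WittVector p R →+* WittVector p R))
    (by
      intro a ha
      rw [Ideal.mem_span_singleton] at ha
      obtain ⟨c, rfl⟩ := ha
      rw [RingHom.comp_apply, Ideal.Quotient.eq_zero_iff_mem, Ideal.mem_span_singleton,
        map_mul, map_pow, map_natCast]
      exact dvd_mul_right _ _)

/-- The ring homomorphism `W_n(R) → W_n(S)` induced functorially by `f : R →+* S`. -/
noncomputable def WnMap (p : ℕ) [Fact p.Prime] (n : ℕ) {R S : Type u} [CommRing R] [CommRing S]
    (f : R →+* S) : Wn p n R →+* Wn p n S :=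
  Ideal.Quotient.lift _
    ((Ideal.Quotient.mk (Ideal.span {(p : WittVector p S) ^ n})).comp
      (WittVector.map f : WittVector p R →+* WittVector p S))
    (by
      intro a ha
      rw [Ideal.mem_span_singleton] at ha
      obtain ⟨c, rfl⟩ := ha
      rw [RingHom.comp_apply, Ideal.Quotient.eq_zero_iff_mem, Ideal.mem_span_singleton,
        map_mul, map_pow, map_natCast]
      exact dvd_mul_right _ _)

/-- A bundled `R`-algebra which is finite étale and faithfully flat over `R`. -/
structure FaithfullyFiniteEtaleAlgebra (R : Type u) [CommRing R] where
  carrier : Type u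
  [commRing : CommRing carrier]
  [algebra : Algebra R carrier]
  finite : Module.Finite R carrier
  etale : Algebra.Etale R carrier
  faithfullyFlat : Module.FaithfullyFlat R carrier

attribute [instance] FaithfullyFiniteEtaleAlgebra.commRing FaithfullyFiniteEtaleAlgebra.algebra

/-! ### The algebra of solutions of `x ^ q = B x + c` -/

section FrobeniusSystem

open MvPolynomial

variable {ι : Type} [Fintype ι] {R : Type u} [CommRing R]

/-- The ideal of the equations `x ^ q = B x + c`. -/
noncomputable def frobeniusSystemIdeal (q : ℕ) (B : Matrix ι ι R) (c : ι → R) :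
    Ideal (MvPolynomial ι R) :=
  Ideal.span (Set.range fun i => X i ^ q - (∑ j, C (B i j) * X j + C (c i)))

/-- The universal `R`-algebra with a solution of the equations `x ^ q = B x + c`. -/
abbrev FrobeniusSystem (q : ℕ) (B : Matrix ι ι R) (c : ι → R) : Type u :=
  MvPolynomial ι R ⧸ frobeniusSystemIdeal q B c

namespace FrobeniusSystem

variable (q : ℕ) (B : Matrix ι ι R) (c : ι → R)

/-- The coordinates of the universal solution. -/
noncomputable def root (i : ι) : FrobeniusSystem q B c := Ideal.Quotient.mk _ (X i)

theorem root_pow (i : ι) : root q B c i ^ q =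
    ∑ j, algebraMap R _ (B i j) * root q B c j + algebraMap R _ (c i) := by
  have h : (Ideal.Quotient.mk (frobeniusSystemIdeal q B c))
      (X i ^ q - (∑ j, C (B i j) * X j + C (c i))) = 0 :=
    Ideal.Quotient.eq_zero_iff_mem.2 (Ideal.subset_span ⟨i, rfl⟩)
  rw [map_sub, sub_eq_zero] at h
  simp only [map_add, map_sum, map_mul, map_pow] at h
  exact h

variable {q B c}

/-- The ring homomorphism out of the universal algebra given by a solution of the equations. -/
noncomputable def liftHom {T : Type*} [CommRing T] (f : R →+* T) (y : ι → T)
    (hy : ∀ i, y i ^ q = ∑ j, f (B i j) * y j + f (c i)) : FrobeniusSystem q B c →+* T :=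
  Ideal.Quotient.lift _ (eval₂Hom f y) (by
    intro x hx
    suffices frobeniusSystemIdeal q B c ≤ RingHom.ker (eval₂Hom f y) from this hx
    rw [frobeniusSystemIdeal, Ideal.span_le]
    rintro _ ⟨i, rfl⟩
    simp [RingHom.mem_ker, hy, eval₂_sum])

theorem liftHom_algebraMap {T : Type*} [CommRing T] (f : R →+* T) (y : ι → T)
    (hy : ∀ i, y i ^ q = ∑ j, f (B i j) * y j + f (c i)) (r : R) :
    liftHom f y hy (algebraMap R _ r) = f r :=
  eval₂_C f y r

theorem liftHom_root {T : Type*} [CommRing T] (f : R →+* T) (y : ι → T)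
    (hy : ∀ i, y i ^ q = ∑ j, f (B i j) * y j + f (c i)) (i : ι) :
    liftHom f y hy (root q B c i) = y i :=
  eval₂_X f y i

theorem ringHom_ext {T : Type*} [CommRing T] {f g : FrobeniusSystem q B c →+* T}
    (h : ∀ r, f (algebraMap R _ r) = g (algebraMap R _ r))
    (h' : ∀ i, f (root q B c i) = g (root q B c i)) : f = g :=
  Ideal.Quotient.ringHom_ext (MvPolynomial.ringHom_ext h h')

theorem exists_algHom {T : Type*} [CommRing T] [Algebra R T] (y : ι → T)
    (hy : ∀ i, y i ^ q = ∑ j, algebraMap R T (B i j) * y j + algebraMap R T (c i)) :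
    ∃ f : FrobeniusSystem q B c →ₐ[R] T, ∀ i, f (root q B c i) = y i :=
  ⟨{ liftHom (algebraMap R T) y hy with commutes' := liftHom_algebraMap _ y hy },
    liftHom_root _ y hy⟩

theorem algHom_ext {T : Type*} [CommRing T] [Algebra R T] {f g : FrobeniusSystem q B c →ₐ[R] T}
    (h : ∀ i, f (root q B c i) = g (root q B c i)) : f = g :=
  Ideal.Quotient.algHom_ext R (MvPolynomial.algHom_ext h)

theorem finite (hq : 2 ≤ q) : Module.Finite R (FrobeniusSystem q B c) := by
  classical
  set mk := Ideal.Quotient.mkₐ R (frobeniusSystemIdeal q B c)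
  set M : Submodule R (FrobeniusSystem q B c) := Submodule.span R
    (Set.image (fun e : ι →₀ ℕ => mk (monomial e 1)) {e | e.degree ≤ Fintype.card ι * q})
  have key : ∀ n : ℕ, ∀ e : ι →₀ ℕ, e.degree = n → mk (monomial e 1) ∈ M := by
    intro n
    induction n using Nat.strong_induction_on with
    | _ n ih =>
      intro e he
      by_cases hle : e.degree ≤ Fintype.card ι * q
      · exact Submodule.subset_span ⟨e, hle, rfl⟩
      obtain ⟨i, hi⟩ : ∃ i, q ≤ e i := by
        by_contra! hlt
        apply hle
        rw [Finsupp.degree_eq_sum]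
        exact (Finset.sum_le_card_nsmul _ _ q fun i _ => (hlt i).le).trans (by simp)
      obtain ⟨e', rfl⟩ : ∃ e', e = Finsupp.single i q + e' :=
        exists_add_of_le (Finsupp.single_le_iff.2 hi)
      have hdeg : q + e'.degree = n := by simpa using he
      have hmon : mk (monomial (Finsupp.single i q + e') 1) =
          ∑ j, B i j • mk (monomial (Finsupp.single j 1 + e') 1) + c i • mk (monomial e' 1) := by
        have h1 : ∀ j k, (monomial (Finsupp.single j k + e') (1 : R)) =
            X j ^ k * monomial e' 1 := by
          intro j k
          rw [X_pow_eq_monomial, monomial_mul, one_mul]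
        have h2 : mk (X i) ^ q = ∑ j, algebraMap R _ (B i j) * mk (X j) + algebraMap R _ (c i) :=
          root_pow q B c i
        simp only [h1, map_mul, map_pow, h2, pow_one, add_mul, Finset.sum_mul,
          mul_assoc]
        congr 1
        · exact Finset.sum_congr rfl fun j _ => (Algebra.smul_def _ _).symm
        · exact (Algebra.smul_def _ _).symm
      rw [hmon]
      refine add_mem (sum_mem fun j _ => M.smul_mem _ ?_) (M.smul_mem _ ?_)
      · exact ih (1 + e'.degree) (by omega) _ (by simp)
      · exact ih e'.degree (by omega) _ rfl
  have htop : M = ⊤ := by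
    refine eq_top_iff.2 fun x _ => ?_
    obtain ⟨f, rfl⟩ := Ideal.Quotient.mkₐ_surjective R (frobeniusSystemIdeal q B c) x
    rw [f.as_sum, map_sum]
    refine sum_mem fun e _ => ?_
    have : monomial e (f.coeff e) = f.coeff e • monomial e (1 : R) := by
      rw [smul_monomial, smul_eq_mul, mul_one]
    rw [this, map_smul]
    exact M.smul_mem _ (key _ e rfl)
  exact ⟨htop ▸ Submodule.fg_span ((Finsupp.finite_of_degree_le _).image _)⟩

section CharP

variable {p : ℕ} [Fact p.Prime] [CharP R p] {a : ℕ}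

theorem etale [DecidableEq ι] (ha : 0 < a) (hB : IsUnit B) :
    Algebra.Etale R (FrobeniusSystem (p ^ a) B c) := by
  obtain ⟨B', hBB', hB'B⟩ := isUnit_iff_exists.1 hB
  have hfp : Algebra.FinitePresentation R (FrobeniusSystem (p ^ a) B c) :=
    Algebra.FinitePresentation.quotient (Submodule.fg_span (Set.finite_range _))
  refine ⟨Algebra.FormallyEtale.iff_comp_bijective.2 fun T _ _ I hI => ?_, hfp⟩
  have hq : 2 ≤ p ^ a := (Fact.out : p.Prime).two_le.trans (Nat.le_self_pow ha.ne' p)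
  have hpow : ∀ x y : T, x - y ∈ I → x ^ p ^ a = y ^ p ^ a := by
    intro x y hxy
    obtain _ | _ := subsingleton_or_nontrivial T
    · exact Subsingleton.elim _ _
    have : CharP T p := (CharP.charP_iff_prime_eq_zero Fact.out).2 (by
      rw [← map_natCast (algebraMap R T), CharP.cast_eq_zero, map_zero])
    have h0 : (x - y) ^ p ^ a = 0 := by
      have : (x - y) ^ 2 = 0 := by
        have := Ideal.pow_mem_pow hxy 2
        rwa [hI] at this
      exact pow_eq_zero_of_le hq this
    rwa [sub_pow_char_pow, sub_eq_zero] at h0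
  have hinv : ∀ x z : ι → T, (∀ i, z i = ∑ j, algebraMap R T (B i j) * x j) ↔
      ∀ i, x i = ∑ j, algebraMap R T (B' i j) * z j := by
    intro x z
    have h1 : ∀ (D : Matrix ι ι R) (v w : ι → T), (∀ i, v i = ∑ j, algebraMap R T (D i j) * w j) ↔
        v = (D.map (algebraMap R T)).mulVec w := by
      intro D v w
      simp [_root_.funext_iff, Matrix.mulVec, dotProduct]
    rw [h1, h1]
    constructor
    · rintro rfl
      rw [Matrix.mulVec_mulVec, ← Matrix.map_mul, hB'B]
      simp
    · rintro rfl
      rw [Matrix.mulVec_mulVec, ← Matrix.map_mul, hBB']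
      simp
  constructor
  · intro f g hfg
    refine algHom_ext fun i => ?_
    have hroot : ∀ h : FrobeniusSystem (p ^ a) B c →ₐ[R] T, ∀ i, h (root _ B c i) =
        ∑ j, algebraMap R T (B' i j) * (h (root _ B c j) ^ p ^ a - algebraMap R T (c j)) := by
      intro h
      refine (hinv _ _).1 fun i => ?_
      rw [← map_pow, root_pow]
      simp
    rw [hroot f, hroot g]
    refine Finset.sum_congr rfl fun j _ => ?_
    rw [hpow (f (root _ B c j)) (g (root _ B c j))]
    exact Ideal.Quotient.eq.1 (DFunLike.congr_fun hfg (root _ B c j))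
  · intro f
    choose y hy using fun i => Ideal.Quotient.mk_surjective (f (root _ B c i))
    set x : ι → T := fun i => ∑ j, algebraMap R T (B' i j) *
      (y j ^ p ^ a - algebraMap R T (c j)) with hx
    have hBx := (hinv x (fun i => y i ^ p ^ a - algebraMap R T (c i))).2 fun i => rfl
    have hxy : ∀ i, Ideal.Quotient.mk I (x i) = f (root _ B c i) := by
      have hc : ∀ r, Ideal.Quotient.mk I (algebraMap R T r) = f (algebraMap R _ r) :=
        fun r => (f.commutes r).symm
      intro i
      simp only [hx, map_sum, map_mul, map_sub, map_pow, hy, hc]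
      simp only [← map_pow, ← map_sub, ← map_mul, ← map_sum]
      congr 1
      simp only [root_pow, add_sub_cancel_right, Finset.mul_sum]
      rw [Finset.sum_comm]
      simp only [← mul_assoc, ← Finset.sum_mul, ← map_mul, ← map_sum]
      simp only [← Matrix.mul_apply, hB'B, Matrix.one_apply]
      simp
    obtain ⟨g, hg⟩ := exists_algHom (B := B) (c := c) (q := p ^ a) x fun i => by
      rw [hpow (x i) (y i), ← hBx i, sub_add_cancel]
      exact Ideal.Quotient.eq.1 ((hxy i).trans (hy i).symm)
    refine ⟨g, algHom_ext fun i => ?_⟩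
    simp [hg, hxy]

theorem pow_bijective [DecidableEq ι] [PerfectRing R p] (ha : 0 < a) (hB : IsUnit B) :
    Function.Bijective fun x : FrobeniusSystem (p ^ a) B c => x ^ p := by
  nontriviality FrobeniusSystem (p ^ a) B c
  obtain ⟨B', hBB', hB'B⟩ := isUnit_iff_exists.1 hB
  obtain ⟨b, rfl⟩ : ∃ b, a = b + 1 := ⟨a - 1, by omega⟩
  have : CharP (FrobeniusSystem (p ^ (b + 1)) B c) p :=
    (CharP.charP_iff_prime_eq_zero Fact.out).2 (by
      rw [← map_natCast (algebraMap R _), CharP.cast_eq_zero, map_zero])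
  set σ : R →+* R := ((frobeniusEquiv R p).symm : R →+* R)
  have hσp : ∀ r, σ r ^ p = r := fun r => frobenius_apply_frobeniusEquiv_symm R p r
  have hpσ : ∀ r, σ (r ^ p) = r := fun r => frobeniusEquiv_symm_pow R p r
  set z : ι → FrobeniusSystem (p ^ (b + 1)) B c := fun i =>
    ∑ j, algebraMap R (FrobeniusSystem (p ^ (b + 1)) B c) (σ (B' i j)) *
      (root _ B c j ^ p ^ b - algebraMap R (FrobeniusSystem (p ^ (b + 1)) B c) (σ (c j))) with hz
  have hzp : ∀ i, z i ^ p = root _ B c i := by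
    intro i
    simp only [hz, sum_pow_char, mul_pow, sub_pow_char, ← map_pow, hσp, ← pow_mul, ← pow_succ]
    simp only [root_pow, add_sub_cancel_right, Finset.mul_sum]
    rw [Finset.sum_comm]
    simp only [← mul_assoc, ← Finset.sum_mul, ← map_mul, ← map_sum]
    simp only [← Matrix.mul_apply, hB'B, Matrix.one_apply]
    simp
  have hzsys : ∀ i, z i ^ p ^ (b + 1) =
      ∑ j, (algebraMap R (FrobeniusSystem (p ^ (b + 1)) B c)).comp σ (B i j) * z j +
        (algebraMap R (FrobeniusSystem (p ^ (b + 1)) B c)).comp σ (c i) := by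
    intro i
    rw [show z i ^ p ^ (b + 1) = root _ B c i ^ p ^ b by rw [← hzp, ← pow_mul, ← pow_succ']]
    simp only [hz, Finset.mul_sum, RingHom.comp_apply]
    rw [Finset.sum_comm]
    simp only [← mul_assoc, ← Finset.sum_mul, ← map_mul, ← map_sum]
    simp only [← Matrix.mul_apply, hBB', Matrix.one_apply]
    simp
  have hinv : (liftHom _ z hzsys).comp (frobenius (FrobeniusSystem (p ^ (b + 1)) B c) p) =
      RingHom.id _ := by
    refine ringHom_ext (fun r => ?_) fun i => ?_
    · simp only [RingHom.comp_apply, frobenius_def, ← map_pow, RingHom.id_apply]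
      rw [liftHom_algebraMap, RingHom.comp_apply, hpσ]
    · simp only [RingHom.comp_apply, frobenius_def, RingHom.id_apply]
      rw [map_pow, liftHom_root, hzp]
  have hinv' : (frobenius (FrobeniusSystem (p ^ (b + 1)) B c) p).comp (liftHom _ z hzsys) =
      RingHom.id _ := by
    refine ringHom_ext (fun r => ?_) fun i => ?_
    · simp only [RingHom.comp_apply, frobenius_def, RingHom.id_apply]
      rw [liftHom_algebraMap, RingHom.comp_apply, ← map_pow, hσp]
    · simp only [RingHom.comp_apply, frobenius_def, RingHom.id_apply]
      rw [liftHom_root, hzp]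
  exact Function.bijective_iff_has_inverse.2 ⟨liftHom _ z hzsys,
    DFunLike.congr_fun hinv, DFunLike.congr_fun hinv'⟩

end CharP

end FrobeniusSystem

end FrobeniusSystem

/-! ### Fixed vectors of semilinear maps over an algebraically closed field -/

section FixedVectors

open Polynomial

variable {k : Type*} [Field k]

/-- The polynomials in `y` solving `x₀ = c₀ y ^ q` and `xᵢ₊₁ = xᵢ ^ q + cᵢ₊₁ y ^ q`. -/
noncomputable def coordPoly (q : ℕ) (c : ℕ → k) : ℕ → k[X]
  | 0 => C (c 0) * X ^ q
  | i + 1 => coordPoly q c i ^ q + C (c (i + 1)) * X ^ q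

theorem X_sq_dvd_coordPoly {q : ℕ} (hq : 2 ≤ q) (c : ℕ → k) (i : ℕ) :
    X ^ 2 ∣ coordPoly q c i := by
  induction i with
  | zero => exact (pow_dvd_pow X hq).mul_left _
  | succ i ih =>
    exact dvd_add (ih.trans (dvd_pow_self _ (by omega))) ((pow_dvd_pow X hq).mul_left _)

variable [IsAlgClosed k]

theorem eq_zero_of_coordPoly_eq_zero {p a : ℕ} [Fact p.Prime] [CharP k p] (ha : 0 < a)
    (c : ℕ → k) (i : ℕ) (h : coordPoly (p ^ a) c i = 0) : ∀ j ≤ i, c j = 0 := by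
  have hq : 2 ≤ p ^ a := (Fact.out : p.Prime).two_le.trans (Nat.le_self_pow ha.ne' p)
  induction i with
  | zero =>
    intro j hj
    obtain rfl : j = 0 := by omega
    simpa [coordPoly] using h
  | succ i ih =>
    obtain ⟨d, hd⟩ := IsAlgClosed.exists_pow_nat_eq (c (i + 1)) (n := p ^ a) (by omega)
    rw [coordPoly, ← hd, C_pow, ← mul_pow, ← add_pow_char_pow] at h
    have h0 : coordPoly (p ^ a) c i + C d * X = 0 := eq_zero_of_pow_eq_zero h
    have hd0 : d = 0 := by
      obtain ⟨f, hf⟩ := X_sq_dvd_coordPoly hq c i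
      have := congrArg (fun g : k[X] => g.coeff 1) h0
      simpa [hf, coeff_X_pow_mul'] using this
    intro j hj
    obtain hj | rfl := Nat.le_succ_iff.1 hj
    · exact ih (by simpa [hd0] using h0) j hj
    · rw [← hd, hd0, zero_pow (by omega)]

theorem exists_eval_coordPoly_eq {p a : ℕ} [Fact p.Prime] [CharP k p] (ha : 0 < a)
    (c : ℕ → k) (i : ℕ) (h : ∃ j ≤ i, c j ≠ 0) :
    ∃ y : k, y ≠ 0 ∧ (coordPoly (p ^ a) c i).eval y = y := by
  have hq : 2 ≤ p ^ a := (Fact.out : p.Prime).two_le.trans (Nat.le_self_pow ha.ne' p)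
  obtain ⟨f, hf⟩ := X_sq_dvd_coordPoly hq c i
  have hf0 : f ≠ 0 := by
    rintro rfl
    obtain ⟨j, hj, hcj⟩ := h
    exact hcj (eq_zero_of_coordPoly_eq_zero ha c i (by simpa using hf) j hj)
  obtain ⟨y, hy⟩ := IsAlgClosed.exists_root (X * f - C 1) (by
    have h1 : (X * f).degree = f.degree + 1 := by rw [mul_comm, degree_mul, degree_X]
    have h2 : 0 < (X * f).degree := by
      rw [degree_eq_natDegree (mul_ne_zero X_ne_zero hf0), natDegree_X_mul hf0]
      exact_mod_cast Nat.succ_pos _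
    rw [degree_sub_C h2]
    exact h2.ne')
  have hy' : y * f.eval y = 1 := by simpa [IsRoot, sub_eq_zero] using hy
  refine ⟨y, left_ne_zero_of_mul_eq_one hy', ?_⟩
  rw [hf, eval_mul, eval_pow, eval_X, pow_two, mul_assoc, hy', mul_one]

theorem exists_pow_sub_eq {p a : ℕ} [Fact p.Prime] (ha : 0 < a) (c : k) :
    ∃ x : k, x ^ p ^ a - x = c := by
  have hq : 1 < p ^ a := Nat.one_lt_pow ha.ne' (Fact.out : p.Prime).one_lt
  have hdeg : (X ^ p ^ a - X - C c : k[X]).degree = ((p ^ a : ℕ) : WithBot ℕ) := by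
    rw [sub_sub, degree_sub_eq_left_of_degree_lt] <;> rw [degree_X_pow]
    refine (degree_add_le _ _).trans_lt (max_lt ?_ (degree_C_le.trans_lt ?_))
    · rw [degree_X]; exact_mod_cast hq
    · exact_mod_cast hq.le
  obtain ⟨x, hx⟩ := IsAlgClosed.exists_root (X ^ p ^ a - X - C c : k[X]) (by
    rw [hdeg]
    exact_mod_cast (zero_lt_one.trans hq).ne')
  exact ⟨x, by simpa [IsRoot, sub_eq_zero] using hx⟩

variable {p a : ℕ} [Fact p.Prime] [CharP k p]

theorem exists_fixed_vector (ha : 0 < a) {V : Type*} [AddCommGroup V] [Module k V]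
    [FiniteDimensional k V] [Nontrivial V] (F : V →ₛₗ[iterateFrobenius k p a] V)
    (hF : Function.Injective F) : ∃ v, v ≠ 0 ∧ F v = v := by
  classical
  obtain ⟨v, hv⟩ := exists_ne (0 : V)
  set e : ℕ → V := fun i => F^[i] v with he
  have hFe : ∀ i, F (e i) = e (i + 1) := fun i => (Function.iterate_succ_apply' F i v).symm
  have hex : ∃ r, ¬ LinearIndependent k (fun i : Fin r => e i) := by
    refine ⟨Module.finrank k V + 1, fun h => ?_⟩
    have := h.fintype_card_le_finrank
    simp at this
  obtain ⟨s, hs⟩ : ∃ s, Nat.find hex = s + 2 := by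
    have h0 : Nat.find hex ≠ 0 := fun h =>
      (h ▸ Nat.find_spec hex) linearIndependent_empty_type
    have h1 : Nat.find hex ≠ 1 := fun h => by
      refine (h ▸ Nat.find_spec hex) (linearIndependent_unique_iff.2 ?_)
      simpa [he] using hv
    exact ⟨Nat.find hex - 2, by omega⟩
  have hli : LinearIndependent k (fun i : Fin (s + 1) => e i) :=
    not_not.1 (Nat.find_min hex (by omega))
  have hnli : ¬ LinearIndependent k (fun i : Fin (s + 2) => e i) := hs ▸ Nat.find_spec hex
  have hspan : e (s + 1) ∈ Submodule.span k (Set.range fun i : Fin (s + 1) => e i) := by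
    by_contra hcon
    exact hnli (linearIndependent_finSucc'.2 ⟨hli, hcon⟩)
  obtain ⟨c', hc'⟩ := (Submodule.mem_span_range_iff_exists_fun k).1 hspan
  obtain ⟨c, rfl⟩ : ∃ c : ℕ → k, c' = fun i : Fin (s + 1) => c i :=
    ⟨fun i => if h : i < s + 1 then c' ⟨i, h⟩ else 0, by ext i; simp [i.isLt]⟩
  rw [Fin.sum_univ_eq_sum_range (fun i => c i • e i)] at hc'
  have hen : e (s + 1) ≠ 0 := by
    intro h
    apply hv
    exact hF.iterate (s + 1) (h.trans (iterate_map_zero F (s + 1)).symm)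
  obtain ⟨y, hy0, hy⟩ := exists_eval_coordPoly_eq (p := p) ha c s (by
    by_contra! hcon
    refine hen (hc'.symm.trans (Finset.sum_eq_zero fun i hi => ?_))
    rw [hcon i (by simpa [Nat.lt_succ_iff] using hi), zero_smul])
  set x : ℕ → k := fun i => (coordPoly (p ^ a) c i).eval y with hx
  refine ⟨∑ i ∈ Finset.range (s + 1), x i • e i, fun h => ?_, ?_⟩
  · rw [← Fin.sum_univ_eq_sum_range (fun i => x i • e i)] at h
    exact hy0 (hy.symm.trans (Fintype.linearIndependent_iff.1 hli (fun i => x i) h (Fin.last s)))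
  · have hx0 : x 0 = c 0 * y ^ p ^ a := by simp [hx, coordPoly]
    have hxs : ∀ i, x (i + 1) = x i ^ p ^ a + c (i + 1) * y ^ p ^ a := by
      intro i
      simp [hx, coordPoly]
    simp only [map_sum, map_smulₛₗ, hFe, iterateFrobenius_def]
    rw [Finset.sum_range_succ, show x s = y from hy, ← hc',
      Finset.sum_range_succ' (fun i => x i • e i),
      Finset.sum_range_succ' (fun i => c i • e i), smul_add, ← add_assoc, Finset.smul_sum,
      ← Finset.sum_add_distrib, hx0, smul_smul, mul_comm (c 0)]
    congr 1
    refine Finset.sum_congr rfl fun i _ => ?_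
    rw [hxs, add_smul, smul_smul, mul_comm (c (i + 1))]

theorem span_fixed_vectors_eq_top (ha : 0 < a) {V : Type*} [AddCommGroup V] [Module k V]
    [FiniteDimensional k V] (F : V →ₛₗ[iterateFrobenius k p a] V)
    (hF : Function.Injective F) : Submodule.span k {v | F v = v} = ⊤ := by
  set W := Submodule.span k {v | F v = v} with hW
  have hq : 0 < p ^ a := pow_pos (Fact.out : p.Prime).pos a
  have hWF : ∀ w ∈ W, ∃ w' ∈ W, F w' = w := by
    intro w hw
    induction hw using Submodule.span_induction with
    | mem v hv => exact ⟨v, Submodule.subset_span hv, hv⟩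
    | zero => exact ⟨0, zero_mem _, map_zero F⟩
    | add v w _ _ hv hw =>
      obtain ⟨v', hv', rfl⟩ := hv
      obtain ⟨w', hw', rfl⟩ := hw
      exact ⟨v' + w', add_mem hv' hw', map_add F _ _⟩
    | smul d v _ hv =>
      obtain ⟨v', hv', rfl⟩ := hv
      obtain ⟨d', rfl⟩ := IsAlgClosed.exists_pow_nat_eq d hq
      exact ⟨d' • v', W.smul_mem _ hv', by rw [map_smulₛₗ, iterateFrobenius_def]⟩
  have hWsub : ∀ w ∈ W, ∀ d : k, ∃ w' ∈ W, F w' - w' = d • w := by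
    intro w hw
    induction hw using Submodule.span_induction with
    | zero => exact fun d => ⟨0, zero_mem _, by simp⟩
    | add v w _ _ hv hw =>
      intro d
      obtain ⟨v', hv', hv⟩ := hv d
      obtain ⟨w', hw', hw⟩ := hw d
      exact ⟨v' + w', add_mem hv' hw', by rw [map_add, smul_add, ← hv, ← hw]; abel⟩
    | mem v hv =>
      intro d
      obtain ⟨x, rfl⟩ := exists_pow_sub_eq (p := p) ha d
      refine ⟨x • v, W.smul_mem _ (Submodule.subset_span hv), ?_⟩
      rw [map_smulₛₗ, iterateFrobenius_def, show F v = v from hv, ← sub_smul]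
    | smul c v _ ih => exact fun d => by simpa only [smul_smul] using ih (d * c)
  by_contra hne
  have hmap : W ≤ W.comap F := Submodule.span_le.2 fun v hv => by
    rw [SetLike.mem_coe, Submodule.mem_comap, show F v = v from hv]
    exact Submodule.subset_span hv
  have : Nontrivial (V ⧸ W) := Submodule.Quotient.nontrivial_iff.2 hne
  obtain ⟨u, hu0, hu⟩ := exists_fixed_vector ha (W.mapQ W F hmap) (by
    refine (injective_iff_map_eq_zero _).2 fun u hu => ?_
    obtain ⟨v, rfl⟩ := W.mkQ_surjective u
    rw [Submodule.mkQ_apply, Submodule.mapQ_apply, Submodule.Quotient.mk_eq_zero] at hu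
    obtain ⟨w, hw, hwv⟩ := hWF _ hu
    rw [Submodule.mkQ_apply, Submodule.Quotient.mk_eq_zero, ← hF hwv]
    exact hw)
  obtain ⟨v, rfl⟩ := W.mkQ_surjective u
  rw [Submodule.mkQ_apply, Submodule.mapQ_apply, Submodule.Quotient.eq] at hu
  obtain ⟨w, hw, hwv⟩ := hWsub _ hu 1
  rw [one_smul] at hwv
  refine hu0 ((Submodule.Quotient.mk_eq_zero W).2 ?_)
  have : v - w ∈ W := Submodule.subset_span (by
    rw [Set.mem_ofPred_eq, map_sub]
    rw [sub_eq_sub_iff_add_eq_add] at hwv ⊢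
    rw [← hwv, add_comm])
  simpa using add_mem this hw

theorem exists_isUnit_eq_mul_pow (ha : 0 < a) {m : ℕ} (B : Matrix (Fin m) (Fin m) k)
    (hB : IsUnit B) : ∃ U : Matrix (Fin m) (Fin m) k, IsUnit U ∧ U = B * U.map (· ^ p ^ a) := by
  let F : (Fin m → k) →ₛₗ[iterateFrobenius k p a] (Fin m → k) :=
    { toFun v := B.mulVec fun i => v i ^ p ^ a
      map_add' v w := by
        rw [← Matrix.mulVec_add]
        congr 1
        ext i
        exact add_pow_char_pow _ _ _ _
      map_smul' d v := by
        rw [← Matrix.mulVec_smul]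
        congr 1
        ext i
        simp [mul_pow, iterateFrobenius_def] }
  have hF : Function.Injective F := by
    intro v w h
    have := Matrix.mulVec_injective_of_isUnit hB h
    ext i
    exact iterateFrobenius_inj k p a (by simpa [iterateFrobenius_def] using congrFun this i)
  obtain ⟨b, hb, hspan, hli⟩ := exists_linearIndependent k {v | F v = v}
  rw [span_fixed_vectors_eq_top ha F hF] at hspan
  let bas := Module.Basis.mk hli (by rw [Subtype.range_coe, hspan])
  let e := (Pi.basisFun k (Fin m)).indexEquiv bas
  have hli' : LinearIndependent k fun i => (e i : Fin m → k) := hli.comp _ e.injective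
  refine ⟨Matrix.of fun i j => (e j : Fin m → k) i,
    Matrix.linearIndependent_cols_iff_isUnit.1 hli', ?_⟩
  ext i j
  exact (congrFun (hb (e j).2) i).symm

end FixedVectors

/-! ### Faithfully finite étale algebras trivializing Frobenius-semilinear systems -/

section FaithfullyFiniteEtale

theorem faithfullyFlat_of_forall_isAlgClosed {R S : Type u} [CommRing R] [CommRing S]
    [Algebra R S] [Module.Flat R S]
    (h : ∀ (k : Type u) [Field k] [IsAlgClosed k] [Algebra R k], Nonempty (S →ₐ[R] k)) :
    Module.FaithfullyFlat R S := by
  refine Module.FaithfullyFlat.of_comap_surjective fun P => ?_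
  obtain ⟨f⟩ := h (AlgebraicClosure P.asIdeal.ResidueField)
  refine ⟨⟨RingHom.ker f, RingHom.ker_isPrime f⟩, PrimeSpectrum.ext ?_⟩
  ext r
  simp only [PrimeSpectrum.comap_asIdeal, Ideal.mem_comap, RingHom.mem_ker, f.commutes]
  rw [IsScalarTower.algebraMap_apply R P.asIdeal.ResidueField, map_eq_zero, ← RingHom.mem_ker,
    Ideal.ker_algebraMap_residueField]

theorem charP_of_nontrivial_algebra (p : ℕ) [Fact p.Prime] (R S : Type*) [CommRing R] [CommRing S]
    [Algebra R S] [Nontrivial S] [CharP R p] : CharP S p :=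
  (CharP.charP_iff_prime_eq_zero Fact.out).2 (by
    rw [← map_natCast (algebraMap R S), CharP.cast_eq_zero, map_zero])

/-- Composition of faithfully finite étale algebras. -/
def FaithfullyFiniteEtaleAlgebra.trans {R : Type u} [CommRing R]
    (S : FaithfullyFiniteEtaleAlgebra R) (T : FaithfullyFiniteEtaleAlgebra S.carrier) :
    FaithfullyFiniteEtaleAlgebra R :=
  letI : Algebra R T.carrier :=
    ((algebraMap S.carrier T.carrier).comp (algebraMap R S.carrier)).toAlgebra
  haveI : IsScalarTower R S.carrier T.carrier := IsScalarTower.of_algebraMap_eq fun _ => rfl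
  haveI := S.finite
  haveI := S.etale
  haveI := S.faithfullyFlat
  haveI := T.finite
  haveI := T.etale
  haveI := T.faithfullyFlat
  { carrier := T.carrier
    finite := Module.Finite.trans S.carrier T.carrier
    etale := Algebra.Etale.comp R S.carrier T.carrier
    faithfullyFlat := Module.FaithfullyFlat.trans R S.carrier T.carrier }

variable (p : ℕ) [Fact p.Prime] {a m : ℕ} {R : Type u} [CommRing R] [CharP R p] [PerfectRing R p]

theorem exists_eq_add_map_pow (ha : 0 < a) (N : Matrix (Fin m) (Fin m) R) :
    ∃ (S : FaithfullyFiniteEtaleAlgebra R) (_ : CharP S.carrier p) (_ : PerfectRing S.carrier p)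
      (Y : Matrix (Fin m) (Fin m) S.carrier),
      Y = N.map (algebraMap R S.carrier) + Y.map (· ^ p ^ a) := by
  have hq : 2 ≤ p ^ a := (Fact.out : p.Prime).two_le.trans (Nat.le_self_pow ha.ne' p)
  set B : Matrix (Fin m × Fin m) (Fin m × Fin m) R := 1
  set c : Fin m × Fin m → R := fun i => -N i.1 i.2
  have hetale : Algebra.Etale R (FrobeniusSystem (p ^ a) B c) :=
    FrobeniusSystem.etale (p := p) ha isUnit_one
  have hff : Module.FaithfullyFlat R (FrobeniusSystem (p ^ a) B c) := by
    refine faithfullyFlat_of_forall_isAlgClosed fun k _ _ _ => ?_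
    choose y hy using fun i => exists_pow_sub_eq (p := p) ha (algebraMap R k (c i))
    obtain ⟨f, -⟩ := FrobeniusSystem.exists_algHom (q := p ^ a) (B := B) (c := c) y fun i => by
      simp [B, Matrix.one_apply, ← hy i]
    exact ⟨f⟩
  have : Nontrivial R := CharP.nontrivial_of_char_ne_one (Fact.out : p.Prime).ne_one
  have : Nontrivial (FrobeniusSystem (p ^ a) B c) :=
    (FaithfulSMul.algebraMap_injective R (FrobeniusSystem (p ^ a) B c)).nontrivial
  refine ⟨⟨FrobeniusSystem (p ^ a) B c, FrobeniusSystem.finite hq, hetale, hff⟩,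
    charP_of_nontrivial_algebra p R _, ⟨FrobeniusSystem.pow_bijective ha isUnit_one⟩,
    Matrix.of fun i j => FrobeniusSystem.root _ B c (i, j), ?_⟩
  ext i j
  have := FrobeniusSystem.root_pow (p ^ a) B c (i, j)
  simp only [Matrix.add_apply, Matrix.map_apply, Matrix.of_apply]
  rw [this]
  simp [B, c, Matrix.one_apply]

open scoped Kronecker in
theorem exists_isUnit_eq_mul_map_pow (ha : 0 < a) (A : Matrix (Fin m) (Fin m) R) (hA : IsUnit A) :
    ∃ (S : FaithfullyFiniteEtaleAlgebra R) (_ : CharP S.carrier p) (_ : PerfectRing S.carrier p)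
      (U : Matrix (Fin m) (Fin m) S.carrier), IsUnit U ∧
      U = A.map (algebraMap R S.carrier) * U.map (· ^ p ^ a) := by
  have hq : 2 ≤ p ^ a := (Fact.out : p.Prime).two_le.trans (Nat.le_self_pow ha.ne' p)
  obtain ⟨A', hAA', hA'A⟩ := isUnit_iff_exists.1 hA
  set B : Matrix (Fin m × Fin m) (Fin m × Fin m) R := A' ⊗ₖ (1 : Matrix (Fin m) (Fin m) R) with hB
  have hBu : IsUnit B := isUnit_iff_exists.2 ⟨A ⊗ₖ (1 : Matrix (Fin m) (Fin m) R), by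
    rw [← Matrix.mul_kronecker_mul, hA'A, one_mul, Matrix.one_kronecker_one], by
    rw [← Matrix.mul_kronecker_mul, hAA', one_mul, Matrix.one_kronecker_one]⟩
  have hBsum : ∀ {T : Type u} [CommRing T] (f : R →+* T) (y : Fin m × Fin m → T) (i j : Fin m),
      ∑ k, f (B (i, j) k) * y k + f ((0 : Fin m × Fin m → R) (i, j)) =
        ∑ k, f (A' i k) * y (k, j) := by
    intro T _ f y i j
    simp [hB, Fintype.sum_prod_type, Matrix.one_apply, apply_ite f]
  let C := FrobeniusSystem (p ^ a) B 0
  let X : Matrix (Fin m) (Fin m) C := Matrix.of fun i j => FrobeniusSystem.root _ B 0 (i, j)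
  have hX : X.map (· ^ p ^ a) = A'.map (algebraMap R C) * X := by
    ext i j
    exact (FrobeniusSystem.root_pow (p ^ a) B 0 (i, j)).trans (hBsum _ _ i j)
  have hetale : Algebra.Etale R C := FrobeniusSystem.etale (p := p) ha hBu
  have hperf : Function.Bijective fun x : C => x ^ p := FrobeniusSystem.pow_bijective ha hBu
  have hred : IsReduced C := (isReduced_iff_pow_one_lt p (Fact.out : p.Prime).one_lt).2
    fun x hx => hperf.1 (hx.trans (zero_pow (Fact.out : p.Prime).ne_zero).symm)
  let L := Localization.Away X.det
  have hredL : IsReduced L := isReduced_localizationPreserves (Submonoid.powers X.det) L hred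
  have hff : Module.FaithfullyFlat R L := by
    refine faithfullyFlat_of_forall_isAlgClosed fun k _ _ _ => ?_
    have : CharP k p := charP_of_nontrivial_algebra p R k
    obtain ⟨U, hU, hUA⟩ := exists_isUnit_eq_mul_pow (p := p) ha (A.map (algebraMap R k))
      (hA.map (algebraMap R k).mapMatrix)
    have hUA' : U.map (· ^ p ^ a) = A'.map (algebraMap R k) * U := by
      conv_rhs => rw [hUA]
      rw [← mul_assoc, ← Matrix.map_mul, hA'A]
      simp
    obtain ⟨f, hf⟩ := FrobeniusSystem.exists_algHom (q := p ^ a) (B := B) (c := 0)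
      (fun i : Fin m × Fin m => U i.1 i.2) fun i => by
        rw [hBsum (algebraMap R k) (fun i : Fin m × Fin m => U i.1 i.2) i.1 i.2]
        exact congrFun (congrFun hUA' i.1) i.2
    have hfX : f X.det = U.det := by
      have : f X.det = _ := RingHom.map_det (f : C →+* k) X
      rw [this]
      congr 1
      ext i j
      exact hf (i, j)
    exact ⟨IsLocalization.liftAlgHom (M := Submonoid.powers X.det) (S := L) (f := f) (by
      rintro ⟨_, n, rfl⟩
      rw [map_pow, hfX]
      exact ((Matrix.isUnit_iff_isUnit_det U).1 hU).pow n)⟩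
  have : Nontrivial R := CharP.nontrivial_of_char_ne_one (Fact.out : p.Prime).ne_one
  have : Nontrivial L := (FaithfulSMul.algebraMap_injective R L).nontrivial
  have : Nontrivial C := (algebraMap C L).domain_nontrivial
  have hcharC : CharP C p := charP_of_nontrivial_algebra p R C
  have hcharL : CharP L p := charP_of_nontrivial_algebra p R L
  have hsurj : Function.Surjective (algebraMap C L) := by
    have hdet : X.det ^ p ^ a = algebraMap R C A'.det * X.det := by
      rw [RingHom.map_det, ← Matrix.det_mul, RingHom.mapMatrix_apply, ← hX,
        ← iterateFrobenius_def p a, RingHom.map_det]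
      congr 1
    have hinv : algebraMap C L X.det *
        algebraMap C L (X.det ^ (p ^ a - 2) * algebraMap R C A.det) = 1 := by
      refine (IsLocalization.Away.algebraMap_isUnit (S := L) X.det).mul_left_cancel ?_
      rw [← map_mul, ← map_mul, mul_one]
      congr 1
      have h2 : X.det * (X.det * (X.det ^ (p ^ a - 2) * algebraMap R C A.det)) =
          X.det ^ p ^ a * algebraMap R C A.det := by
        have h3 : X.det ^ p ^ a = X.det ^ (p ^ a - 2) * X.det ^ 2 := by
          rw [← pow_add, Nat.sub_add_cancel hq]
        rw [h3]
        ring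
      rw [h2, hdet, mul_right_comm, ← map_mul, ← Matrix.det_mul, hA'A, Matrix.det_one, map_one,
        one_mul]
    intro l
    obtain ⟨n, c, hc⟩ := IsLocalization.Away.surj X.det l
    refine ⟨c * (X.det ^ (p ^ a - 2) * algebraMap R C A.det) ^ n, ?_⟩
    rw [map_mul, ← hc, map_pow, mul_assoc, ← mul_pow, hinv, one_pow, mul_one]
  have hfinC : Module.Finite R C := FrobeniusSystem.finite hq
  have hfin : Module.Finite R L :=
    Module.Finite.of_surjective (IsScalarTower.toAlgHom R C L).toLinearMap hsurj
  have hperfL : PerfectRing L p := PerfectRing.ofSurjective L p fun l => by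
    obtain ⟨c, rfl⟩ := hsurj l
    obtain ⟨d, rfl⟩ := hperf.2 c
    exact ⟨algebraMap C L d, (map_pow (algebraMap C L) d p).symm⟩
  refine ⟨⟨L, hfin, inferInstance, hff⟩, hcharL, hperfL, X.map (algebraMap C L), ?_, ?_⟩
  · rw [Matrix.isUnit_iff_isUnit_det, ← RingHom.mapMatrix_apply, ← RingHom.map_det]
    exact IsLocalization.Away.algebraMap_isUnit X.det
  · have h1 : (X.map (algebraMap C L)).map (· ^ p ^ a) =
        (X.map (· ^ p ^ a)).map (algebraMap C L) := by
      ext i j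
      simp
    have h2 : A.map (algebraMap R L) = (A.map (algebraMap R C)).map (algebraMap C L) := by
      ext i j
      exact IsScalarTower.algebraMap_apply R C L _
    have h3 : A.map (algebraMap R L) * (X.map (algebraMap C L)).map (· ^ p ^ a) =
        X.map (algebraMap C L) := by
      rw [h1, hX, h2, ← Matrix.map_mul, ← mul_assoc, ← Matrix.map_mul, hAA']
      simp
    exact h3.symm

end FaithfullyFiniteEtale

/-! ### Lifting solutions along Witt vectors -/

section Witt

open WittVector

variable {p : ℕ} [Fact p.Prime] {R S : Type u} [CommRing R] [CommRing S]

theorem WittVector.isUnit_of_isUnit_coeff_zero [CharP R p] [PerfectRing R p] {x : WittVector p R}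
    (hx : IsUnit (constantCoeff x)) : IsUnit x := by
  obtain ⟨y₀, hy₀⟩ := hx.exists_right_inv
  obtain ⟨y, rfl⟩ := constantCoeff_surjective p y₀
  have hker : x * y - 1 ∈ RingHom.ker (constantCoeff : WittVector p R →+* R) := by
    rw [RingHom.mem_ker, map_sub, map_mul, hy₀, map_one, sub_self]
  rw [ker_constantCoeff] at hker
  have := Ideal.mem_jacobson_bot.1
    (IsAdicComplete.le_jacobson_bot (Ideal.span {(p : WittVector p R)}) hker) 1
  rw [mul_one, sub_add_cancel] at this
  exact isUnit_of_mul_isUnit_left this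

theorem WittVector.isUnit_matrix_of_isUnit_constantCoeff [CharP R p] [PerfectRing R p] {m : ℕ}
    {A : Matrix (Fin m) (Fin m) (WittVector p R)}
    (hA : IsUnit (A.map (constantCoeff : WittVector p R →+* R))) : IsUnit A := by
  rw [Matrix.isUnit_iff_isUnit_det, ← RingHom.mapMatrix_apply, ← RingHom.map_det] at hA
  exact (Matrix.isUnit_iff_isUnit_det A).2 (isUnit_of_isUnit_coeff_zero hA)

theorem WittVector.exists_smul_of_map_constantCoeff_eq_zero [CharP R p] [PerfectRing R p] {m : ℕ}
    {A : Matrix (Fin m) (Fin m) (WittVector p R)}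
    (hA : A.map (constantCoeff : WittVector p R →+* R) = 0) :
    ∃ Z : Matrix (Fin m) (Fin m) (WittVector p R), A = (p : WittVector p R) • Z := by
  have h : ∀ i j, ∃ z, A i j = (p : WittVector p R) * z := fun i j => by
    have : A i j ∈ RingHom.ker (constantCoeff : WittVector p R →+* R) :=
      congrFun (congrFun hA i) j
    rwa [ker_constantCoeff, Ideal.mem_span_singleton] at this
  choose Z hZ using h
  exact ⟨Matrix.of Z, by ext1 i j; exact hZ i j⟩

theorem WittVector.map_frobenius_pow (f : R →+* S) [CharP R p] [CharP S p] (a : ℕ)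
    (x : WittVector p R) : WittVector.map f ((WittVector.frobenius ^ a : WittVector p R →+* _) x) =
      (WittVector.frobenius ^ a : WittVector p S →+* _) (WittVector.map f x) := by
  ext i
  simp only [RingHom.coe_pow, map_coeff, iterate_frobenius_coeff, map_pow]

theorem WittVector.constantCoeff_frobenius_pow [CharP R p] (a : ℕ) (x : WittVector p R) :
    constantCoeff ((WittVector.frobenius ^ a : WittVector p R →+* _) x) =
      constantCoeff x ^ p ^ a := by
  rw [RingHom.coe_pow, constantCoeff_apply, iterate_frobenius_coeff, constantCoeff_apply]

theorem mul_one_add_smul_eq {K E : Type*} [CommRing K] [Ring E] [Algebra K E] {x u n y y' z : E}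
    {r s : K} (hx : x = u * (1 + (r * s) • n)) (hy : n + y' = y + r • z) :
    x * (1 + (r * s) • y') =
      u * (1 + (r * s) • y) + (r * s * r) • (u * z + s • (u * n * y')) := by
  have h : u * n + u * y' = u * y + r • (u * z) := by
    rw [← mul_add, hy, mul_add, mul_smul_comm]
  have h' := congrArg ((r * s) • ·) h
  simp only [smul_add, smul_smul] at h'
  subst hx
  simp only [mul_add, add_mul, mul_one, mul_smul_comm, smul_mul_assoc, smul_add,
    smul_smul, add_assoc]
  rw [add_left_cancel_iff, ← add_assoc, h', add_assoc, mul_assoc (r * s) r s]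

variable [CharP R p] [PerfectRing R p]

theorem exists_isUnit_eq_mul_add_smul {a m : ℕ} (ha : 0 < a)
    (A : Matrix (Fin m) (Fin m) (WittVector p R)) (hA : IsUnit A) (n : ℕ) :
    ∃ (S : FaithfullyFiniteEtaleAlgebra R) (_ : CharP S.carrier p) (_ : PerfectRing S.carrier p)
      (U M : Matrix (Fin m) (Fin m) (WittVector p S.carrier)), IsUnit U ∧
      U = A.map (WittVector.map (algebraMap R S.carrier)) *
        U.map (WittVector.frobenius ^ a : WittVector p S.carrier →+* _) +
        (p : WittVector p S.carrier) ^ (n + 1) • M := by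
  induction n with
  | zero =>
    obtain ⟨S, _, _, U₀, hU₀, hU₀A⟩ := exists_isUnit_eq_mul_map_pow p ha
      (A.map (constantCoeff : WittVector p R →+* R)) (hA.map (constantCoeff).mapMatrix)
    set U := U₀.map (teichmuller p)
    have hUc : U.map (constantCoeff : WittVector p S.carrier →+* S.carrier) = U₀ := by
      ext i j
      exact teichmuller_coeff_zero p _
    obtain ⟨M, hM⟩ := exists_smul_of_map_constantCoeff_eq_zero (p := p)
      (A := U - A.map (WittVector.map (algebraMap R S.carrier)) *
        U.map (WittVector.frobenius ^ a : WittVector p S.carrier →+* _)) (by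
      have h1 : (A.map (WittVector.map (algebraMap R S.carrier))).map
          (constantCoeff : WittVector p S.carrier →+* S.carrier) =
          (A.map (constantCoeff : WittVector p R →+* R)).map (algebraMap R S.carrier) := by
        ext i j
        simp [constantCoeff_apply]
      have h2 : (U.map (WittVector.frobenius ^ a : WittVector p S.carrier →+* _)).map
          (constantCoeff : WittVector p S.carrier →+* S.carrier) = U₀.map (· ^ p ^ a) := by
        rw [← hUc]
        ext i j
        exact constantCoeff_frobenius_pow a _
      rw [← RingHom.mapMatrix_apply, map_sub, map_mul, RingHom.mapMatrix_apply,
        RingHom.mapMatrix_apply, RingHom.mapMatrix_apply, h1, h2, hUc, sub_eq_zero]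
      exact hU₀A)
    refine ⟨S, inferInstance, inferInstance, U, M,
      isUnit_matrix_of_isUnit_constantCoeff (hUc ▸ hU₀), ?_⟩
    rw [zero_add, pow_one, ← hM, add_sub_cancel]
  | succ n ih =>
    obtain ⟨S, _, _, U, M, hU, hUA⟩ := ih
    obtain ⟨U', hUU', -⟩ := isUnit_iff_exists.1 hU
    set N := -(U' * M) with hN
    obtain ⟨T, _, _, Y₀, hY₀⟩ := exists_eq_add_map_pow p ha
      (N.map (constantCoeff : WittVector p S.carrier →+* S.carrier))
    set f : WittVector p S.carrier →+* WittVector p T.carrier :=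
      WittVector.map (algebraMap S.carrier T.carrier)
    set φ : WittVector p T.carrier →+* WittVector p T.carrier := WittVector.frobenius ^ a
    set Y := Y₀.map (teichmuller p)
    have hYc : Y.map (constantCoeff : WittVector p T.carrier →+* T.carrier) = Y₀ := by
      ext i j
      exact teichmuller_coeff_zero p _
    obtain ⟨Z, hZ⟩ := exists_smul_of_map_constantCoeff_eq_zero (p := p)
      (A := N.map f + Y.map φ - Y) (by
      have h1 : (N.map f).map (constantCoeff : WittVector p T.carrier →+* T.carrier) =
          (N.map (constantCoeff : WittVector p S.carrier →+* S.carrier)).map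
            (algebraMap S.carrier T.carrier) := by
        ext i j
        simp [constantCoeff_apply, f]
      have h2 : (Y.map φ).map (constantCoeff : WittVector p T.carrier →+* T.carrier) =
          Y₀.map (· ^ p ^ a) := by
        rw [← hYc]
        ext i j
        exact constantCoeff_frobenius_pow a _
      rw [← RingHom.mapMatrix_apply, map_sub, map_add, RingHom.mapMatrix_apply,
        RingHom.mapMatrix_apply, RingHom.mapMatrix_apply, h1, h2, hYc, sub_eq_zero]
      exact hY₀.symm)
    set P : WittVector p T.carrier :=
      (p : WittVector p T.carrier) * (p : WittVector p T.carrier) ^ n with hP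
    set V := U.map f * (1 + P • Y) with hV
    set AT : Matrix (Fin m) (Fin m) (WittVector p T.carrier) := A.map
      (WittVector.map ((algebraMap S.carrier T.carrier).comp (algebraMap R S.carrier)))
    have hX : AT * (U.map f).map φ =
        U.map f * (1 + P • N.map f) := by
      have h1 : A.map (WittVector.map (algebraMap R S.carrier)) *
          U.map (WittVector.frobenius ^ a : WittVector p S.carrier →+* _) =
          U * (1 + (p : WittVector p S.carrier) ^ (n + 1) • N) := by
        rw [mul_add, mul_one, mul_smul_comm, hN, mul_neg, ← mul_assoc, hUU', one_mul, smul_neg,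
          ← sub_eq_add_neg, eq_sub_iff_add_eq]
        exact hUA.symm
      have h2 := congrArg f.mapMatrix h1
      have h3 : (A.map (WittVector.map (algebraMap R S.carrier))).map f =
          AT := by
        ext i j
        simp [AT, f]
      have h4 : (U.map (WittVector.frobenius ^ a : WittVector p S.carrier →+* _)).map f =
          (U.map f).map φ := by
        ext1 i j
        exact map_frobenius_pow _ a _
      have h5 : f.mapMatrix ((p : WittVector p S.carrier) ^ (n + 1) • N) = P • N.map f := by
        ext1 i j
        simp [hP, pow_succ']
      rwa [map_mul, map_mul, map_add, map_one, h5, RingHom.mapMatrix_apply,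
        RingHom.mapMatrix_apply, RingHom.mapMatrix_apply, h3, h4] at h2
    have hφV : AT * V.map φ =
        V + (P * p) • (U.map f * Z + (p : WittVector p T.carrier) ^ n •
          (U.map f * N.map f * Y.map φ)) := by
      rw [← mul_one_add_smul_eq hX (sub_eq_iff_eq_add'.1 hZ), mul_assoc]
      congr 1
      have h5 : φ.mapMatrix (P • Y) = P • Y.map φ := by
        ext1 i j
        simp [hP]
      rw [hV, ← RingHom.mapMatrix_apply, map_mul, map_add, map_one, h5, RingHom.mapMatrix_apply]
    refine ⟨S.trans T, ‹CharP T.carrier p›, ‹PerfectRing T.carrier p›, V,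
      -(U.map f * Z + (p : WittVector p T.carrier) ^ n • (U.map f * N.map f * Y.map φ)), ?_, ?_⟩
    · refine (hU.map f.mapMatrix).mul ?_
      refine isUnit_matrix_of_isUnit_constantCoeff ?_
      have h5 : (constantCoeff : WittVector p T.carrier →+* T.carrier).mapMatrix (P • Y) = 0 := by
        ext1 i j
        have hPc : (constantCoeff : WittVector p T.carrier →+* T.carrier) P = 0 := by
          rw [hP, map_mul, map_natCast, CharP.cast_eq_zero, zero_mul]
        rw [RingHom.mapMatrix_apply, Matrix.map_apply, Matrix.smul_apply, smul_eq_mul, map_mul,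
          hPc, zero_mul, Matrix.zero_apply]
      rw [← RingHom.mapMatrix_apply, map_add, map_one, h5, add_zero]
      exact isUnit_one
    · have hPp : P * p = (p : WittVector p T.carrier) ^ (n + 1 + 1) := by
        rw [hP]
        ring
      rw [hPp] at hφV
      exact (eq_add_neg_of_add_eq hφV.symm).trans (congrArg _ (smul_neg _ _).symm)

end Witt
/-- Over a perfect ring `R` of characteristic `p`, any invertible matrix
`A` over `W_n(R)` can be trivialized after a faithfully finite étale extension: there are a
faithfully finite étale `R`-algebra `S` and an invertible matrix `U` over `W_n(S)` with
`U = Ā·φ^a(U)`. -/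

theorem wittVector_truncated_frobenius_descent
    (p : ℕ) [Fact p.Prime] (a n m : ℕ) (ha : 0 < a) (hn : 0 < n)
    (R : Type u) [CommRing R] [CharP R p]
    (hperf : Function.Bijective fun x : R => x ^ p)
    (A : Matrix (Fin m) (Fin m) (Wn p n R)) (hA : IsUnit A) :
    ∃ (S : FaithfullyFiniteEtaleAlgebra R) (U : Matrix (Fin m) (Fin m) (Wn p n S.carrier)),
      IsUnit U ∧
      U = A.map (WnMap p n (algebraMap R S.carrier)) *
        U.map ((⇑(WnFrobenius p n S.carrier))^[a]) := by
  have : PerfectRing R p := ⟨hperf⟩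
  obtain ⟨n, rfl⟩ : ∃ k, n = k + 1 := ⟨n - 1, by omega⟩
  choose B hB using fun i j => Ideal.Quotient.mk_surjective (A i j)
  obtain rfl : A = (Matrix.of B).map (Ideal.Quotient.mk _) := by ext i j; exact (hB i j).symm
  have hBu : IsUnit (Matrix.of B) := by
    let g : Wn p (n + 1) R →+* R := Ideal.Quotient.lift _ WittVector.constantCoeff (by
      intro x hx
      obtain ⟨c, rfl⟩ := Ideal.mem_span_singleton.1 hx
      rw [map_mul, map_pow, map_natCast, CharP.cast_eq_zero, zero_pow n.succ_ne_zero, zero_mul])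
    exact WittVector.isUnit_matrix_of_isUnit_constantCoeff (hA.map g.mapMatrix)
  obtain ⟨S, _, _, U, M, hU, hUA⟩ := exists_isUnit_eq_mul_add_smul ha (Matrix.of B) hBu n
  refine ⟨S, U.map (Ideal.Quotient.mk _), hU.map (Ideal.Quotient.mk _).mapMatrix, ?_⟩
  set π : WittVector p S.carrier →+* Wn p (n + 1) S.carrier := Ideal.Quotient.mk _
  have hφ : ∀ x, (WnFrobenius p (n + 1) S.carrier)^[a] (π x) =
      π ((WittVector.frobenius ^ a : WittVector p S.carrier →+* _) x) := by
    intro x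
    rw [RingHom.coe_pow]
    exact (Function.Semiconj.iterate_right (f := π) (fun _ => rfl) a x).symm
  have hp : π ((p : WittVector p S.carrier) ^ (n + 1)) = 0 :=
    Ideal.Quotient.eq_zero_iff_mem.2 (Ideal.mem_span_singleton_self _)
  have key := congrArg π.mapMatrix hUA
  rw [map_add, map_mul] at key
  refine key.trans ?_
  have h0 : π.mapMatrix ((p : WittVector p S.carrier) ^ (n + 1) • M) = 0 := by
    ext i j
    simp [hp]
  rw [h0, add_zero]
  congr 1
  ext i j
  exact (hφ _).symm
end

section
/- Let K be an algebraically closed field of characteristic p > 0, let a be a positive integer, set q = p^a, and let m be a positive integer. Then for every invertible m×m matrix A over K there exists an invertible m×m matrix U over K such that A = U^{-1}·U^{(q)}, where U^{(q)} denotes the matrix obtained from U by raising each entry to the q-th power. In other words, the map U ↦ U^{-1}·U^{(q)} from GL_m(K) to itself is surjective. -/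
open Polynomial in
/-- The coefficients, as polynomials in the top coefficient, of a fixed vector of a `q`-semilinear
map acting by a companion matrix with last column `c`. -/
noncomputable def fixedCoeffPoly {K : Type*} [Field K] (q : ℕ) (c : ℕ → K) : ℕ → K[X]
  | 0 => C (c 0) * X ^ q
  | i + 1 => fixedCoeffPoly q c i ^ q + C (c (i + 1)) * X ^ q

open Polynomial in
theorem X_sq_dvd_fixedCoeffPoly {K : Type*} [Field K] {q : ℕ} (hq : 2 ≤ q) (c : ℕ → K) (i : ℕ) :
    (X ^ 2 : K[X]) ∣ fixedCoeffPoly q c i := by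
  have hX (d : K) : (X ^ 2 : K[X]) ∣ C d * X ^ q := (pow_dvd_pow X hq).mul_left _
  induction i with
  | zero => exact hX _
  | succ i ih => exact dvd_add (ih.trans (dvd_pow_self _ (by omega))) (hX _)

open Polynomial in
theorem natDegree_fixedCoeffPoly {K : Type*} [Field K] {q : ℕ} (hq : 2 ≤ q) {c : ℕ → K}
    (hc : c 0 ≠ 0) (i : ℕ) : (fixedCoeffPoly q c i).natDegree = q ^ (i + 1) := by
  induction i with
  | zero => simp [fixedCoeffPoly, hc]
  | succ i ih =>
    have hlt : (C (c (i + 1)) * X ^ q).natDegree < (fixedCoeffPoly q c i ^ q).natDegree := by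
      refine (natDegree_C_mul_X_pow_le _ _).trans_lt ?_
      rw [natDegree_pow, ih]
      exact lt_mul_of_one_lt_right (by omega) (Nat.one_lt_pow (by omega) (by omega))
    rw [fixedCoeffPoly, natDegree_add_eq_left_of_natDegree_lt hlt, natDegree_pow, ih]
    ring

open Polynomial in
theorem exists_ne_zero_eval_fixedCoeffPoly_eq {K : Type*} [Field K] [IsAlgClosed K] {q : ℕ}
    (hq : 2 ≤ q) {c : ℕ → K} (hc : c 0 ≠ 0) (i : ℕ) :
    ∃ y : K, y ≠ 0 ∧ (fixedCoeffPoly q c i).eval y = y := by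
  obtain ⟨r, hr⟩ := X_sq_dvd_fixedCoeffPoly hq c i
  have hr0 : r ≠ 0 := by
    rintro rfl
    have := natDegree_fixedCoeffPoly hq hc i
    rw [hr, mul_zero, natDegree_zero] at this
    exact (pow_pos (by omega : 0 < q) _).ne this
  have hdeg : (X * r - C 1).degree ≠ 0 := by
    have hnat : (X * r - C 1).natDegree = r.natDegree + 1 := by
      rw [natDegree_sub_C, natDegree_X_mul hr0]
    intro h
    have := natDegree_eq_zero_iff_degree_le_zero.mpr h.le
    omega
  obtain ⟨y, hy⟩ := IsAlgClosed.exists_root _ hdeg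
  have hy' : y * r.eval y = 1 := by simpa [sub_eq_zero] using hy
  refine ⟨y, fun h => by simp [h] at hy', ?_⟩
  rw [hr]
  simp only [eval_mul, eval_pow, eval_X]
  linear_combination y * hy'

open Polynomial in
theorem IsAlgClosed.exists_pow_sub_self_eq {K : Type*} [Field K] [IsAlgClosed K] {q : ℕ}
    (hq : 2 ≤ q) (c : K) : ∃ y : K, y ^ q - y = c := by
  have hdeg : (X ^ q - X - C c : K[X]).degree ≠ 0 := by
    have hnat : (X ^ q - X - C c : K[X]).natDegree = q := by
      rw [natDegree_sub_C, natDegree_sub_eq_left_of_natDegree_lt (by simp; omega),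
        natDegree_X_pow]
    intro h
    have := natDegree_eq_zero_iff_degree_le_zero.mpr h.le
    omega
  obtain ⟨y, hy⟩ := IsAlgClosed.exists_root _ hdeg
  exact ⟨y, by simpa [sub_eq_zero] using hy⟩

theorem exists_eq_sum_range_smul {K V : Type*} [Field K] [AddCommGroup V] [Module K V]
    [FiniteDimensional K V] (f : ℕ → V) :
    ∃ (n : ℕ) (c : ℕ → K), f n = ∑ i ∈ Finset.range n, c i • f i := by
  let S : ℕ →o Submodule K V :=
    ⟨fun n => Submodule.span K (f '' (Finset.range n : Set ℕ)), fun i j hij =>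
      Submodule.span_mono (Set.image_mono (by
        exact_mod_cast Finset.range_mono hij))⟩
  obtain ⟨n, hn⟩ := monotone_stabilizes_iff_noetherian.mpr (inferInstance : IsNoetherian K V) S
  have hmem : f n ∈ S n := by
    rw [hn (n + 1) n.le_succ]
    exact Submodule.subset_span ⟨n, by simp, rfl⟩
  obtain ⟨c, hc⟩ := Submodule.mem_span_image_finset_iff_exists_fun K |>.mp hmem
  refine ⟨n, fun i => if h : i ∈ Finset.range n then c ⟨i, h⟩ else 0, ?_⟩
  rw [← hc, ← Finset.sum_coe_sort (Finset.range n)]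
  exact Finset.sum_congr rfl fun i _ => by simp only [dif_pos i.2]

/-- An injective `q`-semilinear endomorphism of a nonzero finite-dimensional space over an
algebraically closed field has a nonzero fixed vector. -/
theorem exists_ne_zero_fixed_of_injective {K V : Type*} [Field K] [IsAlgClosed K]
    [AddCommGroup V] [Module K V] [FiniteDimensional K V] [Nontrivial V] {q : ℕ} (hq : 2 ≤ q)
    {σ : K →+* K} (hσ : ∀ x, σ x = x ^ q) (φ : V →ₛₗ[σ] V) (hφ : Function.Injective φ) :
    ∃ w : V, w ≠ 0 ∧ φ w = w := by
  classical
  obtain ⟨v, hv⟩ := exists_ne (0 : V)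
  let f : ℕ → V := fun n => φ^[n] v
  have hf (n : ℕ) : φ (f n) = f (n + 1) := (Function.iterate_succ_apply' φ n v).symm
  have hex := exists_eq_sum_range_smul (K := K) f
  obtain ⟨c, hc⟩ := Nat.find_spec hex
  have hmin := fun k => Nat.find_min hex (m := k)
  generalize Nat.find hex = n at hc hmin
  obtain _ | m := n
  · exact absurd (by simpa [f] using hc) hv
  have hm := hmin m m.lt_succ_self
  have hc0 : c 0 ≠ 0 := by
    intro h0
    choose b hb using fun i => IsAlgClosed.exists_pow_nat_eq (c (i + 1)) (by omega : 0 < q)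
    refine hm ⟨b, hφ ?_⟩
    rw [hf, hc, Finset.sum_range_succ', h0, zero_smul, add_zero, map_sum]
    exact Finset.sum_congr rfl fun i _ => by rw [map_smulₛₗ, hσ, hb, hf]
  obtain ⟨y, hy, hyx⟩ := exists_ne_zero_eval_fixedCoeffPoly_eq hq hc0 m
  let x : ℕ → K := fun i => (fixedCoeffPoly q c i).eval y
  have hxm : x m = y := hyx
  have hx0 : x 0 = c 0 * y ^ q := by simp [x, fixedCoeffPoly]
  have hxs (i : ℕ) : x (i + 1) = x i ^ q + c (i + 1) * y ^ q := by simp [x, fixedCoeffPoly]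
  refine ⟨∑ i ∈ Finset.range (m + 1), x i • f i, fun h => hm ⟨fun i => -(y⁻¹ * x i), ?_⟩, ?_⟩
  · rw [Finset.sum_range_succ, hxm] at h
    have h' := congrArg (y⁻¹ • ·) h
    simp only [smul_add, smul_smul, inv_mul_cancel₀ hy, one_smul, smul_zero,
      Finset.smul_sum] at h'
    simp only [neg_smul, Finset.sum_neg_distrib]
    exact eq_neg_of_add_eq_zero_right h'
  · simp only [map_sum, map_smulₛₗ, hσ, hf]
    rw [Finset.sum_range_succ, hxm, hc, Finset.sum_range_succ' (fun i => x i • f i),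
      Finset.sum_range_succ' (fun i => c i • f i), hx0]
    simp only [hxs, add_smul, Finset.sum_add_distrib, smul_add, Finset.smul_sum, smul_smul,
      mul_comm (y ^ q)]
    abel

/-- The fixed vectors of an injective `q`-semilinear endomorphism of a finite-dimensional space
over an algebraically closed field span the space. -/
theorem span_fixed_eq_top_of_injective {K V : Type*} [Field K] [IsAlgClosed K]
    [AddCommGroup V] [Module K V] [FiniteDimensional K V] {q : ℕ} (hq : 2 ≤ q)
    {σ : K →+* K} (hσ : ∀ x, σ x = x ^ q) (φ : V →ₛₗ[σ] V) (hφ : Function.Injective φ) :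
    Submodule.span K {v : V | φ v = v} = ⊤ := by
  set W := Submodule.span K {v : V | φ v = v} with hW
  have hroot : ∀ w ∈ W, ∃ w' ∈ W, φ w' = w := by
    intro w hw
    induction hw using Submodule.span_induction with
    | mem v hv => exact ⟨v, Submodule.subset_span hv, hv⟩
    | zero => exact ⟨0, W.zero_mem, map_zero φ⟩
    | add u v _ _ hu hv =>
      obtain ⟨u', hu', rfl⟩ := hu
      obtain ⟨v', hv', rfl⟩ := hv
      exact ⟨u' + v', W.add_mem hu' hv', map_add φ _ _⟩
    | smul c v _ hv =>
      obtain ⟨v', hv', rfl⟩ := hv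
      obtain ⟨d, rfl⟩ := IsAlgClosed.exists_pow_nat_eq c (by omega : 0 < q)
      exact ⟨d • v', W.smul_mem d hv', by rw [map_smulₛₗ, hσ]⟩
  have hsub : ∀ w ∈ W, ∃ w' ∈ W, φ w' - w' = w := by
    intro w hw
    induction hw using Submodule.closure_induction with
    | zero => exact ⟨0, W.zero_mem, by simp⟩
    | add u v _ _ hu hv =>
      obtain ⟨u', hu', rfl⟩ := hu
      obtain ⟨v', hv', rfl⟩ := hv
      exact ⟨u' + v', W.add_mem hu' hv', by rw [map_add]; abel⟩
    | smul_mem c v hv =>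
      obtain ⟨d, rfl⟩ := IsAlgClosed.exists_pow_sub_self_eq hq c
      refine ⟨d • v, W.smul_mem d (Submodule.subset_span hv), ?_⟩
      rw [map_smulₛₗ, hσ, show φ v = v from hv, sub_smul]
  have hle : W ≤ W.comap φ := Submodule.span_le.mpr fun v hv => by
    rw [SetLike.mem_coe, Submodule.mem_comap, show φ v = v from hv]
    exact Submodule.subset_span hv
  have hinj : Function.Injective (W.mapQ W φ hle) := by
    rw [injective_iff_map_eq_zero]
    intro x hx
    obtain ⟨v, rfl⟩ := W.mkQ_surjective x
    rw [Submodule.mkQ_apply, Submodule.mapQ_apply, Submodule.Quotient.mk_eq_zero] at hx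
    obtain ⟨w, hw, hwv⟩ := hroot _ hx
    rw [Submodule.mkQ_apply, Submodule.Quotient.mk_eq_zero, ← hφ hwv]
    exact hw
  by_contra hne
  have : Nontrivial (V ⧸ W) := Submodule.Quotient.nontrivial_iff.mpr hne
  obtain ⟨x, hx0, hx⟩ := exists_ne_zero_fixed_of_injective hq hσ (W.mapQ W φ hle) hinj
  obtain ⟨v, rfl⟩ := W.mkQ_surjective x
  rw [Submodule.mkQ_apply, Submodule.mapQ_apply, Submodule.Quotient.eq] at hx
  obtain ⟨w, hw, hwv⟩ := hsub _ hx
  rw [Submodule.mkQ_apply, Ne, Submodule.Quotient.mk_eq_zero] at hx0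
  have hfix : φ (v - w) = v - w := by
    rw [map_sub, sub_eq_sub_iff_sub_eq_sub, hwv]
  exact hx0 ((W.sub_mem_iff_left hw).mp (Submodule.subset_span hfix))

/-- Lang's theorem for `GL_m`: over an algebraically closed field `K` of
characteristic `p`, with `q = p^a`, every invertible matrix `A` can be written as
`U⁻¹ · U^{(q)}`, where `U^{(q)}` is the entrywise `q`-th power of `U`. -/
theorem lang_surjectivity_GL
    (p : ℕ) (hp : p.Prime) (K : Type*) [Field K] [IsAlgClosed K] [CharP K p]
    (a : ℕ) (ha : 0 < a) (m : ℕ) (hm : 0 < m)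
    (A : Matrix (Fin m) (Fin m) K) (hA : IsUnit A) :
    ∃ U : Matrix (Fin m) (Fin m) K,
      IsUnit U ∧ A = U⁻¹ * U.map (fun x => x ^ (p ^ a)) := by
  have : Fact p.Prime := ⟨hp⟩
  have hq : 2 ≤ p ^ a := hp.two_le.trans (Nat.le_self_pow ha.ne' p)
  have hAdet : IsUnit A.det := (Matrix.isUnit_iff_isUnit_det A).mp hA
  let σ : K →+* K := iterateFrobenius K p a
  have hσ (x : K) : σ x = x ^ p ^ a := iterateFrobenius_def p a x
  let φ : (Fin m → K) →ₛₗ[σ] (Fin m → K) :=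
    { toFun := fun v => Matrix.vecMul (σ ∘ v) A⁻¹
      map_add' := fun u v => by
        rw [← Matrix.add_vecMul]
        congr 1
        ext i
        simp
      map_smul' := fun c v => by
        rw [← Matrix.smul_vecMul]
        congr 1
        ext i
        simp }
  have hφA (v : Fin m → K) : Matrix.vecMul (φ v) A = σ ∘ v := by
    change Matrix.vecMul (Matrix.vecMul (σ ∘ v) A⁻¹) A = σ ∘ v
    rw [Matrix.vecMul_vecMul, Matrix.nonsing_inv_mul A hAdet, Matrix.vecMul_one]
  have hφ : Function.Injective φ := fun u v huv =>
    σ.injective.comp_left (by simpa only [hφA] using congrArg (Matrix.vecMul · A) huv)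
  have hspan := span_fixed_eq_top_of_injective hq hσ φ hφ
  let b := Module.Basis.ofSpan hspan.ge
  have hb (i) : φ (b i) = b i := Module.Basis.ofSpan_subset hspan.ge ⟨i, rfl⟩
  let b' := b.reindex (b.indexEquiv (Pi.basisFun K (Fin m)))
  have hb' (i) : φ (b' i) = b' i := by simpa [b'] using hb _
  let U : Matrix (Fin m) (Fin m) K := Matrix.of b'
  have hU : IsUnit U := Matrix.linearIndependent_rows_iff_isUnit.mp b'.linearIndependent
  have hUA : U * A = U.map (fun x => x ^ p ^ a) := by
    ext i j
    have h := congrFun (hφA (b' i)) j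
    rw [hb'] at h
    rw [Function.comp_apply, hσ] at h
    exact h
  refine ⟨U, hU, ?_⟩
  rw [← hUA, Matrix.nonsing_inv_mul_cancel_left _ _ ((Matrix.isUnit_iff_isUnit_det U).mp hU)]
end

section
/- Let p be a prime and let R be a commutative ring of characteristic p on which the Frobenius map x ↦ x^p is bijective (i.e., R is a perfect 𝔽_p-algebra). Let S be an R-algebra that is finite étale over R, i.e., S is finite as an R-module and is an étale R-algebra. Then the p-power map x ↦ x^p is bijective on S; that is, S is also perfect. -/
universe u

/-- An étale algebra with surjective structure map whose kernel consists of nilpotent elements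
has an injective structure map. -/
theorem injective_algebraMap_of_etale_of_surjective_of_isNilpotent
    {A B : Type*} [CommRing A] [CommRing B] [Algebra A B] [Algebra.Etale A B]
    (hsurj : Function.Surjective (algebraMap A B))
    (hker : ∀ a : A, algebraMap A B a = 0 → IsNilpotent a) :
    Function.Injective (algebraMap A B) := by
  have hfg : (RingHom.ker (algebraMap A B)).FG :=
    Algebra.FinitePresentation.ker_fG_of_surjective (Algebra.ofId A B) hsurj
  obtain ⟨e, he, heq⟩ := (Ideal.isIdempotentElem_iff_of_fg _ hfg).mp
    ((Algebra.FormallyEtale.iff_of_surjective hsurj).mp inferInstance)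
  have hmem : e ∈ RingHom.ker (algebraMap A B) := heq ▸ Ideal.mem_span_singleton_self e
  obtain ⟨n, hn⟩ := hker e hmem
  have he0 : e = 0 := by
    have h := he.pow_succ_eq n
    rw [pow_succ, hn, zero_mul] at h
    exact h.symm
  rw [RingHom.injective_iff_ker_eq_bot, heq, he0]
  simp

open TensorProduct in
/-- A finite unramified algebra in which every `1 ⊗ b - b ⊗ 1` is nilpotent has surjective
structure map. -/
theorem surjective_algebraMap_of_formallyUnramified_of_isNilpotent
    {A B : Type*} [CommRing A] [CommRing B] [Algebra A B] [Module.Finite A B]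
    [Algebra.FormallyUnramified A B]
    (hnil : ∀ b : B, IsNilpotent (1 ⊗ₜ[A] b - b ⊗ₜ[A] 1 : B ⊗[A] B)) :
    Function.Surjective (algebraMap A B) := by
  rw [← Algebra.isEpi_iff_surjective_algebraMap_of_finite, Algebra.isEpi_iff_forall_one_tmul_eq]
  obtain ⟨t, ht, ht1⟩ := Algebra.FormallyUnramified.iff_exists_tensorProduct.mp
    (inferInstance : Algebra.FormallyUnramified A B)
  have hle : KaehlerDifferential.ideal A B ≤ nilradical (B ⊗[A] B) := by
    rw [← KaehlerDifferential.span_range_eq_ideal, Ideal.span_le]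
    rintro _ ⟨b, rfl⟩
    exact hnil b
  have hu : IsUnit t := by
    have h : IsNilpotent (1 - t) := hle <| by
      simp [KaehlerDifferential.ideal, RingHom.mem_ker, ht1]
    simpa using h.isUnit_one_sub
  intro b
  exact sub_eq_zero.mp (hu.mul_left_eq_zero.mp (ht b))

/-- If `f` and `g.comp f` are étale, then so is `g`. -/
theorem RingHom.Etale.of_comp_etale {A B C : Type*} [CommRing A] [CommRing B] [CommRing C]
    {f : A →+* B} {g : B →+* C} (hf : f.Etale) (hgf : (g.comp f).Etale) : g.Etale := by
  algebraize [f, g, g.comp f]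
  exact Algebra.Etale.of_restrictScalars (R := A) (A := B) (B := C)

open TensorProduct in
/-- A finite étale ring homomorphism `f : A →+* B` in characteristic `p`, whose kernel is killed
by Frobenius and whose image contains all `p`-th powers, is bijective. -/
theorem RingHom.Etale.bijective_of_pow {A B : Type*} [CommRing A] [CommRing B]
    {p : ℕ} [ExpChar B p] {f : A →+* B} (hf : f.Etale) (hfin : f.Finite)
    (hker : ∀ a, f a = 0 → a ^ p = 0) (hpow : ∀ b, ∃ a, f a = b ^ p) :
    Function.Bijective f := by
  algebraize [f]
  have hsurj : Function.Surjective (algebraMap A B) := by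
    refine surjective_algebraMap_of_formallyUnramified_of_isNilpotent fun b => ⟨p, ?_⟩
    obtain ⟨a, ha⟩ := hpow b
    replace ha : algebraMap A B a = b ^ p := ha
    have : ExpChar (B ⊗[A] B) p := by
      refine expChar_of_injective_ringHom
        (f := (Algebra.TensorProduct.includeLeft : B →ₐ[A] B ⊗[A] B).toRingHom) ?_ p
      exact Function.LeftInverse.injective
        (g := Algebra.TensorProduct.lmul' A) fun b => by simp
    rw [sub_pow_expChar, Algebra.TensorProduct.tmul_pow, Algebra.TensorProduct.tmul_pow, ← ha,
      one_pow, Algebra.algebraMap_eq_smul_one, TensorProduct.tmul_smul,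
      TensorProduct.smul_tmul', sub_self]
  exact ⟨injective_algebraMap_of_etale_of_surjective_of_isNilpotent hsurj
    fun a ha => ⟨p, hker a ha⟩, hsurj⟩

/-- A finite étale algebra over a perfect ring of characteristic `p`
is itself perfect: the `p`-power map is bijective on `S`. -/
theorem finite_etale_algebra_over_perfect_is_perfect
    (p : ℕ) (hp : p.Prime) (R S : Type u) [CommRing R] [CharP R p]
    (hR : Function.Bijective fun x : R => x ^ p)
    [CommRing S] [Algebra R S] [Module.Finite R S] [Algebra.Etale R S] :
    Function.Bijective fun x : S => x ^ p := by
  have : Fact p.Prime := ⟨hp⟩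
  have : ExpChar R p := .prime hp
  have : CharP S p ∨ Subsingleton S := by
    by_cases h : Subsingleton S
    · exact .inr h
    · have := not_subsingleton_iff_nontrivial.mp h
      have hS : (p : S) = 0 := by
        rw [← map_natCast (algebraMap R S), CharP.cast_eq_zero, map_zero]
      exact .inl ((CharP.charP_iff_prime_eq_zero hp).mpr hS)
  rcases this with _ | _
  swap
  · exact ⟨fun _ _ _ => Subsingleton.elim _ _, fun y => ⟨y, Subsingleton.elim _ _⟩⟩
  have : ExpChar S p := .prime hp
  let φ := frobenius R p
  let F := frobenius S p
  have hφ : Function.Bijective φ := hR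
  have hcomm : F.comp (algebraMap R S) = (algebraMap R S).comp φ :=
    RingHom.ext fun r => ((algebraMap R S).map_frobenius p r).symm
  have hι : (algebraMap R S).Etale := (RingHom.etale_algebraMap).mpr inferInstance
  have hcomp : (F.comp (algebraMap R S)).Etale := hcomm ▸
    RingHom.Etale.stableUnderComposition _ _ (.of_bijective hφ) hι
  have hfin : (F.comp (algebraMap R S)).Finite := hcomm ▸
    RingHom.Finite.comp (RingHom.finite_algebraMap.mpr inferInstance)
      (RingHom.Finite.of_surjective φ hφ.2)
  have hF : F.Etale := hι.of_comp_etale hcomp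
  exact hF.bijective_of_pow (p := p) (.of_comp_finite hfin) (fun _ h => h) fun b => ⟨b, rfl⟩
end

section
/- Let p be a prime and let R be a commutative ring of characteristic p (so R is an 𝔽_p-algebra via the unique ring homomorphism 𝔽_p → R). Let e ∈ R satisfy e^p = e. For each i ∈ 𝔽_p define e_i = ∏_{j ∈ 𝔽_p, j ≠ i} (i − j)^{-1}·(e − j), where elements of 𝔽_p are viewed in R via the structure map and (i − j)^{-1} is the inverse of the nonzero element i − j in 𝔽_p. Then each e_i is an idempotent of R (e_i² = e_i), and ∑_{i ∈ 𝔽_p} i·e_i = e. -/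
/-- The candidate idempotent `e_i = ∏_{j ≠ i} (i − j)⁻¹ · (e − j)` attached to an element
`e` with `e^p = e` of a commutative ring `R` of characteristic `p`, for `i ∈ 𝔽_p`. -/
def langIdempotent (p : ℕ) [Fact p.Prime] {R : Type*} [CommRing R] [CharP R p]
    (e : R) (i : ZMod p) : R :=
  ∏ j ∈ Finset.univ.erase i,
    (ZMod.castHom (dvd_refl p) R ((i - j)⁻¹) * (e - ZMod.castHom (dvd_refl p) R j))

open Polynomial in
/-- A polynomial over `ZMod p` vanishing at every point of `ZMod p` vanishes at every root of
`X ^ p - X` in a ring of characteristic `p`. -/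
theorem eval₂_castHom_eq_zero_of_forall_eval_eq_zero
    (p : ℕ) [Fact p.Prime] {R : Type*} [CommRing R] [CharP R p]
    {e : R} (he : e ^ p = e) {f : (ZMod p)[X]} (hf : ∀ x, f.eval x = 0) :
    f.eval₂ (ZMod.castHom (dvd_refl p) R) e = 0 := by
  have hp : 1 < p := (Fact.out : p.Prime).one_lt
  have hmonic : (X ^ p - X : (ZMod p)[X]).Monic :=
    monic_X_pow_sub (by rw [degree_X]; exact_mod_cast hp)
  have hmod : f %ₘ (X ^ p - X) = 0 := by
    refine Polynomial.eq_zero_of_degree_lt_of_eval_finset_eq_zero Finset.univ ?_ fun x _ => ?_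
    · rw [Finset.card_univ, ZMod.card]
      refine (degree_modByMonic_lt f hmonic).trans_eq ?_
      rw [degree_eq_natDegree hmonic.ne_zero, FiniteField.X_pow_card_sub_X_natDegree_eq _ hp]
    · rw [modByMonic_eq_sub_mul_div]
      simp [hf, ZMod.pow_card]
  obtain ⟨g, rfl⟩ := (modByMonic_eq_zero_iff_dvd hmonic).1 hmod
  simp [eval₂_mul, he]

theorem langIdempotent_eq_eval₂_basis (p : ℕ) [Fact p.Prime] {R : Type*} [CommRing R] [CharP R p]
    (e : R) (i : ZMod p) :
    langIdempotent p e i =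
      (Lagrange.basis Finset.univ id i).eval₂ (ZMod.castHom (dvd_refl p) R) e := by
  simp [langIdempotent, Lagrange.basis, Lagrange.basisDivisor, Polynomial.eval₂_finsetProd,
    Polynomial.eval₂_mul]

theorem eval_lagrange_basis_univ {F : Type*} [Field F] [Fintype F] [DecidableEq F] (i x : F) :
    (Lagrange.basis Finset.univ id i).eval x = if i = x then 1 else 0 := by
  split_ifs with h
  · subst h
    exact Lagrange.eval_basis_self (v := id) Function.injective_id.injOn (Finset.mem_univ i)
  · exact Lagrange.eval_basis_of_ne (v := id) h (Finset.mem_univ x)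

/-- If `e^p = e` in a commutative ring `R` of characteristic `p`, then
each `e_i = ∏_{j ≠ i} (i − j)⁻¹(e − j)` is idempotent and `∑_{i ∈ 𝔽_p} i·e_i = e`. -/
theorem langIdempotent_isIdempotent_and_sum
    (p : ℕ) [Fact p.Prime] (R : Type*) [CommRing R] [CharP R p]
    (e : R) (he : e ^ p = e) :
    (∀ i : ZMod p, langIdempotent p e i * langIdempotent p e i = langIdempotent p e i) ∧
    (∑ i : ZMod p, ZMod.castHom (dvd_refl p) R i * langIdempotent p e i) = e := by
  constructor
  · intro i
    have h := eval₂_castHom_eq_zero_of_forall_eval_eq_zero p he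
      (f := Lagrange.basis Finset.univ id i * Lagrange.basis Finset.univ id i -
        Lagrange.basis Finset.univ id i) fun x => by
        by_cases h : i = x <;> simp [eval_lagrange_basis_univ, h]
    rw [Polynomial.eval₂_sub, Polynomial.eval₂_mul, ← langIdempotent_eq_eval₂_basis] at h
    exact sub_eq_zero.1 h
  · have h := eval₂_castHom_eq_zero_of_forall_eval_eq_zero p he
      (f := ∑ i : ZMod p, Polynomial.C i * Lagrange.basis Finset.univ id i - Polynomial.X)
      fun x => by simp [Polynomial.eval_finsetSum, eval_lagrange_basis_univ]
    simp only [Polynomial.eval₂_sub, Polynomial.eval₂_finsetSum, Polynomial.eval₂_mul,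
      Polynomial.eval₂_C, Polynomial.eval₂_X, ← langIdempotent_eq_eval₂_basis] at h
    exact sub_eq_zero.1 h
end

section
/- Let p be a prime and let R and S be commutative rings of characteristic p, each perfect (the map x ↦ x^p is bijective) and each complete with respect to a power-multiplicative nonarchimedean ring norm (a norm with ‖x+y‖ ≤ max(‖x‖,‖y‖), ‖xy‖ ≤ ‖x‖·‖y‖, and ‖xⁿ‖ = ‖x‖ⁿ for all n ≥ 1). Let f : R → S be a ring homomorphism that is strict, meaning there exists c > 0 such that every y in the image of f admits a preimage x ∈ R with f(x) = y and ‖x‖ ≤ c·‖y‖. Then f is almost optimal: for every ε > 0, every y in the image of f admits a preimage x ∈ R with f(x) = y and ‖x‖ ≤ (1+ε)·‖y‖. -/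
/-- A power-multiplicative nonarchimedean ring norm with respect to which the ring is
complete (every Cauchy sequence converges). -/
structure PowMulBanachNorm (A : Type*) [CommRing A] where
  nrm : A → ℝ
  nonneg : ∀ x, 0 ≤ nrm x
  eq_zero_iff : ∀ x, nrm x = 0 ↔ x = 0
  nonarch : ∀ x y, nrm (x + y) ≤ max (nrm x) (nrm y)
  submul : ∀ x y, nrm (x * y) ≤ nrm x * nrm y
  powmul : ∀ (x : A) (n : ℕ), 1 ≤ n → nrm (x ^ n) = nrm x ^ n
  complete : ∀ u : ℕ → A,
    (∀ ε : ℝ, 0 < ε → ∃ N : ℕ, ∀ m ≥ N, ∀ n ≥ N, nrm (u m - u n) < ε) →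
    ∃ x : A, ∀ ε : ℝ, 0 < ε → ∃ N : ℕ, ∀ n ≥ N, nrm (u n - x) < ε

/-- A strict homomorphism between perfect uniform Banach
`𝔽_p`-algebras is almost optimal: if every element of the image lifts with norm at most
`c` times its norm (for some fixed `c > 0`), then for every `ε > 0` every element of the
image lifts with norm at most `(1 + ε)` times its norm. -/
theorem strict_hom_of_perfect_uniform_is_almost_optimal
    (p : ℕ) (hp : p.Prime) (R S : Type*) [CommRing R] [CommRing S]
    [CharP R p] [CharP S p]
    (hRperf : Function.Bijective fun x : R => x ^ p)
    (hSperf : Function.Bijective fun x : S => x ^ p)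
    (νR : PowMulBanachNorm R) (νS : PowMulBanachNorm S)
    (f : R →+* S)
    (hstrict : ∃ c : ℝ, 0 < c ∧ ∀ y ∈ Set.range f, ∃ x : R, f x = y ∧ νR.nrm x ≤ c * νS.nrm y) :
    ∀ ε : ℝ, 0 < ε → ∀ y ∈ Set.range f, ∃ x : R, f x = y ∧ νR.nrm x ≤ (1 + ε) * νS.nrm y := by
  intro ε hε y hy
  obtain ⟨c, -, hc⟩ := hstrict
  obtain ⟨n, hn⟩ := pow_unbounded_of_one_lt c (by linarith : (1 : ℝ) < 1 + ε)
  have hcn : c ≤ (1 + ε) ^ p ^ n :=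
    hn.le.trans (pow_le_pow_right₀ (by linarith) (Nat.lt_pow_self hp.one_lt).le)
  have hpn : 1 ≤ p ^ n := Nat.one_le_pow _ _ hp.pos
  obtain ⟨x₀, rfl⟩ := hy
  obtain ⟨z, hz, hzle⟩ := hc (f x₀ ^ p ^ n) ⟨x₀ ^ p ^ n, map_pow f _ _⟩
  obtain ⟨x, rfl⟩ : ∃ x : R, x ^ p ^ n = z := by
    simpa only [pow_iterate] using (hRperf.surjective.iterate n) z
  refine ⟨x, ?_, ?_⟩
  · have hinj := hSperf.injective.iterate n
    rw [pow_iterate] at hinj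
    exact hinj (by simpa only [map_pow] using hz)
  · rw [νR.powmul x _ hpn, νS.powmul _ _ hpn] at hzle
    have hy0 := νS.nonneg (f x₀)
    refine le_of_pow_le_pow_left₀ (by lia) (by positivity) (hzle.trans ?_)
    rw [mul_pow]
    gcongr
end

section
/- Let R, R1, R2, R12 be nonarchimedean Banach rings with bounded ring homomorphisms R → R1, R → R2, R1 → R12, R2 → R12 forming a commuting square such that: (i) the sequence 0 → R → R1 ⊕ R2 → R12 → 0 is exact, where R → R1 ⊕ R2 sends r to the pair of its images and R1 ⊕ R2 → R12 sends (x, y) to the difference of the images of x and y; (ii) the surjection R1 ⊕ R2 → R12 is strict: there exists C > 0 such that every z ∈ R12 can be written as the image of x minus the image of y with x ∈ R1, y ∈ R2, ‖x‖ ≤ C‖z‖, and ‖y‖ ≤ C‖z‖; and (iii) the image of R2 in R12 is dense. Then for every glueing datum over this square in which M1, M2, M12 are finite projective modules over R1, R2, R12 respectively, the R-module M is finitely presented, and the natural maps M ⊗_R R1 → M1 and M ⊗_R R2 → M2 are bijective. -/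
open TensorProduct

/-- A nonarchimedean Banach ring norm: submultiplicative, ultrametric, and complete
(every Cauchy sequence converges). -/
structure NABanachNorm (A : Type*) [CommRing A] where
  nrm : A → ℝ
  nonneg : ∀ x, 0 ≤ nrm x
  eq_zero_iff : ∀ x, nrm x = 0 ↔ x = 0
  nonarch : ∀ x y, nrm (x + y) ≤ max (nrm x) (nrm y)
  submul : ∀ x y, nrm (x * y) ≤ nrm x * nrm y
  complete : ∀ u : ℕ → A,
    (∀ ε : ℝ, 0 < ε → ∃ N : ℕ, ∀ m ≥ N, ∀ n ≥ N, nrm (u m - u n) < ε) →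
    ∃ x : A, ∀ ε : ℝ, 0 < ε → ∃ N : ℕ, ∀ n ≥ N, nrm (u n - x) < ε

/-- A ring homomorphism between normed rings is bounded. -/
def IsBoundedHom {A B : Type*} [CommRing A] [CommRing B]
    (νA : NABanachNorm A) (νB : NABanachNorm B) (f : A →+* B) : Prop :=
  ∃ C : ℝ, 0 < C ∧ ∀ x : A, νB.nrm (f x) ≤ C * νA.nrm x

/-- Small elements `D` admit a solution of `φ₁ X - φ₂ Y = D + D * φ₂ Y`, i.e. of
`1 + φ₁ X = (1 + D) * (1 + φ₂ Y)`, with `X` of norm less than one. -/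
theorem exists_additive_splitting {S1 S2 S12 : Type*} [NormedRing S1] [NormedRing S2]
    [NormedRing S12] [CompleteSpace S1] [CompleteSpace S2] (φ1 : S1 →+* S12) (φ2 : S2 →+* S12)
    {K1 K2 C : ℝ} (hK2 : 0 < K2) (hC : 0 < C)
    (h1 : ∀ x, ‖φ1 x‖ ≤ K1 * ‖x‖) (h2 : ∀ x, ‖φ2 x‖ ≤ K2 * ‖x‖)
    (hsplit : ∀ z, ∃ x y, φ1 x - φ2 y = z ∧ ‖x‖ ≤ C * ‖z‖ ∧ ‖y‖ ≤ C * ‖z‖) :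
    ∃ ε > 0, ∀ D : S12, ‖D‖ < ε → ∃ X Y, φ1 X - φ2 Y = D + D * φ2 Y ∧ ‖X‖ < 1 := by
  choose x y hxy hx hy using hsplit
  refine ⟨min (1 / (2 * (K2 * C))) (1 / (2 * C)), by positivity, fun D hD ↦ ?_⟩
  have hD1 : ‖D‖ * (K2 * C) ≤ 1 / 2 := by
    have := (hD.trans_le (min_le_left _ _)).le
    rw [le_div_iff₀ (by positivity)] at this
    linarith
  have hD2 : ‖D‖ * (2 * C) < 1 := by
    have := hD.trans_le (min_le_right _ _)
    rwa [lt_div_iff₀ (by positivity)] at this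
  let d : ℕ → S12 := fun k ↦ Nat.rec D (fun _ e ↦ D * φ2 (y e)) k
  have hd0 : d 0 = D := rfl
  have hds (k) : d (k + 1) = D * φ2 (y (d k)) := rfl
  have hd (k) : ‖d k‖ ≤ ‖D‖ * (1 / 2) ^ k := by
    induction k with
    | zero => simp [hd0]
    | succ k ih =>
      calc ‖d (k + 1)‖ ≤ ‖D‖ * ‖φ2 (y (d k))‖ := norm_mul_le _ _
        _ ≤ ‖D‖ * (K2 * (C * ‖d k‖)) := by
          gcongr
          exact (h2 _).trans (by gcongr; exact hy _)
        _ = ‖D‖ * (K2 * C) * ‖d k‖ := by ring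
        _ ≤ 1 / 2 * (‖D‖ * (1 / 2) ^ k) := by gcongr
        _ = _ := by ring
  have hgeo : HasSum (fun k : ℕ ↦ C * ‖D‖ * (1 / 2 : ℝ) ^ k) (C * ‖D‖ * 2) :=
    hasSum_geometric_two.mul_left _
  have hxb (k) : ‖x (d k)‖ ≤ C * ‖D‖ * (1 / 2) ^ k :=
    (hx _).trans (by rw [mul_assoc]; gcongr; exact hd k)
  have hyb (k) : ‖y (d k)‖ ≤ C * ‖D‖ * (1 / 2) ^ k :=
    (hy _).trans (by rw [mul_assoc]; gcongr; exact hd k)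
  have hX := (Summable.of_norm_bounded hgeo.summable hxb).hasSum
  have hY := (Summable.of_norm_bounded hgeo.summable hyb).hasSum
  have hX12 := hX.map φ1 (AddMonoidHomClass.continuous_of_bound φ1 K1 h1)
  have hY12 := hY.map φ2 (AddMonoidHomClass.continuous_of_bound φ2 K2 h2)
  refine ⟨∑' k, x (d k), ∑' k, y (d k), ?_, (tsum_of_norm_bounded hgeo hxb).trans_lt (by linarith)⟩
  have hsum : HasSum d (φ1 (∑' k, x (d k)) - φ2 (∑' k, y (d k))) :=
    (hX12.sub hY12).congr_fun fun k ↦ (hxy (d k)).symm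
  refine hsum.unique ?_
  rw [← hd0, add_comm, hd0]
  have := (hasSum_nat_add_iff (f := d) 1 (g := D * φ2 (∑' k, y (d k)))).1 (hY12.mul_left D)
  simpa [hd0] using this

section MatrixNorm

attribute [local instance] Matrix.linftyOpNormedRing Matrix.linftyOpNormedAddCommGroup

theorem Matrix.norm_entry_le_linftyOpNorm {m n S : Type*} [Fintype m] [Fintype n]
    [NormedRing S] (A : Matrix m n S) (i : m) (j : n) : ‖A i j‖ ≤ ‖A‖ := by
  rw [Matrix.linfty_opNorm_def, ← coe_nnnorm, NNReal.coe_le_coe]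
  exact (Finset.single_le_sum (f := fun j ↦ ‖A i j‖₊) (fun _ _ ↦ zero_le) (Finset.mem_univ j)).trans
    (Finset.le_sup (f := fun i ↦ ∑ j, ‖A i j‖₊) (Finset.mem_univ i))

theorem Matrix.linftyOpNorm_le_card_mul {m n S : Type*} [Fintype m] [Fintype n]
    [NormedRing S] (A : Matrix m n S) {r : ℝ} (hr : 0 ≤ r) (h : ∀ i j, ‖A i j‖ ≤ r) :
    ‖A‖ ≤ Fintype.card n * r := by
  lift r to NNReal using hr
  rw [Matrix.linfty_opNorm_def]
  norm_cast
  refine Finset.sup_le fun i _ ↦ ?_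
  refine (Finset.sum_le_card_nsmul _ _ r fun j _ ↦ by exact_mod_cast h i j).trans ?_
  simp [Finset.card_univ]

/-- For matrices `A`, `B` over `R12`, some approximation `B'` of `B` over `R2` makes
`1 + A * (B' - B)` a quotient of an invertible matrix over `R1` and a matrix over `R2`. -/
def HasMatrixFactorization (R1 R2 R12 : Type*) [CommRing R1] [CommRing R2] [CommRing R12]
    [Algebra R1 R12] [Algebra R2 R12] : Prop :=
  ∀ (a b : ℕ) (A : Matrix (Fin a) (Fin b) R12) (B : Matrix (Fin b) (Fin a) R12),
    ∃ (B' : Matrix (Fin b) (Fin a) R2) (C1 : Matrix (Fin a) (Fin a) R1)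
      (C2 : Matrix (Fin a) (Fin a) R2), IsUnit C1 ∧
      (1 + A * (B'.map (algebraMap R2 R12) - B)) * C2.map (algebraMap R2 R12) =
        C1.map (algebraMap R1 R12)

theorem Matrix.linftyOpNorm_map_le {a : ℕ} {S T : Type*} [NormedRing S] [NormedRing T]
    (φ : S → T) {K : ℝ} (hK : 0 < K) (h : ∀ x, ‖φ x‖ ≤ K * ‖x‖)
    (X : Matrix (Fin a) (Fin a) S) : ‖X.map φ‖ ≤ (a + 1) * K * ‖X‖ := by
  refine (Matrix.linftyOpNorm_le_card_mul _ (r := K * ‖X‖) (by positivity) fun i j ↦ ?_).trans ?_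
  · exact (h _).trans (by gcongr; exact X.norm_entry_le_linftyOpNorm i j)
  · rw [Fintype.card_fin, mul_assoc]
    gcongr
    linarith

theorem Matrix.completeSpace_linftyOp {a : ℕ} {S : Type*} [NormedRing S] [CompleteSpace S] :
    @CompleteSpace (Matrix (Fin a) (Fin a) S)
      (Matrix.linftyOpNormedRing.toMetricSpace.toUniformSpace) :=
  inferInstanceAs (CompleteSpace (Fin a → Fin a → S))

theorem hasMatrixFactorization_of_normed {R1 R2 R12 : Type*} [NormedCommRing R1]
    [NormedCommRing R2] [NormedCommRing R12] [CompleteSpace R1] [CompleteSpace R2]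
    [Algebra R1 R12] [Algebra R2 R12] {K1 K2 C : ℝ} (hK1 : 0 < K1) (hK2 : 0 < K2) (hC : 0 < C)
    (h1 : ∀ x, ‖algebraMap R1 R12 x‖ ≤ K1 * ‖x‖) (h2 : ∀ x, ‖algebraMap R2 R12 x‖ ≤ K2 * ‖x‖)
    (hsplit : ∀ z : R12, ∃ (x : R1) (y : R2), algebraMap R1 R12 x - algebraMap R2 R12 y = z ∧
      ‖x‖ ≤ C * ‖z‖ ∧ ‖y‖ ≤ C * ‖z‖)
    (hdense : ∀ (z : R12) (ε : ℝ), 0 < ε → ∃ y : R2, ‖z - algebraMap R2 R12 y‖ < ε) :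
    HasMatrixFactorization R1 R2 R12 := by
  intro a b A B
  have := Matrix.completeSpace_linftyOp (a := a) (S := R1)
  have := Matrix.completeSpace_linftyOp (a := a) (S := R2)
  have ha : (0 : ℝ) < a + 1 := by positivity
  choose x y hxy hx hy using hsplit
  obtain ⟨ε, hε, h⟩ := exists_additive_splitting
    ((algebraMap R1 R12).mapMatrix (m := Fin a)) ((algebraMap R2 R12).mapMatrix (m := Fin a))
    (mul_pos ha hK2) (mul_pos ha hC)
    (Matrix.linftyOpNorm_map_le _ hK1 h1) (Matrix.linftyOpNorm_map_le _ hK2 h2)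
    (fun Z ↦ ⟨Z.map x, Z.map y, Matrix.ext fun i j ↦ hxy _,
      Matrix.linftyOpNorm_map_le x hC hx Z, Matrix.linftyOpNorm_map_le y hC hy Z⟩)
  choose B' hB' using fun i j ↦ hdense (B i j) (ε / ((‖A‖ + 1) * (a + 1))) (by positivity)
  have hB : ‖(Matrix.of B').map (algebraMap R2 R12) - B‖ ≤
      a * (ε / ((‖A‖ + 1) * (a + 1))) := by
    refine (Matrix.linftyOpNorm_le_card_mul _ (r := ε / ((‖A‖ + 1) * (a + 1))) (by positivity)
      fun i j ↦ ?_).trans (by simp)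
    have := (hB' i j).le
    rwa [norm_sub_rev] at this
  have hD : ‖A * ((Matrix.of B').map (algebraMap R2 R12) - B)‖ < ε := by
    calc _ ≤ ‖A‖ * (a * (ε / ((‖A‖ + 1) * (a + 1)))) :=
          (Matrix.linfty_opNorm_mul _ _).trans (by gcongr)
      _ = (‖A‖ * a) * (ε / ((‖A‖ + 1) * (a + 1))) := by ring
      _ < ((‖A‖ + 1) * (a + 1)) * (ε / ((‖A‖ + 1) * (a + 1))) := by
          refine mul_lt_mul_of_pos_right ?_ (by positivity)
          nlinarith [norm_nonneg A, Nat.cast_nonneg (α := ℝ) a]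
      _ = ε := by field_simp
  obtain ⟨X, Y, hXY, hX⟩ := h _ hD
  refine ⟨Matrix.of B', 1 + X, 1 + Y, ?_, ?_⟩
  · simpa using isUnit_one_sub_of_norm_lt_one (x := -X) (by simpa using hX)
  · change _ * (algebraMap R2 R12).mapMatrix (1 + Y) = (algebraMap R1 R12).mapMatrix (1 + X)
    rw [map_add, map_add, map_one, map_one, sub_eq_iff_eq_add.1 hXY]
    simp only [add_mul, mul_add, one_mul, mul_one]
    abel

end MatrixNorm

/-- The purely algebraic properties of a glueing square. -/
structure GlueingSquare (R R1 R2 R12 : Type*) [CommRing R] [CommRing R1] [CommRing R2]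
    [CommRing R12] [Algebra R R1] [Algebra R R2] [Algebra R1 R12] [Algebra R2 R12] : Prop where
  comm (r : R) : algebraMap R1 R12 (algebraMap R R1 r) = algebraMap R2 R12 (algebraMap R R2 r)
  eq_zero (r : R) : algebraMap R R1 r = 0 → algebraMap R R2 r = 0 → r = 0
  exists_lift (x : R1) (y : R2) : algebraMap R1 R12 x = algebraMap R2 R12 y →
    ∃ r, algebraMap R R1 r = x ∧ algebraMap R R2 r = y
  exists_sub (z : R12) : ∃ (x : R1) (y : R2), algebraMap R1 R12 x - algebraMap R2 R12 y = z
  factorization : HasMatrixFactorization R1 R2 R12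

theorem map_linearCombination {A B M N ι : Type*} [CommRing A] [CommRing B] [Algebra A B]
    [AddCommGroup M] [Module A M] [AddCommGroup N] [Module B N] [Fintype ι]
    (f : M →ₛₗ[algebraMap A B] N) (v : ι → M) (c : ι → A) :
    f (Fintype.linearCombination A v c) =
      Fintype.linearCombination B (f ∘ v) (algebraMap A B ∘ c) := by
  simp [Fintype.linearCombination_apply]

theorem span_comp_eq_top {A B M N ι : Type*} [CommRing A] [CommRing B] [Algebra A B]
    [AddCommGroup M] [Module A M] [AddCommGroup N] [Module B N] [Fintype ι]
    (f : M →ₛₗ[algebraMap A B] N) (hf : Submodule.span B (Set.range f) = ⊤) {v : ι → M}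
    (hv : Submodule.span A (Set.range v) = ⊤) :
    Submodule.span B (Set.range (f ∘ v)) = ⊤ := by
  rw [eq_top_iff, ← hf, Submodule.span_le]
  rintro _ ⟨m, rfl⟩
  obtain ⟨c, rfl⟩ := (Fintype.range_linearCombination A v ▸ hv ▸ Submodule.mem_top :
    m ∈ LinearMap.range (Fintype.linearCombination A v))
  rw [map_linearCombination, ← Fintype.range_linearCombination]
  exact ⟨_, rfl⟩

theorem exists_linearCombination_eq {A M ι : Type*} [CommRing A]
    [AddCommGroup M] [Module A M] [Fintype ι] {v : ι → M}
    (hv : Submodule.span A (Set.range v) = ⊤) (m : M) :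
    ∃ c, Fintype.linearCombination A v c = m := by
  rw [← LinearMap.mem_range, Fintype.range_linearCombination, hv]
  trivial

section Glueing

variable {R R1 R2 R12 : Type*} [CommRing R] [CommRing R1] [CommRing R2] [CommRing R12]
  [Algebra R R1] [Algebra R R2] [Algebra R1 R12] [Algebra R2 R12]
  {M1 M2 M12 : Type*} [AddCommGroup M1] [Module R1 M1] [AddCommGroup M2] [Module R2 M2]
  [AddCommGroup M12] [Module R12 M12]
  {f1 : M1 →ₛₗ[algebraMap R1 R12] M12} {f2 : M2 →ₛₗ[algebraMap R2 R12] M12}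

/-- Finite glueing data have enough compatible pairs to generate the first module. -/
theorem HasMatrixFactorization.exists_generators_left (h : HasMatrixFactorization R1 R2 R12)
    [Module.Finite R1 M1] [Module.Finite R2 M2]
    (hf1 : Submodule.span R12 (Set.range f1) = ⊤) (hf2 : Submodule.span R12 (Set.range f2) = ⊤) :
    ∃ (n : ℕ) (x : Fin n → M1) (y : Fin n → M2), (∀ i, f1 (x i) = f2 (y i)) ∧
      Submodule.span R1 (Set.range x) = ⊤ := by
  obtain ⟨a, v, hv⟩ := Module.Finite.exists_fin (R := R1) (M := M1)
  obtain ⟨b, w, hw⟩ := Module.Finite.exists_fin (R := R2) (M := M2)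
  choose A hA using fun j ↦ exists_linearCombination_eq (span_comp_eq_top f1 hf1 hv) (f2 (w j))
  choose B hB using fun i ↦ exists_linearCombination_eq (span_comp_eq_top f2 hf2 hw) (f1 (v i))
  set L1 := Fintype.linearCombination R12 (f1 ∘ v) with hL1
  set L2 := Fintype.linearCombination R12 (f2 ∘ w) with hL2
  let A' : Matrix (Fin a) (Fin b) R12 := (Matrix.of A).transpose
  let B₀ : Matrix (Fin b) (Fin a) R12 := (Matrix.of B).transpose
  have hA' : L1 ∘ₗ A'.mulVecLin = L2 := by
    refine LinearMap.pi_ext' fun j ↦ LinearMap.ext_ring ?_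
    simpa [A', hL2, Fintype.linearCombination_apply_single] using hA j
  have hB₀ : L2 ∘ₗ B₀.mulVecLin = L1 := by
    refine LinearMap.pi_ext' fun j ↦ LinearMap.ext_ring ?_
    simpa [B₀, hL1, Fintype.linearCombination_apply_single] using hB j
  obtain ⟨B', C1, C2, ⟨U, rfl⟩, hC⟩ := h a b A' B₀
  refine ⟨a, fun j ↦ Fintype.linearCombination R1 v (U.1.col j),
    fun j ↦ Fintype.linearCombination R2 w (B'.mulVec (C2.col j)), fun j ↦ ?_, ?_⟩
  · rw [map_linearCombination, map_linearCombination]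
    have e1 : algebraMap R1 R12 ∘ U.1.col j = (U.1.map (algebraMap R1 R12)).col j := rfl
    have e2 : algebraMap R2 R12 ∘ B'.mulVec (C2.col j) =
        (B'.map (algebraMap R2 R12)).mulVec ((C2.map (algebraMap R2 R12)).col j) := by
      ext i
      simp [Matrix.mulVec, dotProduct]
    have e3 (z) : L1 (A'.mulVec z) = L2 z := LinearMap.congr_fun hA' z
    have e4 (z) : L2 (B₀.mulVec z) = L1 z := LinearMap.congr_fun hB₀ z
    have e5 : (U.1.map (algebraMap R1 R12)).col j =
        (1 + A' * (B'.map (algebraMap R2 R12) - B₀)).mulVec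
          ((C2.map (algebraMap R2 R12)).col j) := by
      rw [← hC]
      rfl
    rw [e1, e2, e5, ← hL1, ← hL2, Matrix.add_mulVec, Matrix.one_mulVec, map_add,
      ← Matrix.mulVec_mulVec, e3, Matrix.sub_mulVec, map_sub, e4, add_sub_cancel]
  · rw [eq_top_iff]
    rintro m -
    obtain ⟨c, rfl⟩ := exists_linearCombination_eq hv m
    rw [← Fintype.range_linearCombination]
    refine ⟨U⁻¹.1.mulVec c, ?_⟩
    have : Fintype.linearCombination R1 (fun j ↦ Fintype.linearCombination R1 v (U.1.col j)) =
        Fintype.linearCombination R1 v ∘ₗ U.1.mulVecLin := by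
      refine LinearMap.pi_ext' fun j ↦ LinearMap.ext_ring ?_
      simp [Fintype.linearCombination_apply_single]
    rw [this, LinearMap.comp_apply, Matrix.mulVecLin_apply, Matrix.mulVec_mulVec]
    simp

theorem GlueingSquare.exists_sub_eq (h : GlueingSquare R R1 R2 R12) {ι : Type*} [Fintype ι]
    (hf1 : Submodule.span R12 (Set.range f1) = ⊤) {x : ι → M1} {y : ι → M2}
    (hxy : ∀ i, f1 (x i) = f2 (y i)) (hx : Submodule.span R1 (Set.range x) = ⊤) (z : M12) :
    ∃ m1, ∃ m2 ∈ Submodule.span R2 (Set.range y), f1 m1 - f2 m2 = z := by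
  obtain ⟨c, rfl⟩ := exists_linearCombination_eq (span_comp_eq_top f1 hf1 hx) z
  choose a b hab using h.exists_sub
  refine ⟨Fintype.linearCombination R1 x (a ∘ c), Fintype.linearCombination R2 y (b ∘ c), ?_, ?_⟩
  · rw [← Fintype.range_linearCombination]
    exact ⟨_, rfl⟩
  · rw [map_linearCombination, map_linearCombination]
    simp only [Fintype.linearCombination_apply, ← Finset.sum_sub_distrib, Function.comp, ← hxy,
      ← sub_smul, hab]

theorem GlueingSquare.exists_generators (h : GlueingSquare R R1 R2 R12)
    [Module.Finite R1 M1] [Module.Finite R2 M2]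
    (hf1 : Submodule.span R12 (Set.range f1) = ⊤) (hf2 : Submodule.span R12 (Set.range f2) = ⊤) :
    ∃ (ι : Type) (_ : Fintype ι) (x : ι → M1) (y : ι → M2), (∀ i, f1 (x i) = f2 (y i)) ∧
      Submodule.span R1 (Set.range x) = ⊤ ∧ Submodule.span R2 (Set.range y) = ⊤ := by
  obtain ⟨a, x, y, hxy, hx⟩ := h.factorization.exists_generators_left hf1 hf2
  obtain ⟨b, w, hw⟩ := Module.Finite.exists_fin (R := R2) (M := M2)
  choose m1 m2 hm2 hm using h.exists_sub_eq (f2 := f2) hf1 hxy hx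
  refine ⟨Fin a ⊕ Fin b, inferInstance, Sum.elim x fun j ↦ m1 (f2 (w j)),
    Sum.elim y fun j ↦ w j + m2 (f2 (w j)), ?_, ?_, ?_⟩
  · rintro (i | j)
    · exact hxy i
    · simpa using sub_eq_iff_eq_add.1 (hm (f2 (w j)))
  · rw [Set.Sum.elim_range, Submodule.span_union, hx, top_sup_eq]
  · rw [eq_top_iff, ← hw, Submodule.span_le]
    rintro _ ⟨j, rfl⟩
    rw [← add_sub_cancel_right (w j) (m2 (f2 (w j)))]
    refine Submodule.sub_mem _ (Submodule.subset_span ⟨Sum.inr j, rfl⟩) ?_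
    refine Submodule.span_mono ?_ (hm2 (f2 (w j)))
    rintro _ ⟨i, rfl⟩
    exact ⟨Sum.inl i, rfl⟩

end Glueing

/-- A semilinear map `f : M → N` has the base change property for finite projective modules
when it exhibits generators and every functional on `M` extends along `f`. -/
structure IsProjectiveBaseChange {A B M N : Type*} [CommRing A] [CommRing B] [Algebra A B]
    [AddCommGroup M] [Module A M] [AddCommGroup N] [Module B N]
    (f : M →ₛₗ[algebraMap A B] N) : Prop where
  span_eq_top : Submodule.span B (Set.range f) = ⊤
  exists_extension (h : M →ₗ[A] A) : ∃ h' : N →ₗ[B] B, ∀ m, h' (f m) = algebraMap A B (h m)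

namespace IsProjectiveBaseChange

variable {A B M N : Type*} [CommRing A] [CommRing B] [Algebra A B]
  [AddCommGroup M] [Module A M] [AddCommGroup N] [Module B N] {f : M →ₛₗ[algebraMap A B] N}

theorem exists_pi_extension (hf : IsProjectiveBaseChange f) {ι : Type*} (h : M →ₗ[A] (ι → A)) :
    ∃ h' : N →ₗ[B] (ι → B), ∀ m, h' (f m) = algebraMap A B ∘ h m := by
  choose g hg using fun i ↦ hf.exists_extension (LinearMap.proj i ∘ₗ h)
  exact ⟨LinearMap.pi g, fun m ↦ funext fun i ↦ hg i m⟩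

theorem exists_functional_extension {ι : Type*} [Fintype ι] (h : (ι → A) →ₗ[A] A) :
    ∃ h' : (ι → B) →ₗ[B] B, ∀ c, h' (algebraMap A B ∘ c) = algebraMap A B (h c) := by
  classical
  refine ⟨Fintype.linearCombination B fun i ↦ algebraMap A B (h (Pi.single i 1)), fun c ↦ ?_⟩
  have hsingle (i : ι) : (fun j ↦ if i = j then (1 : A) else 0) = Pi.single i 1 :=
    funext fun j ↦ by simp [Pi.single_apply, eq_comm]
  conv_rhs => rw [LinearMap.pi_apply_eq_sum_univ h c]
  simp [Fintype.linearCombination_apply, hsingle]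

/-- The kernels of the presentations of `M` and `N` attached to generators of `M`. -/
theorem exists_ker (hf : IsProjectiveBaseChange f) [Module.Projective A M] {ι : Type*} [Fintype ι]
    {x : ι → M} {z : ι → N} (hz : ∀ i, f (x i) = z i)
    (hx : Submodule.span A (Set.range x) = ⊤) :
    Module.Finite A (LinearMap.ker (Fintype.linearCombination A x)) ∧
    Module.Projective A (LinearMap.ker (Fintype.linearCombination A x)) ∧
    ∃ g : LinearMap.ker (Fintype.linearCombination A x) →ₛₗ[algebraMap A B]
        LinearMap.ker (Fintype.linearCombination B z),
      (∀ c, (g c).1 = algebraMap A B ∘ c.1) ∧ IsProjectiveBaseChange g := by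
  classical
  obtain rfl : f ∘ x = z := funext hz
  set p := Fintype.linearCombination A x with hp
  set q := Fintype.linearCombination B (f ∘ x) with hq
  have hpsurj : Function.Surjective p := fun m ↦ exists_linearCombination_eq hx m
  obtain ⟨s, hs⟩ := Module.projective_lifting_property p LinearMap.id hpsurj
  have hs' (m) : p (s m) = m := LinearMap.congr_fun hs m
  let e : (ι → A) →ₗ[A] LinearMap.ker p :=
    (LinearMap.id - s ∘ₗ p).codRestrict _ fun c ↦ by simp [hs']
  have he (c : LinearMap.ker p) : e c = c := by
    ext1
    simp [e, LinearMap.mem_ker.1 c.2]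
  have he' : e ∘ₗ (LinearMap.ker p).subtype = LinearMap.id := LinearMap.ext he
  have hpq (c) : q (algebraMap A B ∘ c) = f (p c) := (map_linearCombination f x c).symm
  let g : LinearMap.ker p →ₛₗ[algebraMap A B] LinearMap.ker q :=
    { toFun := fun c ↦ ⟨algebraMap A B ∘ c.1, by
        rw [LinearMap.mem_ker, hpq, LinearMap.mem_ker.1 c.2, map_zero]⟩
      map_add' := fun c d ↦ by ext; simp
      map_smul' := fun a c ↦ by ext; simp [Algebra.smul_def] }
  have hesurj : Function.Surjective e := fun c ↦ ⟨c, he c⟩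
  refine ⟨Module.Finite.of_surjective e hesurj,
    Module.Projective.of_split _ e he', g, fun _ ↦ rfl, ?_, fun h ↦ ?_⟩
  · obtain ⟨t, ht⟩ := hf.exists_pi_extension s
    rw [eq_top_iff]
    rintro d -
    let E : (ι → B) →ₗ[B] LinearMap.ker q :=
      Fintype.linearCombination B fun i ↦ g (e (Pi.single i 1))
    have hE : (LinearMap.ker q).subtype ∘ₗ E = LinearMap.id - t ∘ₗ q := by
      refine LinearMap.pi_ext' fun i ↦ LinearMap.ext_ring ?_
      ext j
      simp [E, Fintype.linearCombination_apply_single, g, e, hq, hp, ht, Pi.single_apply,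
        apply_ite]
    have hd : E d = d := by
      ext1
      have := LinearMap.congr_fun hE d
      simpa [LinearMap.mem_ker.1 d.2] using this
    rw [← hd]
    refine Submodule.span_mono ?_
      ((Fintype.range_linearCombination B fun i ↦ g (e (Pi.single i 1))) ▸ ⟨d, rfl⟩ :
        E d ∈ Submodule.span B (Set.range fun i ↦ g (e (Pi.single i 1))))
    rintro _ ⟨i, rfl⟩
    exact ⟨_, rfl⟩
  · obtain ⟨h', hh'⟩ := exists_functional_extension (B := B) (h ∘ₗ e)
    refine ⟨h' ∘ₗ (LinearMap.ker q).subtype, fun c ↦ (hh' c).trans ?_⟩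
    rw [LinearMap.comp_apply, he]

end IsProjectiveBaseChange

section Glueing

variable {R R1 R2 R12 : Type*} [CommRing R] [CommRing R1] [CommRing R2] [CommRing R12]
  [Algebra R R1] [Algebra R R2] [Algebra R1 R12] [Algebra R2 R12]
  {M1 M2 M12 : Type*} [AddCommGroup M1] [Module R1 M1] [AddCommGroup M2] [Module R2 M2]
  [AddCommGroup M12] [Module R12 M12]
  {f1 : M1 →ₛₗ[algebraMap R1 R12] M12} {f2 : M2 →ₛₗ[algebraMap R2 R12] M12}

/-- Compatible pairs `(x i, y i)` generating both modules of a glueing datum as well as the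
module of all compatible pairs. -/
structure IsGlueingGenerators (R : Type*) [CommRing R] [Algebra R R1] [Algebra R R2]
    (f1 : M1 →ₛₗ[algebraMap R1 R12] M12) (f2 : M2 →ₛₗ[algebraMap R2 R12] M12)
    {ι : Type} [Fintype ι] (x : ι → M1) (y : ι → M2) : Prop where
  compatible (i : ι) : f1 (x i) = f2 (y i)
  span_left : Submodule.span R1 (Set.range x) = ⊤
  span_right : Submodule.span R2 (Set.range y) = ⊤
  exists_coeff {m1 : M1} {m2 : M2} : f1 m1 = f2 m2 → ∃ r : ι → R,
    Fintype.linearCombination R1 x (algebraMap R R1 ∘ r) = m1 ∧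
    Fintype.linearCombination R2 y (algebraMap R R2 ∘ r) = m2

theorem GlueingSquare.exists_isGlueingGenerators_ker (h : GlueingSquare R R1 R2 R12)
    [Module.Finite R1 M1] [Module.Finite R2 M2] [Module.Projective R1 M1] [Module.Projective R2 M2]
    (hf1 : IsProjectiveBaseChange f1) (hf2 : IsProjectiveBaseChange f2) :
    ∃ (ι : Type) (_ : Fintype ι) (x : ι → M1) (y : ι → M2), IsGlueingGenerators R f1 f2 x y := by
  obtain ⟨ι, _, x, y, hxy, hx, hy⟩ := h.exists_generators hf1.span_eq_top hf2.span_eq_top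
  obtain ⟨_, _, g1, hg1, hb1⟩ := hf1.exists_ker hxy hx
  obtain ⟨_, _, g2, hg2, hb2⟩ := hf2.exists_ker (fun _ ↦ rfl) hy
  refine ⟨ι, inferInstance, x, y, hxy, hx, hy, fun {m1 m2} hm ↦ ?_⟩
  obtain ⟨κ, _, u, v, huv, hu, hv⟩ := h.exists_generators hb1.span_eq_top hb2.span_eq_top
  obtain ⟨c, rfl⟩ := exists_linearCombination_eq hx m1
  obtain ⟨d, rfl⟩ := exists_linearCombination_eq hy m2
  have hcomp : f1 ∘ x = f2 ∘ y := funext hxy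
  have hker : algebraMap R1 R12 ∘ c - algebraMap R2 R12 ∘ d ∈
      LinearMap.ker (Fintype.linearCombination R12 (fun i ↦ f2 (y i))) := by
    rw [LinearMap.mem_ker, map_sub, sub_eq_zero]
    rw [map_linearCombination, map_linearCombination, hcomp] at hm
    exact hm
  obtain ⟨n1, n2, -, hn⟩ := h.exists_sub_eq hb1.span_eq_top huv hu ⟨_, hker⟩
  have hn' := congrArg Subtype.val hn
  rw [Submodule.coe_sub, hg1, hg2] at hn'
  choose r hr1 hr2 using fun i ↦ h.exists_lift (c i - n1.1 i) (d i - n2.1 i) (by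
    have := congrFun hn' i
    simp only [Pi.sub_apply, Function.comp_apply] at this
    rw [map_sub, map_sub, sub_eq_sub_iff_sub_eq_sub, this])
  refine ⟨r, ?_, ?_⟩
  · have : algebraMap R R1 ∘ r = c - n1.1 := funext hr1
    rw [this, map_sub, LinearMap.mem_ker.1 n1.2, sub_zero]
  · have : algebraMap R R2 ∘ r = d - n2.1 := funext hr2
    rw [this, map_sub, LinearMap.mem_ker.1 n2.2, sub_zero]

/-- Glueing generators together with glueing generators of the relations among them. -/
theorem GlueingSquare.exists_presentation (h : GlueingSquare R R1 R2 R12)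
    [Module.Finite R1 M1] [Module.Finite R2 M2] [Module.Projective R1 M1] [Module.Projective R2 M2]
    (hf1 : IsProjectiveBaseChange f1) (hf2 : IsProjectiveBaseChange f2) :
    ∃ (ι : Type) (_ : Fintype ι) (x : ι → M1) (y : ι → M2) (κ : Type) (_ : Fintype κ)
      (t : κ → ι → R), IsGlueingGenerators R f1 f2 x y ∧
      (∀ k, Fintype.linearCombination R1 x (algebraMap R R1 ∘ t k) = 0) ∧
      (∀ k, Fintype.linearCombination R2 y (algebraMap R R2 ∘ t k) = 0) ∧
      (∀ c, Fintype.linearCombination R1 x c = 0 →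
        c ∈ Submodule.span R1 (Set.range fun k ↦ algebraMap R R1 ∘ t k)) ∧
      (∀ c, Fintype.linearCombination R2 y c = 0 →
        c ∈ Submodule.span R2 (Set.range fun k ↦ algebraMap R R2 ∘ t k)) ∧
      ∀ r : ι → R, Fintype.linearCombination R1 x (algebraMap R R1 ∘ r) = 0 →
        Fintype.linearCombination R2 y (algebraMap R R2 ∘ r) = 0 →
        r ∈ Submodule.span R (Set.range t) := by
  obtain ⟨ι, _, x, y, hxy⟩ := h.exists_isGlueingGenerators_ker hf1 hf2
  obtain ⟨_, _, g1, hg1, hb1⟩ := hf1.exists_ker hxy.compatible hxy.span_left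
  obtain ⟨_, _, g2, hg2, hb2⟩ := hf2.exists_ker (fun _ ↦ rfl) hxy.span_right
  obtain ⟨κ, _, u, v, huv⟩ := h.exists_isGlueingGenerators_ker hb1 hb2
  choose t ht1 ht2 using fun k i ↦ h.exists_lift ((u k).1 i) ((v k).1 i) (by
    have := congrFun (congrArg Subtype.val (huv.compatible k)) i
    rwa [hg1, hg2] at this)
  have hu (k) : algebraMap R R1 ∘ t k = (u k).1 := funext (ht1 k)
  have hv (k) : algebraMap R R2 ∘ t k = (v k).1 := funext (ht2 k)
  refine ⟨ι, inferInstance, x, y, κ, inferInstance, t, hxy, fun k ↦ hu k ▸ (u k).2,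
    fun k ↦ hv k ▸ (v k).2, fun c hc ↦ ?_, fun c hc ↦ ?_, fun r hr1 hr2 ↦ ?_⟩
  · obtain ⟨a, ha⟩ := exists_linearCombination_eq huv.span_left ⟨c, hc⟩
    rw [← Fintype.range_linearCombination]
    refine ⟨a, ?_⟩
    simpa [Fintype.linearCombination_apply, hu] using congrArg Subtype.val ha
  · obtain ⟨a, ha⟩ := exists_linearCombination_eq huv.span_right ⟨c, hc⟩
    rw [← Fintype.range_linearCombination]
    refine ⟨a, ?_⟩
    simpa [Fintype.linearCombination_apply, hv] using congrArg Subtype.val ha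
  · obtain ⟨s, hs1, hs2⟩ := huv.exists_coeff (m1 := ⟨_, hr1⟩) (m2 := ⟨_, hr2⟩) (by
      ext i
      rw [hg1, hg2]
      exact h.comm (r i))
    rw [← Fintype.range_linearCombination]
    refine ⟨s, funext fun i ↦ sub_eq_zero.1 (h.eq_zero _ ?_ ?_)⟩
    · rw [map_sub, sub_eq_zero]
      simpa [Fintype.linearCombination_apply, ← hu, Algebra.smul_def] using
        congrFun (congrArg Subtype.val hs1) i
    · rw [map_sub, sub_eq_zero]
      simpa [Fintype.linearCombination_apply, ← hv, Algebra.smul_def] using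
        congrFun (congrArg Subtype.val hs2) i

end Glueing

/-- A base change map is bijective when it sends generators to generators and the relations
in the target are spanned by relations in the source. -/
theorem bijective_liftBaseChange {R A K M ι κ : Type*} [CommRing R] [CommRing A] [Algebra R A]
    [AddCommGroup K] [Module R K] [AddCommGroup M] [Module A M] [Module R M] [IsScalarTower R A M]
    [Fintype ι] (l : K →ₗ[R] M) {e : ι → K} (he : Submodule.span R (Set.range e) = ⊤)
    {t : κ → ι → R} (ht : ∀ k, Fintype.linearCombination R e (t k) = 0)
    (hl : Submodule.span A (Set.range (l ∘ e)) = ⊤)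
    (hker : ∀ c, Fintype.linearCombination A (l ∘ e) c = 0 →
      c ∈ Submodule.span A (Set.range fun k ↦ algebraMap R A ∘ t k)) :
    Function.Bijective (LinearMap.liftBaseChange A l) := by
  set q : (ι → A) →ₗ[A] A ⊗[R] K := Fintype.linearCombination A fun i ↦ (1 : A) ⊗ₜ[R] e i with hq
  have hlq (c) : l.liftBaseChange A (q c) = Fintype.linearCombination A (l ∘ e) c := by
    simp [hq, Fintype.linearCombination_apply]
  refine ⟨(injective_iff_map_eq_zero _).2 fun z hz ↦ ?_, fun m ↦ ?_⟩
  · obtain ⟨c, rfl⟩ : ∃ c, q c = z := by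
      clear hz
      induction z with
      | zero => exact ⟨0, map_zero q⟩
      | tmul a k =>
        obtain ⟨r, rfl⟩ := exists_linearCombination_eq he k
        refine ⟨a • (algebraMap R A ∘ r), ?_⟩
        simp [hq, Fintype.linearCombination_apply, TensorProduct.tmul_sum,
          TensorProduct.smul_tmul', Algebra.smul_def, mul_comm]
      | add z w hz hw =>
        obtain ⟨c, rfl⟩ := hz
        obtain ⟨d, rfl⟩ := hw
        exact ⟨c + d, map_add q c d⟩
    rw [hlq] at hz
    have hle : Submodule.span A (Set.range fun k ↦ algebraMap R A ∘ t k) ≤ LinearMap.ker q := by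
      rw [Submodule.span_le]
      rintro _ ⟨k, rfl⟩
      have := congrArg (fun k ↦ (1 : A) ⊗ₜ[R] k) (ht k)
      simpa [hq, Fintype.linearCombination_apply, TensorProduct.tmul_sum,
          TensorProduct.smul_tmul', Algebra.smul_def, mul_comm] using this
    exact hle (hker c hz)
  · obtain ⟨c, rfl⟩ := exists_linearCombination_eq hl m
    exact ⟨q c, hlq c⟩

namespace NABanachNorm

variable {A : Type*} [CommRing A] (ν : NABanachNorm A)

theorem nrm_neg_le (x : A) : ν.nrm (-x) ≤ ν.nrm (-1) * ν.nrm x := by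
  simpa using ν.submul (-1) x

/-- The symmetrization `max ‖x‖ ‖-x‖` as a ring norm. -/
def toRingNorm : RingNorm A where
  toFun x := max (ν.nrm x) (ν.nrm (-x))
  map_zero' := by simp [(ν.eq_zero_iff 0).2 rfl]
  add_le' x y := by
    refine max_le ?_ ?_
    · refine (ν.nonarch x y).trans (max_le ?_ ?_)
      · linarith [le_max_left (ν.nrm x) (ν.nrm (-x)), le_max_left (ν.nrm y) (ν.nrm (-y)),
          ν.nonneg y]
      · linarith [le_max_left (ν.nrm x) (ν.nrm (-x)), le_max_left (ν.nrm y) (ν.nrm (-y)),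
          ν.nonneg x]
    · rw [neg_add]
      refine (ν.nonarch (-x) (-y)).trans (max_le ?_ ?_)
      · linarith [le_max_right (ν.nrm x) (ν.nrm (-x)), le_max_right (ν.nrm y) (ν.nrm (-y)),
          ν.nonneg (-y)]
      · linarith [le_max_right (ν.nrm x) (ν.nrm (-x)), le_max_right (ν.nrm y) (ν.nrm (-y)),
          ν.nonneg (-x)]
  neg' x := by rw [neg_neg, max_comm]
  mul_le' x y := by
    refine max_le ((ν.submul x y).trans ?_) ?_
    · exact mul_le_mul (le_max_left _ _) (le_max_left _ _) (ν.nonneg _)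
        ((ν.nonneg _).trans (le_max_left _ _))
    · rw [← neg_mul]
      exact (ν.submul (-x) y).trans (mul_le_mul (le_max_right _ _) (le_max_left _ _) (ν.nonneg _)
        ((ν.nonneg _).trans (le_max_left _ _)))
  eq_zero_of_map_eq_zero' x hx :=
    (ν.eq_zero_iff x).1 (((le_max_left _ _).trans hx.le).antisymm (ν.nonneg x))

/-- The normed ring structure given by the symmetrization `max ‖x‖ ‖-x‖`. -/
abbrev toNormedCommRing : NormedCommRing A :=
  { ν.toRingNorm.toNormedRing with mul_comm := mul_comm }

theorem nrm_le_norm (x : A) : ν.nrm x ≤ ν.toNormedCommRing.norm x := le_max_left _ _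

theorem norm_le (x : A) : ν.toNormedCommRing.norm x ≤ (1 + ν.nrm (-1)) * ν.nrm x := by
  refine max_le ?_ ((ν.nrm_neg_le x).trans ?_)
  · nlinarith [ν.nonneg x, ν.nonneg (-1)]
  · nlinarith [ν.nonneg x]

theorem one_add_pos : 0 < 1 + ν.nrm (-1) := by linarith [ν.nonneg (-1)]

theorem completeSpace :
    @CompleteSpace A ν.toNormedCommRing.toMetricSpace.toUniformSpace := by
  let := ν.toNormedCommRing
  refine Metric.complete_of_cauchySeq_tendsto fun u hu ↦ ?_
  rw [Metric.cauchySeq_iff] at hu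
  obtain ⟨x, hx⟩ := ν.complete u fun ε hε ↦ by
    obtain ⟨N, hN⟩ := hu ε hε
    exact ⟨N, fun m hm n hn ↦ (ν.nrm_le_norm _).trans_lt (dist_eq_norm (u m) (u n) ▸ hN m hm n hn)⟩
  refine ⟨x, Metric.tendsto_atTop.2 fun ε hε ↦ ?_⟩
  obtain ⟨N, hN⟩ := hx (ε / (1 + ν.nrm (-1))) (div_pos hε ν.one_add_pos)
  refine ⟨N, fun n hn ↦ ?_⟩
  rw [dist_eq_norm]
  refine (ν.norm_le _).trans_lt ?_
  have := hN n hn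
  rwa [lt_div_iff₀' ν.one_add_pos] at this

theorem norm_map_le {B : Type*} [CommRing B] {νA : NABanachNorm A} {νB : NABanachNorm B}
    {f : A → B} {K : ℝ} (hK : 0 < K) {x : A} (h : νB.nrm (f x) ≤ K * νA.nrm x) :
    νB.toNormedCommRing.norm (f x) ≤
      (1 + νB.nrm (-1)) * K * νA.toNormedCommRing.norm x := by
  refine (νB.norm_le _).trans ?_
  rw [mul_assoc]
  refine mul_le_mul_of_nonneg_left (h.trans ?_) νB.one_add_pos.le
  exact mul_le_mul_of_nonneg_left (νA.nrm_le_norm x) hK.le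

theorem hasMatrixFactorization {R1 R2 R12 : Type*} [CommRing R1] [CommRing R2] [CommRing R12]
    [Algebra R1 R12] [Algebra R2 R12] (ν1 : NABanachNorm R1) (ν2 : NABanachNorm R2)
    (ν12 : NABanachNorm R12) (h1 : IsBoundedHom ν1 ν12 (algebraMap R1 R12))
    (h2 : IsBoundedHom ν2 ν12 (algebraMap R2 R12))
    (hstrict : ∃ C : ℝ, 0 < C ∧ ∀ z : R12, ∃ (x : R1) (y : R2),
      algebraMap R1 R12 x - algebraMap R2 R12 y = z ∧
      ν1.nrm x ≤ C * ν12.nrm z ∧ ν2.nrm y ≤ C * ν12.nrm z)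
    (hdense : ∀ (z : R12) (ε : ℝ), 0 < ε →
      ∃ y : R2, ν12.nrm (z - algebraMap R2 R12 y) < ε) :
    HasMatrixFactorization R1 R2 R12 := by
  obtain ⟨K1, hK1, h1⟩ := h1
  obtain ⟨K2, hK2, h2⟩ := h2
  obtain ⟨C, hC, hstrict⟩ := hstrict
  choose x y hxy hx hy using hstrict
  have p1 := ν1.one_add_pos
  have p2 := ν2.one_add_pos
  have p12 := ν12.one_add_pos
  let := ν1.toNormedCommRing
  let := ν2.toNormedCommRing
  let := ν12.toNormedCommRing
  have := ν1.completeSpace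
  have := ν2.completeSpace
  refine hasMatrixFactorization_of_normed (mul_pos p12 hK1) (mul_pos p12 hK2)
    (mul_pos (add_pos p1 p2) hC)
    (fun x ↦ norm_map_le hK1 (h1 x)) (fun x ↦ norm_map_le hK2 (h2 x)) (fun z ↦ ?_) fun z ε hε ↦ ?_
  · refine ⟨x z, y z, hxy z, (norm_map_le hC (hx z)).trans ?_, (norm_map_le hC (hy z)).trans ?_⟩
    · exact mul_le_mul_of_nonneg_right
        (mul_le_mul_of_nonneg_right (le_add_of_nonneg_right p2.le) hC.le) (norm_nonneg z)
    · exact mul_le_mul_of_nonneg_right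
        (mul_le_mul_of_nonneg_right (le_add_of_nonneg_left p1.le) hC.le) (norm_nonneg z)
  · obtain ⟨y, hy⟩ := hdense z (ε / (1 + ν12.nrm (-1))) (div_pos hε p12)
    refine ⟨y, (ν12.norm_le _).trans_lt ?_⟩
    rwa [lt_div_iff₀' p12] at hy

end NABanachNorm

theorem isProjectiveBaseChange_of_equiv {A B M N : Type*} [CommRing A] [CommRing B] [Algebra A B]
    [AddCommGroup M] [Module A M] [AddCommGroup N] [Module B N] (ψ : (B ⊗[A] M) ≃ₗ[B] N)
    (f : M →ₛₗ[algebraMap A B] N) (hf : ∀ m, f m = ψ (1 ⊗ₜ m)) : IsProjectiveBaseChange f where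
  span_eq_top := by
    rw [eq_top_iff]
    rintro n -
    obtain ⟨z, rfl⟩ := ψ.surjective n
    induction z with
    | zero => rw [map_zero]; exact zero_mem _
    | tmul b m =>
      have : ψ (b ⊗ₜ m) = b • f m := by rw [hf, ← map_smul, TensorProduct.smul_tmul', smul_eq_mul,
        mul_one]
      rw [this]
      exact Submodule.smul_mem _ _ (Submodule.subset_span ⟨m, rfl⟩)
    | add z w hz hw => rw [map_add]; exact add_mem hz hw
  exists_extension h :=
    ⟨LinearMap.liftBaseChange B (Algebra.linearMap A B ∘ₗ h) ∘ₗ ψ.symm.toLinearMap,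
      fun m ↦ by simp [hf]⟩

/-- The semilinear map `m ↦ ψ (1 ⊗ m)`. -/
def LinearEquiv.tensorUnitMap {A B M N : Type*} [CommRing A] [CommRing B] [Algebra A B]
    [AddCommGroup M] [Module A M] [AddCommGroup N] [Module B N] (ψ : (B ⊗[A] M) ≃ₗ[B] N) :
    M →ₛₗ[algebraMap A B] N where
  toFun m := ψ (1 ⊗ₜ m)
  map_add' m m' := by rw [TensorProduct.tmul_add, map_add]
  map_smul' a m := by
    rw [← map_smul, TensorProduct.smul_tmul', ← TensorProduct.smul_tmul, Algebra.smul_def,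
      smul_eq_mul]

/-- For a glueing square of nonarchimedean Banach rings (exact, with
strict surjection `R1 ⊕ R2 → R12` and dense image of `R2` in `R12`), any finite projective
glueing datum glues: the kernel module `M` is finitely presented over `R`, and the natural
base-change maps `M ⊗_R R1 → M1` and `M ⊗_R R2 → M2` are bijective. -/
theorem finite_projective_glueing
    (R R1 R2 R12 : Type*) [CommRing R] [CommRing R1] [CommRing R2] [CommRing R12]
    [Algebra R R1] [Algebra R R2] [Algebra R R12]
    [Algebra R1 R12] [Algebra R2 R12]
    [IsScalarTower R R1 R12] [IsScalarTower R R2 R12]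
    (ν : NABanachNorm R) (ν1 : NABanachNorm R1) (ν2 : NABanachNorm R2)
    (ν12 : NABanachNorm R12)
    (hb1 : IsBoundedHom ν ν1 (algebraMap R R1))
    (hb2 : IsBoundedHom ν ν2 (algebraMap R R2))
    (hb112 : IsBoundedHom ν1 ν12 (algebraMap R1 R12))
    (hb212 : IsBoundedHom ν2 ν12 (algebraMap R2 R12))
    -- (i) exactness of 0 → R → R1 ⊕ R2 → R12 → 0
    (hinj : ∀ r : R, algebraMap R R1 r = 0 → algebraMap R R2 r = 0 → r = 0)
    (hmid : ∀ (x1 : R1) (x2 : R2), algebraMap R1 R12 x1 = algebraMap R2 R12 x2 →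
      ∃ r : R, algebraMap R R1 r = x1 ∧ algebraMap R R2 r = x2)
    -- (ii) strict surjectivity of R1 ⊕ R2 → R12
    (hstrict : ∃ C : ℝ, 0 < C ∧ ∀ z : R12, ∃ (x : R1) (y : R2),
      algebraMap R1 R12 x - algebraMap R2 R12 y = z ∧
      ν1.nrm x ≤ C * ν12.nrm z ∧ ν2.nrm y ≤ C * ν12.nrm z)
    -- (iii) density of the image of R2 in R12
    (hdense : ∀ (z : R12) (ε : ℝ), 0 < ε → ∃ y : R2, ν12.nrm (z - algebraMap R2 R12 y) < ε)
    -- the finite projective glueing datum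
    (M1 M2 M12 : Type*)
    [AddCommGroup M1] [Module R1 M1] [Module R M1] [IsScalarTower R R1 M1]
    [AddCommGroup M2] [Module R2 M2] [Module R M2] [IsScalarTower R R2 M2]
    [AddCommGroup M12] [Module R12 M12] [Module R M12] [IsScalarTower R R12 M12]
    [Module.Finite R1 M1] [Module.Projective R1 M1]
    [Module.Finite R2 M2] [Module.Projective R2 M2]
    [Module.Finite R12 M12] [Module.Projective R12 M12]
    (ψ1 : (R12 ⊗[R1] M1) ≃ₗ[R12] M12) (ψ2 : (R12 ⊗[R2] M2) ≃ₗ[R12] M12)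
    (δ : (M1 × M2) →ₗ[R] M12)
    (hδ : ∀ m : M1 × M2, δ m = ψ1 ((1 : R12) ⊗ₜ[R1] m.1) - ψ2 ((1 : R12) ⊗ₜ[R2] m.2)) :
    Module.FinitePresentation R (LinearMap.ker δ) ∧
    Function.Bijective
      (LinearMap.liftBaseChange R1
        ((LinearMap.fst R M1 M2).comp (LinearMap.ker δ).subtype)) ∧
    Function.Bijective
      (LinearMap.liftBaseChange R2
        ((LinearMap.snd R M1 M2).comp (LinearMap.ker δ).subtype)) := by
  have hfac := NABanachNorm.hasMatrixFactorization ν1 ν2 ν12 hb112 hb212 hstrict hdense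
  have hsq : GlueingSquare R R1 R2 R12 :=
    { comm := fun r ↦ by
        rw [← IsScalarTower.algebraMap_apply, ← IsScalarTower.algebraMap_apply]
      eq_zero := hinj
      exists_lift := hmid
      exists_sub := fun z ↦ by
        obtain ⟨C, -, hC⟩ := hstrict
        obtain ⟨x, y, h, -⟩ := hC z
        exact ⟨x, y, h⟩
      factorization := hfac }
  have hmem (m1 : M1) (m2 : M2) :
      (m1, m2) ∈ LinearMap.ker δ ↔ ψ1.tensorUnitMap m1 = ψ2.tensorUnitMap m2 := by
    rw [LinearMap.mem_ker, hδ, sub_eq_zero]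
    rfl
  obtain ⟨ι, _, x, y, κ, _, t, hxy, ht1, ht2, hk1, hk2, hk⟩ := hsq.exists_presentation
    (isProjectiveBaseChange_of_equiv ψ1 ψ1.tensorUnitMap fun _ ↦ rfl)
    (isProjectiveBaseChange_of_equiv ψ2 ψ2.tensorUnitMap fun _ ↦ rfl)
  let e (i : ι) : LinearMap.ker δ := ⟨(x i, y i), (hmem _ _).2 (hxy.compatible i)⟩
  have he1 (r : ι → R) : (Fintype.linearCombination R e r).1.1 =
      Fintype.linearCombination R1 x (algebraMap R R1 ∘ r) := by
    simp [Fintype.linearCombination_apply, e, Prod.fst_sum]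
  have he2 (r : ι → R) : (Fintype.linearCombination R e r).1.2 =
      Fintype.linearCombination R2 y (algebraMap R R2 ∘ r) := by
    simp [Fintype.linearCombination_apply, e, Prod.snd_sum]
  have hesurj : Function.Surjective (Fintype.linearCombination R e) := by
    rintro ⟨⟨m1, m2⟩, hm⟩
    obtain ⟨r, hr1, hr2⟩ := hxy.exists_coeff ((hmem _ _).1 hm)
    exact ⟨r, Subtype.ext (Prod.ext ((he1 r).trans hr1) ((he2 r).trans hr2))⟩
  have hespan : Submodule.span R (Set.range e) = ⊤ := by
    rw [← Fintype.range_linearCombination, LinearMap.range_eq_top.2 hesurj]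
  have hte (k : κ) : Fintype.linearCombination R e (t k) = 0 :=
    Subtype.ext (Prod.ext ((he1 _).trans (ht1 k)) ((he2 _).trans (ht2 k)))
  refine ⟨Module.finitePresentation_of_surjective _ hesurj ?_,
    bijective_liftBaseChange _ hespan hte hxy.span_left hk1,
    bijective_liftBaseChange _ hespan hte hxy.span_right hk2⟩
  have hker : LinearMap.ker (Fintype.linearCombination R e) = Submodule.span R (Set.range t) := by
    refine le_antisymm (fun r hr ↦ ?_) (Submodule.span_le.2 ?_)
    · rw [LinearMap.mem_ker] at hr
      exact hk r (by rw [← he1, hr]; rfl) (by rw [← he2, hr]; rfl)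
    · rintro _ ⟨k, rfl⟩
      exact hte k
  rw [hker]
  exact Submodule.fg_span (Set.finite_range t)
end

section
/- Let R1, R2, S be nonarchimedean Banach rings, and let f1 : R1 → S and f2 : R2 → S be bounded ring homomorphisms such that the additive map ψ : R1 ⊕ R2 → S given by ψ(x, y) = f1(x) + f2(y) is strict surjective: there exists d > 0 such that every z ∈ S can be written as z = f1(x) + f2(y) with ‖x‖ ≤ d‖z‖ and ‖y‖ ≤ d‖z‖. Then there exists c > 0 such that for every positive integer n, every invertible n×n matrix U over S satisfying ‖U − 1‖ < c (where the norm of a matrix is the maximum of the norms of its entries) can be written as U = f1(U1)·f2(U2) for some invertible n×n matrix U1 over R1 and some invertible n×n matrix U2 over R2, where f_i is applied entrywise. -/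
open Filter Topology

/-- The symmetrization `max (‖x‖, ‖-x‖)` of the norm, as a ring norm. -/
def NABanachNorm.toRingNorm_s14 {A : Type*} [CommRing A] (ν : NABanachNorm A) : RingNorm A where
  toFun x := max (ν.nrm x) (ν.nrm (-x))
  map_zero' := by simp [(ν.eq_zero_iff 0).2 rfl]
  add_le' x y := by
    have hx := ν.nonneg x
    have hy := ν.nonneg y
    refine max_le ((ν.nonarch x y).trans ?_) ?_
    · refine max_le ?_ ?_ <;>
        linarith [le_max_left (ν.nrm x) (ν.nrm (-x)), le_max_left (ν.nrm y) (ν.nrm (-y))]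
    · rw [neg_add]
      refine (ν.nonarch (-x) (-y)).trans (max_le ?_ ?_)
      · linarith [le_max_right (ν.nrm x) (ν.nrm (-x)), le_max_left (ν.nrm y) (ν.nrm (-y))]
      · linarith [le_max_left (ν.nrm x) (ν.nrm (-x)), le_max_right (ν.nrm y) (ν.nrm (-y))]
  neg' x := by simp [max_comm]
  mul_le' x y := by
    have hy := ν.nonneg y
    have hx := (ν.nonneg x).trans (le_max_left (ν.nrm x) (ν.nrm (-x)))
    refine max_le ((ν.submul x y).trans ?_) ?_
    · exact mul_le_mul (le_max_left _ _) (le_max_left _ _) hy hx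
    · rw [← neg_mul]
      exact (ν.submul (-x) y).trans (mul_le_mul (le_max_right _ _) (le_max_left _ _) hy hx)
  eq_zero_of_map_eq_zero' x h := by
    refine (ν.eq_zero_iff x).1 (le_antisymm ?_ (ν.nonneg x))
    exact h ▸ le_max_left (ν.nrm x) (ν.nrm (-x))

/-- The normed ring structure given by the symmetrized norm. -/
@[reducible]
def NABanachNorm.toNormedRing {A : Type*} [CommRing A] (ν : NABanachNorm A) : NormedRing A :=
  ν.toRingNorm_s14.toNormedRing

theorem NABanachNorm.norm_def {A : Type*} [CommRing A] (ν : NABanachNorm A) (x : A) :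
    ν.toNormedRing.norm x = max (ν.nrm x) (ν.nrm (-x)) := rfl

theorem NABanachNorm.exists_norm_le {A : Type*} [CommRing A] (ν : NABanachNorm A) :
    ∃ K : ℝ, 0 < K ∧ ∀ x, ν.toNormedRing.norm x ≤ K * ν.nrm x := by
  refine ⟨max 1 (ν.nrm (-1)), by positivity, fun x => ?_⟩
  rw [ν.norm_def]
  have hx := ν.nonneg x
  refine max_le ?_ ?_
  · simpa using mul_le_mul_of_nonneg_right (le_max_left 1 (ν.nrm (-1))) hx
  · rw [← neg_one_mul]
    exact (ν.submul _ _).trans (mul_le_mul_of_nonneg_right (le_max_right _ _) hx)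

theorem NABanachNorm.isUltrametricDist {A : Type*} [CommRing A] (ν : NABanachNorm A) :
    letI := ν.toNormedRing
    IsUltrametricDist A := by
  let := ν.toNormedRing
  refine IsUltrametricDist.isUltrametricDist_of_forall_norm_add_le_max_norm fun x y => ?_
  rw [ν.norm_def, ν.norm_def, ν.norm_def, neg_add]
  exact max_le ((ν.nonarch x y).trans (max_le_max (le_max_left _ _) (le_max_left _ _)))
    ((ν.nonarch (-x) (-y)).trans (max_le_max (le_max_right _ _) (le_max_right _ _)))

theorem NABanachNorm.completeSpace_s14 {A : Type*} [CommRing A] (ν : NABanachNorm A) :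
    letI := ν.toNormedRing
    CompleteSpace A := by
  let := ν.toNormedRing
  obtain ⟨K, hK, hle⟩ := ν.exists_norm_le
  refine Metric.complete_of_cauchySeq_tendsto fun u hu => ?_
  rw [Metric.cauchySeq_iff] at hu
  obtain ⟨x, hx⟩ := ν.complete u fun ε hε => by
    obtain ⟨N, hN⟩ := hu ε hε
    refine ⟨N, fun m hm n hn => lt_of_le_of_lt ?_ (hN m hm n hn)⟩
    rw [dist_eq_norm]
    exact le_max_left _ _
  refine ⟨x, Metric.tendsto_atTop.2 fun ε hε => ?_⟩
  obtain ⟨N, hN⟩ := hx (ε / K) (by positivity)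
  refine ⟨N, fun n hn => ?_⟩
  rw [dist_eq_norm]
  refine (hle _).trans_lt ?_
  rw [mul_comm]
  exact (lt_div_iff₀ hK).1 (hN n hn)

/-- The normed ring structure on matrices over an ultrametric normed ring
given by the maximum of the norms of the entries. -/
@[reducible]
def Matrix.ultrametricNormedRing (m R : Type*) [Fintype m] [DecidableEq m] [NormedRing R]
    [IsUltrametricDist R] : NormedRing (Matrix m m R) where
  __ := Matrix.instRing
  __ := Matrix.normedAddCommGroup
  norm_mul_le A B := by
    let : NormedAddCommGroup (Matrix m m R) := Matrix.normedAddCommGroup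
    change ‖A * B‖ ≤ ‖A‖ * ‖B‖
    refine (Matrix.norm_le_iff (by positivity)).2 fun i j => ?_
    rw [Matrix.mul_apply]
    refine IsUltrametricDist.norm_sum_le_of_forall_le_of_nonneg (by positivity) fun k _ => ?_
    exact (norm_mul_le _ _).trans (mul_le_mul (Matrix.norm_entry_le_entrywise_sup_norm A)
      (Matrix.norm_entry_le_entrywise_sup_norm B) (norm_nonneg _) (norm_nonneg _))

section Ultrametric

variable {A B A₁ A₂ : Type*} [NormedRing A] [IsUltrametricDist A] [NormedRing B]
  [IsUltrametricDist B] [NormedRing A₁] [IsUltrametricDist A₁] [NormedRing A₂]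
  [IsUltrametricDist A₂]

theorem exists_isUnit_tendsto_of_norm_sub_le [CompleteSpace A] {P : ℕ → A} (h0 : P 0 = 1)
    (h : ∀ k, ‖P k - 1‖ ≤ 1 / 2 → ‖P (k + 1) - P k‖ ≤ 1 / 2 * (1 / 2) ^ k) :
    ∃ a, IsUnit a ∧ Tendsto P atTop (𝓝 a) := by
  have hP : ∀ k, ‖P k - 1‖ ≤ 1 / 2 := by
    intro k
    induction k with
    | zero => simp [h0]
    | succ k ih =>
      rw [← sub_add_sub_cancel (P (k + 1)) (P k) 1]
      refine (IsUltrametricDist.norm_add_le_max _ _).trans (max_le ((h k ih).trans ?_) ih)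
      have : ((1 : ℝ) / 2) ^ k ≤ 1 := pow_le_one₀ (by norm_num) (by norm_num)
      linarith
  have hcau : CauchySeq P := cauchySeq_of_le_geometric (1 / 2) (1 / 2) (by norm_num) fun k => by
    rw [dist_comm, dist_eq_norm]
    exact h k (hP k)
  obtain ⟨a, ha⟩ := cauchySeq_tendsto_of_complete hcau
  have hle : ‖a - 1‖ ≤ 1 / 2 := le_of_tendsto (ha.sub_const 1).norm (.of_forall hP)
  refine ⟨a, ?_, ha⟩
  rw [← sub_sub_cancel 1 a]
  refine isUnit_one_sub_of_norm_lt_one ?_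
  rw [norm_sub_rev]
  linarith

theorem norm_mul_le_of_norm_sub_one_le_one {x p : A} (hp : ‖p - 1‖ ≤ 1) : ‖x * p‖ ≤ ‖x‖ := by
  rw [show x * p = x + x * (p - 1) by noncomm_ring]
  exact (IsUltrametricDist.norm_add_le_max _ _).trans (max_le le_rfl
    ((norm_mul_le _ _).trans (mul_le_of_le_one_right (norm_nonneg _) hp)))

theorem norm_mul_le_of_norm_sub_one_le_one' {x p : A} (hp : ‖p - 1‖ ≤ 1) : ‖p * x‖ ≤ ‖x‖ := by
  rw [show p * x = x + (p - 1) * x by noncomm_ring]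
  exact (IsUltrametricDist.norm_add_le_max _ _).trans (max_le le_rfl
    ((norm_mul_le _ _).trans (mul_le_of_le_one_left (norm_nonneg _) hp)))

theorem norm_one_sub_mul_one_add_mul_one_sub_sub_one_le {x y : B} {M t : ℝ} (hM : 1 ≤ M)
    (ht : t ≤ 1) (hxy : ‖x + y‖ ≤ t) (hx : ‖x‖ ≤ M * t) (hy : ‖y‖ ≤ M * t) :
    ‖(1 - x) * (1 + (x + y)) * (1 - y) - 1‖ ≤ M ^ 2 * t ^ 2 := by
  have ht0 : 0 ≤ t := (norm_nonneg _).trans hxy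
  have hMt : 0 ≤ M * t := by positivity
  have hle : M * t * t ≤ M ^ 2 * t ^ 2 := by
    nlinarith [mul_le_mul_of_nonneg_right hM (by positivity : 0 ≤ M * t ^ 2)]
  have h1 : ‖x * (x + y)‖ ≤ M * t * t := norm_mul_le_of_le hx hxy
  have h2 : ‖(x + y) * y‖ ≤ t * (M * t) := norm_mul_le_of_le hxy hy
  have h3 : ‖x * y‖ ≤ M * t * (M * t) := norm_mul_le_of_le hx hy
  have h4 : ‖x * (x + y) * y‖ ≤ M * t * t * (M * t) := norm_mul_le_of_le h1 hy
  have e : (1 - x) * (1 + (x + y)) * (1 - y) - 1 =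
      (x * y + x * (x + y) * y) + (-(x * (x + y)) + -((x + y) * y)) := by noncomm_ring
  rw [e]
  refine (IsUltrametricDist.norm_add_le_max _ _).trans (max_le ?_ ?_)
  · refine (IsUltrametricDist.norm_add_le_max _ _).trans (max_le ?_ ?_)
    · linarith
    · have := mul_le_mul_of_nonneg_left ht (by positivity : 0 ≤ M ^ 2 * t ^ 2)
      linarith
  · refine (IsUltrametricDist.norm_add_le_max _ _).trans (max_le ?_ ?_) <;> rw [norm_neg] <;>
      linarith

theorem exists_isUnit_map_mul_map_eq [CompleteSpace A₁] [CompleteSpace A₂]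
    (g₁ : A₁ →+* B) (g₂ : A₂ →+* B) {C d : ℝ} (hC : 0 < C) (hd : 0 < d)
    (hg₁ : ∀ x, ‖g₁ x‖ ≤ C * ‖x‖) (hg₂ : ∀ x, ‖g₂ x‖ ≤ C * ‖x‖)
    (hstrict : ∀ z, ∃ x y, g₁ x + g₂ y = z ∧ ‖x‖ ≤ d * ‖z‖ ∧ ‖y‖ ≤ d * ‖z‖)
    {u : B} (hu : ‖u - 1‖ ≤ 1 / (2 * ((C * d + 1) ^ 2 + d))) :
    ∃ u₁ u₂, IsUnit u₁ ∧ IsUnit u₂ ∧ u = g₁ u₁ * g₂ u₂ := by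
  choose s₁ s₂ hs hs₁ hs₂ using hstrict
  set M := C * d + 1 with hM
  set c := 1 / (2 * (M ^ 2 + d)) with hc
  have hM1 : 1 ≤ M := by rw [hM]; nlinarith [mul_pos hC hd]
  have hM2 : 1 ≤ M ^ 2 := one_le_pow₀ hM1
  have hc0 : 0 < c := by positivity
  have hce : M ^ 2 * c + d * c = 1 / 2 := by rw [hc]; field_simp
  have hdc : d * c ≤ 1 / 2 := by nlinarith
  have hMc : M ^ 2 * c ≤ 1 / 2 := by nlinarith
  have hc1 : c ≤ 1 := by nlinarith
  let a : ℕ → B := fun k =>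
    k.rec (u - 1) fun _ a => (1 - g₁ (s₁ a)) * (1 + a) * (1 - g₂ (s₂ a)) - 1
  let P : ℕ → A₁ := fun k => k.rec 1 fun k P => (1 - s₁ (a k)) * P
  let Q : ℕ → A₂ := fun k => k.rec 1 fun k Q => Q * (1 - s₂ (a k))
  have ha_succ (k) : a (k + 1) =
    (1 - g₁ (s₁ (a k))) * (1 + a k) * (1 - g₂ (s₂ (a k))) - 1 := rfl
  have hP_succ (k) : P (k + 1) = (1 - s₁ (a k)) * P k := rfl
  have hQ_succ (k) : Q (k + 1) = Q k * (1 - s₂ (a k)) := rfl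
  have ha (k) : ‖a k‖ ≤ c * (1 / 2) ^ k := by
    induction k with
    | zero => simpa [a] using hu
    | succ k ih =>
      set t := c * (1 / 2) ^ k with ht
      have htc : t ≤ c :=
        mul_le_of_le_one_right hc0.le (pow_le_one₀ (by norm_num) (by norm_num))
      have ht0 : 0 ≤ t := by positivity
      have hbound {x : ℝ} (hx : x ≤ d * ‖a k‖) : C * x ≤ M * t := by
        have h1 : C * x ≤ C * (d * t) := by gcongr; exact hx.trans (by gcongr)
        rw [hM]; linarith
      have key := norm_one_sub_mul_one_add_mul_one_sub_sub_one_le (x := g₁ (s₁ (a k)))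
        (y := g₂ (s₂ (a k))) hM1 (htc.trans hc1) (by rwa [hs])
        ((hg₁ _).trans (hbound (hs₁ _))) ((hg₂ _).trans (hbound (hs₂ _)))
      rw [hs, ← ha_succ] at key
      refine key.trans ?_
      have h2 : M ^ 2 * t ≤ 1 / 2 := (mul_le_mul_of_nonneg_left htc (by positivity)).trans hMc
      have h3 := mul_le_mul_of_nonneg_right h2 ht0
      calc M ^ 2 * t ^ 2 = M ^ 2 * t * t := by ring
        _ ≤ 1 / 2 * t := h3
        _ = c * (1 / 2) ^ (k + 1) := by rw [ht]; ring
  have hsmall {x : ℝ} {k : ℕ} (hx : x ≤ d * ‖a k‖) : x ≤ 1 / 2 * (1 / 2) ^ k := by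
    calc x ≤ d * (c * (1 / 2) ^ k) := hx.trans (by gcongr; exact ha k)
      _ = d * c * (1 / 2) ^ k := by ring
      _ ≤ 1 / 2 * (1 / 2) ^ k := by gcongr
  obtain ⟨p, hp, hPp⟩ := exists_isUnit_tendsto_of_norm_sub_le (P := P) rfl fun k hk => by
    rw [hP_succ, show (1 - s₁ (a k)) * P k - P k = -(s₁ (a k) * P k) by noncomm_ring, norm_neg]
    exact (norm_mul_le_of_norm_sub_one_le_one (hk.trans (by norm_num))).trans (hsmall (hs₁ _))
  obtain ⟨q, hq, hQq⟩ := exists_isUnit_tendsto_of_norm_sub_le (P := Q) rfl fun k hk => by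
    rw [hQ_succ, show Q k * (1 - s₂ (a k)) - Q k = -(Q k * s₂ (a k)) by noncomm_ring, norm_neg]
    exact (norm_mul_le_of_norm_sub_one_le_one' (hk.trans (by norm_num))).trans (hsmall (hs₂ _))
  have hinv (k) : g₁ (P k) * u * g₂ (Q k) = 1 + a k := by
    induction k with
    | zero => simp [P, Q, a]
    | succ k ih =>
      rw [hP_succ, hQ_succ, ha_succ, ← ih]
      simp only [map_mul, map_sub, map_one]
      noncomm_ring
  have ha0 : Tendsto a atTop (𝓝 0) := by
    refine squeeze_zero_norm ha ?_
    simpa using (tendsto_pow_atTop_nhds_zero_of_lt_one (r := (1 / 2 : ℝ)) (by norm_num)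
      (by norm_num)).const_mul c
  have hc₁ : Continuous g₁ := AddMonoidHomClass.continuous_of_bound g₁ C hg₁
  have hc₂ : Continuous g₂ := AddMonoidHomClass.continuous_of_bound g₂ C hg₂
  have hlim : g₁ p * u * g₂ q = 1 := by
    refine tendsto_nhds_unique (((hc₁.tendsto p).comp hPp |>.mul_const u).mul
      ((hc₂.tendsto q).comp hQq)) ?_
    simpa [Function.comp_def, hinv] using ha0.const_add 1
  obtain ⟨p, rfl⟩ := hp
  obtain ⟨q, rfl⟩ := hq
  refine ⟨↑p⁻¹, ↑q⁻¹, p⁻¹.isUnit, q⁻¹.isUnit, ?_⟩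
  have h1 : g₁ ↑p⁻¹ * g₁ p = 1 := by rw [← map_mul, p.inv_mul, map_one]
  have h2 : g₂ q * g₂ ↑q⁻¹ = 1 := by rw [← map_mul, q.mul_inv, map_one]
  calc u = g₁ ↑p⁻¹ * g₁ p * u * (g₂ q * g₂ ↑q⁻¹) := by rw [h1, h2, one_mul, mul_one]
    _ = g₁ ↑p⁻¹ * (g₁ p * u * g₂ q) * g₂ ↑q⁻¹ := by noncomm_ring
    _ = g₁ ↑p⁻¹ * g₂ ↑q⁻¹ := by rw [hlim, mul_one]

end Ultrametric

theorem Matrix.norm_mapMatrix_le {m A B : Type*} [Fintype m] [DecidableEq m] [NormedRing A]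
    [NormedRing B] [IsUltrametricDist A] [IsUltrametricDist B] (g : A →+* B) {C : ℝ} (hC : 0 < C)
    (hg : ∀ x, ‖g x‖ ≤ C * ‖x‖) (X : Matrix m m A) :
    letI := Matrix.ultrametricNormedRing m A
    letI := Matrix.ultrametricNormedRing m B
    ‖g.mapMatrix X‖ ≤ C * ‖X‖ := by
  let := Matrix.ultrametricNormedRing m A
  let := Matrix.ultrametricNormedRing m B
  refine (Matrix.norm_le_iff (by positivity)).2 fun i j => (hg _).trans ?_
  gcongr
  exact Matrix.norm_entry_le_entrywise_sup_norm X

theorem Matrix.exists_isUnit_map_mul_map_eq {m A₁ A₂ B : Type*} [Fintype m] [DecidableEq m]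
    [NormedRing A₁] [NormedRing A₂] [NormedRing B] [IsUltrametricDist A₁] [IsUltrametricDist A₂]
    [IsUltrametricDist B] [CompleteSpace A₁] [CompleteSpace A₂]
    (g₁ : A₁ →+* B) (g₂ : A₂ →+* B) {C d : ℝ} (hC : 0 < C) (hd : 0 < d)
    (hg₁ : ∀ x, ‖g₁ x‖ ≤ C * ‖x‖) (hg₂ : ∀ x, ‖g₂ x‖ ≤ C * ‖x‖)
    (hstrict : ∀ z, ∃ x y, g₁ x + g₂ y = z ∧ ‖x‖ ≤ d * ‖z‖ ∧ ‖y‖ ≤ d * ‖z‖)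
    {U : Matrix m m B} (hU : ∀ i j, ‖(U - 1) i j‖ ≤ 1 / (2 * ((C * d + 1) ^ 2 + d))) :
    ∃ (U₁ : Matrix m m A₁) (U₂ : Matrix m m A₂), IsUnit U₁ ∧ IsUnit U₂ ∧
      U = U₁.map g₁ * U₂.map g₂ := by
  let := Matrix.ultrametricNormedRing m A₁
  let := Matrix.ultrametricNormedRing m A₂
  let := Matrix.ultrametricNormedRing m B
  have : IsUltrametricDist (Matrix m m A₁) := inferInstanceAs (IsUltrametricDist (m → m → A₁))
  have : IsUltrametricDist (Matrix m m A₂) := inferInstanceAs (IsUltrametricDist (m → m → A₂))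
  have : IsUltrametricDist (Matrix m m B) := inferInstanceAs (IsUltrametricDist (m → m → B))
  have : @CompleteSpace (Matrix m m A₁) PseudoMetricSpace.toUniformSpace :=
    inferInstanceAs (CompleteSpace (m → m → A₁))
  have : @CompleteSpace (Matrix m m A₂) PseudoMetricSpace.toUniformSpace :=
    inferInstanceAs (CompleteSpace (m → m → A₂))
  refine _root_.exists_isUnit_map_mul_map_eq g₁.mapMatrix g₂.mapMatrix hC hd
    (Matrix.norm_mapMatrix_le g₁ hC hg₁) (Matrix.norm_mapMatrix_le g₂ hC hg₂)
    (fun Z => ?_) ((Matrix.norm_le_iff (by positivity)).2 hU)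
  choose s₁ s₂ hs hs₁ hs₂ using hstrict
  refine ⟨Z.map s₁, Z.map s₂, ?_, (Matrix.norm_le_iff (by positivity)).2 fun i j => ?_,
    (Matrix.norm_le_iff (by positivity)).2 fun i j => ?_⟩
  · ext i j
    exact hs (Z i j)
  · refine (hs₁ _).trans ?_
    gcongr
    exact Matrix.norm_entry_le_entrywise_sup_norm Z
  · refine (hs₂ _).trans ?_
    gcongr
    exact Matrix.norm_entry_le_entrywise_sup_norm Z

/-- (Cartan-type factorization.) If `ψ(x,y) = f1(x) + f2(y)` is strict
surjective with constant `d`, then there is `c > 0` such that every invertible matrix `U`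
over `S` with `‖U − 1‖ < c` factors as `U = f1(U1)·f2(U2)` with `Ui` invertible over `Ri`. -/
theorem cartan_matrix_factorization
    (R1 R2 S : Type*) [CommRing R1] [CommRing R2] [CommRing S]
    (ν1 : NABanachNorm R1) (ν2 : NABanachNorm R2) (νS : NABanachNorm S)
    (f1 : R1 →+* S) (f2 : R2 →+* S)
    (hb1 : ∃ C : ℝ, 0 < C ∧ ∀ x : R1, νS.nrm (f1 x) ≤ C * ν1.nrm x)
    (hb2 : ∃ C : ℝ, 0 < C ∧ ∀ x : R2, νS.nrm (f2 x) ≤ C * ν2.nrm x)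
    (d : ℝ) (hd : 0 < d)
    (hstrict : ∀ z : S, ∃ (x : R1) (y : R2), f1 x + f2 y = z ∧
      ν1.nrm x ≤ d * νS.nrm z ∧ ν2.nrm y ≤ d * νS.nrm z) :
    ∃ c : ℝ, 0 < c ∧ ∀ n : ℕ, 0 < n → ∀ U : Matrix (Fin n) (Fin n) S, IsUnit U →
      (∀ i j, νS.nrm ((U - 1) i j) < c) →
      ∃ (U1 : Matrix (Fin n) (Fin n) R1) (U2 : Matrix (Fin n) (Fin n) R2),
        IsUnit U1 ∧ IsUnit U2 ∧ U = U1.map f1 * U2.map f2 := by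
  obtain ⟨C₁, hC₁, hf₁⟩ := hb1
  obtain ⟨C₂, hC₂, hf₂⟩ := hb2
  obtain ⟨K₁, hK₁, hn₁⟩ := ν1.exists_norm_le
  obtain ⟨K₂, hK₂, hn₂⟩ := ν2.exists_norm_le
  obtain ⟨K, hK, hn⟩ := νS.exists_norm_le
  let := ν1.toNormedRing
  let := ν2.toNormedRing
  let := νS.toNormedRing
  have := ν1.isUltrametricDist
  have := ν2.isUltrametricDist
  have := νS.isUltrametricDist
  have := ν1.completeSpace_s14
  have := ν2.completeSpace_s14
  have hle₁ (x : R1) : ν1.nrm x ≤ ‖x‖ := le_max_left _ _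
  have hle₂ (x : R2) : ν2.nrm x ≤ ‖x‖ := le_max_left _ _
  have hle (x : S) : νS.nrm x ≤ ‖x‖ := le_max_left _ _
  have hC : 0 < K * max C₁ C₂ := by positivity
  have hD : 0 < max K₁ K₂ * d := by positivity
  have hg₁ (x : R1) : ‖f1 x‖ ≤ K * max C₁ C₂ * ‖x‖ := by
    rw [mul_assoc]
    refine (hn _).trans (mul_le_mul_of_nonneg_left ((hf₁ x).trans ?_) hK.le)
    exact mul_le_mul (le_max_left _ _) (hle₁ x) (ν1.nonneg x) (by positivity)
  have hg₂ (x : R2) : ‖f2 x‖ ≤ K * max C₁ C₂ * ‖x‖ := by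
    rw [mul_assoc]
    refine (hn _).trans (mul_le_mul_of_nonneg_left ((hf₂ x).trans ?_) hK.le)
    exact mul_le_mul (le_max_right _ _) (hle₂ x) (ν2.nonneg x) (by positivity)
  have hs (z : S) : ∃ (x : R1) (y : R2), f1 x + f2 y = z ∧
      ‖x‖ ≤ max K₁ K₂ * d * ‖z‖ ∧ ‖y‖ ≤ max K₁ K₂ * d * ‖z‖ := by
    obtain ⟨x, y, h, hx, hy⟩ := hstrict z
    have hz : d * νS.nrm z ≤ d * ‖z‖ := mul_le_mul_of_nonneg_left (hle z) hd.le
    refine ⟨x, y, h, ?_, ?_⟩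
    · rw [mul_assoc]
      exact (hn₁ x).trans
        (mul_le_mul (le_max_left _ _) (hx.trans hz) (ν1.nonneg x) (by positivity))
    · rw [mul_assoc]
      exact (hn₂ y).trans
        (mul_le_mul (le_max_right _ _) (hy.trans hz) (ν2.nonneg y) (by positivity))
  refine ⟨1 / (2 * ((K * max C₁ C₂ * (max K₁ K₂ * d) + 1) ^ 2 + max K₁ K₂ * d)) / K,
    by positivity, fun n _ U _ hU => ?_⟩
  refine Matrix.exists_isUnit_map_mul_map_eq f1 f2 hC hD hg₁ hg₂ hs fun i j => ?_
  refine (hn _).trans ?_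
  rw [mul_comm]
  exact ((lt_div_iff₀ hK).1 (hU i j)).le
end

section
/- Consider commutative rings R, R1, R2, R12 with ring homomorphisms R → R1 → R12 and R → R2 → R12 forming a commuting square such that the sequence 0 → R → R1 ⊕ R2 → R12 → 0 is exact, where R → R1 ⊕ R2 sends r to the pair of its images and R1 ⊕ R2 → R12 sends (x, y) to the difference of the images of x and y. Let (M1, M2, M12, ψ1, ψ2) be a glueing datum over this square in which M1 and M2 are finitely generated over R1 and R2 respectively, and suppose there exists a finitely generated R-submodule M0 of M such that the natural map M0 ⊗_R R1 → M1 is surjective. Then: (a) the map M1 ⊕ M2 → M12 sending (m1, m2) to ψ1(m1 ⊗ 1) − ψ2(m2 ⊗ 1) is surjective; and (b) there exists a finitely generated R-submodule M0' of M such that both natural maps M0' ⊗_R R1 → M1 and M0' ⊗_R R2 → M2 are surjective. -/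
open TensorProduct

/-- The base change of a linear map `f` restricted to a submodule `N` is surjective iff the image
of `N` generates the target over the bigger ring. -/
theorem surjective_liftBaseChange_comp_subtype_iff {R A M P : Type*} [CommRing R] [CommRing A]
    [Algebra R A] [AddCommGroup M] [Module R M] [AddCommGroup P] [Module R P] [Module A P]
    [IsScalarTower R A P] (f : M →ₗ[R] P) (N : Submodule R M) :
    Function.Surjective (LinearMap.liftBaseChange A (f.comp N.subtype)) ↔
      Submodule.span A (f '' N) = ⊤ := by
  rw [← LinearMap.range_eq_top, LinearMap.range_liftBaseChange, LinearMap.range_comp,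
    Submodule.range_subtype, Submodule.map_coe]

/-- If `S ⊆ M1 × M2` consists of pairs with equal images in `M12` and its first projection
generates `M1`, then every element of `M12` is a difference of images in which the second term
comes from the span of the second projection of `S`. -/
theorem exists_sub_eq_of_span_fst_eq_top {R1 R2 R12 M1 M2 M12 : Type*}
    [CommRing R1] [CommRing R2] [CommRing R12] [Algebra R1 R12] [Algebra R2 R12]
    (hsurj : ∀ z : R12, ∃ (x1 : R1) (x2 : R2),
      algebraMap R1 R12 x1 - algebraMap R2 R12 x2 = z)
    [AddCommGroup M1] [Module R1 M1] [AddCommGroup M2] [Module R2 M2]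
    [AddCommGroup M12] [Module R12 M12]
    (ψ1 : (R12 ⊗[R1] M1) ≃ₗ[R12] M12) (ψ2 : (R12 ⊗[R2] M2) ≃ₗ[R12] M12)
    (S : Set (M1 × M2))
    (hS : ∀ m ∈ S, ψ1 ((1 : R12) ⊗ₜ[R1] m.1) = ψ2 ((1 : R12) ⊗ₜ[R2] m.2))
    (hspan : Submodule.span R1 (Prod.fst '' S) = ⊤) (z : M12) :
    ∃ m1 : M1, ∃ m2 ∈ Submodule.span R2 (Prod.snd '' S),
      ψ1 ((1 : R12) ⊗ₜ[R1] m1) - ψ2 ((1 : R12) ⊗ₜ[R2] m2) = z := by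
  obtain ⟨t, rfl⟩ := ψ1.surjective z
  have ht : t ∈ Submodule.span R12 (TensorProduct.mk R1 R12 M1 1 '' (Prod.fst '' S)) := by
    rw [← Submodule.baseChange_span, hspan, Submodule.baseChange_top]
    trivial
  induction ht using Submodule.closure_induction with
  | zero => exact ⟨0, 0, Submodule.zero_mem _, by simp⟩
  | add s t _ _ hs ht =>
    obtain ⟨a1, a2, ha, has⟩ := hs
    obtain ⟨b1, b2, hb, hbt⟩ := ht
    refine ⟨a1 + b1, a2 + b2, Submodule.add_mem _ ha hb, ?_⟩
    rw [map_add, ← has, ← hbt, TensorProduct.tmul_add, TensorProduct.tmul_add, map_add, map_add]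
    abel
  | smul_mem r t ht =>
    obtain ⟨_, ⟨m, hm, rfl⟩, rfl⟩ := ht
    obtain ⟨x1, x2, rfl⟩ := hsurj r
    refine ⟨x1 • m.1, x2 • m.2,
      Submodule.smul_mem _ _ (Submodule.subset_span ⟨m, hm, rfl⟩), ?_⟩
    rw [TensorProduct.tmul_smul, TensorProduct.tmul_smul, ← algebraMap_smul R12 x1,
      ← algebraMap_smul R12 x2, map_smul, map_smul, ← hS m hm, TensorProduct.mk_apply, map_smul,
      sub_smul]

/-- Given a commuting square of rings with
`0 → R → R1 ⊕ R2 → R12 → 0` exact, and a glueing datum `(M1, M2, M12, ψ1, ψ2)` with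
`M1`, `M2` finitely generated, if some finitely generated `R`-submodule `M0` of the kernel
module `M` surjects onto `M1` after base change to `R1`, then (a) the difference map
`M1 ⊕ M2 → M12` is surjective, and (b) `M0` can be enlarged to a finitely generated
`M0' ⊆ M` surjecting onto both `M1` and `M2` after base change. -/
theorem glueing_datum_generators
    (R R1 R2 R12 : Type*) [CommRing R] [CommRing R1] [CommRing R2] [CommRing R12]
    [Algebra R R1] [Algebra R R2] [Algebra R R12]
    [Algebra R1 R12] [Algebra R2 R12]
    [IsScalarTower R R1 R12] [IsScalarTower R R2 R12]
    -- exactness of 0 → R → R1 ⊕ R2 → R12 → 0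
    (hinj : ∀ r : R, algebraMap R R1 r = 0 → algebraMap R R2 r = 0 → r = 0)
    (hmid : ∀ (x1 : R1) (x2 : R2), algebraMap R1 R12 x1 = algebraMap R2 R12 x2 →
      ∃ r : R, algebraMap R R1 r = x1 ∧ algebraMap R R2 r = x2)
    (hsurj : ∀ z : R12, ∃ (x1 : R1) (x2 : R2),
      algebraMap R1 R12 x1 - algebraMap R2 R12 x2 = z)
    -- the glueing datum
    (M1 M2 M12 : Type*)
    [AddCommGroup M1] [Module R1 M1] [Module R M1] [IsScalarTower R R1 M1]
    [AddCommGroup M2] [Module R2 M2] [Module R M2] [IsScalarTower R R2 M2]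
    [AddCommGroup M12] [Module R12 M12] [Module R M12] [IsScalarTower R R12 M12]
    [Module.Finite R1 M1] [Module.Finite R2 M2]
    (ψ1 : (R12 ⊗[R1] M1) ≃ₗ[R12] M12) (ψ2 : (R12 ⊗[R2] M2) ≃ₗ[R12] M12)
    (δ : (M1 × M2) →ₗ[R] M12)
    (hδ : ∀ m : M1 × M2, δ m = ψ1 ((1 : R12) ⊗ₜ[R1] m.1) - ψ2 ((1 : R12) ⊗ₜ[R2] m.2))
    -- the finitely generated submodule M0 of M = ker δ
    (M0 : Submodule R (M1 × M2)) (hM0 : M0 ≤ LinearMap.ker δ) (hM0fg : M0.FG)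
    (hM0surj : Function.Surjective
      (LinearMap.liftBaseChange R1 ((LinearMap.fst R M1 M2).comp M0.subtype))) :
    Function.Surjective δ ∧
    ∃ M0' : Submodule R (M1 × M2), M0' ≤ LinearMap.ker δ ∧ M0'.FG ∧
      Function.Surjective
        (LinearMap.liftBaseChange R1 ((LinearMap.fst R M1 M2).comp M0'.subtype)) ∧
      Function.Surjective
        (LinearMap.liftBaseChange R2 ((LinearMap.snd R M1 M2).comp M0'.subtype)) := by
  rw [surjective_liftBaseChange_comp_subtype_iff] at hM0surj
  have key := exists_sub_eq_of_span_fst_eq_top hsurj ψ1 ψ2 (M0 : Set (M1 × M2))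
    (fun m hm => sub_eq_zero.mp ((hδ m).symm.trans (hM0 hm))) hM0surj
  refine ⟨fun z => ?_, ?_⟩
  · obtain ⟨m1, m2, -, h⟩ := key z
    exact ⟨(m1, m2), (hδ _).trans h⟩
  obtain ⟨G, hG⟩ := Module.Finite.fg_top (R := R2) (M := M2)
  choose a b hb hab using fun g : M2 => key (ψ2 ((1 : R12) ⊗ₜ[R2] g))
  let lift : M2 → M1 × M2 := fun g => (a g, b g + g)
  have hlift (g : M2) : δ (lift g) = 0 := by
    rw [hδ, TensorProduct.tmul_add, map_add, ← sub_sub, hab, sub_self]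
  have hle : M0 ≤ M0 ⊔ Submodule.span R (lift '' G) := le_sup_left
  refine ⟨M0 ⊔ Submodule.span R (lift '' G), sup_le hM0 (Submodule.span_le.mpr ?_),
    hM0fg.sup (Submodule.fg_span (G.finite_toSet.image _)), ?_, ?_⟩
  · rintro _ ⟨g, -, rfl⟩
    exact hlift g
  · rw [surjective_liftBaseChange_comp_subtype_iff, ← top_le_iff, ← hM0surj]
    exact Submodule.span_mono (Set.image_mono hle)
  · rw [surjective_liftBaseChange_comp_subtype_iff, ← top_le_iff, ← hG, Submodule.span_le]
    intro g hg
    have h1 : b g ∈ Submodule.span R2 (LinearMap.snd R M1 M2 ''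
        (M0 ⊔ Submodule.span R (lift '' G) : Submodule R (M1 × M2))) :=
      Submodule.span_mono (Set.image_mono hle) (hb g)
    refine (Submodule.add_mem_iff_right _ h1).mp (Submodule.subset_span ⟨lift g, ?_, rfl⟩)
    exact le_sup_right (a := M0) (Submodule.subset_span (Set.mem_image_of_mem lift hg))
end
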